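/- arXiv:2501.08158 — 2 statements merged into one kernel-verified Lean document; each statement's English description precedes it below -/
import Mathlib

section
/- Let n ≥ 1 be an integer, q a prime power, and p an odd prime such that p divides q−1 and p > n(n−1). Then for every irreducible complex character χ of GL_n(F_q) (the group of invertible n×n matrices over the field with q elements) with p ∤ χ(1), Property 1.3 holds for (GL_n(F_q), χ, p). -/
open CategoryTheory

/-- `Qcyc N` is the `N`-th cyclotomic field `ℚ(ζ_N)`, realised as the subfield of `ℂ`
generated by all `N`-th roots of unity. -/
noncomputable def Qcyc (N : ℕ) : IntermediateField ℚ ℂ :=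
  IntermediateField.adjoin ℚ {z : ℂ | z ^ N = 1}

/-- `Qadj c` is the subfield `ℚ(c)` of `ℂ` generated by a complex number `c`. -/
noncomputable def Qadj (c : ℂ) : IntermediateField ℚ ℂ :=
  IntermediateField.adjoin ℚ {c}

/-- `f` is the conductor of the complex number `c`: the least positive integer `N`
with `c ∈ ℚ(ζ_N)`. -/
def IsConductorOf (c : ℂ) (f : ℕ) : Prop :=
  IsLeast {N : ℕ | 0 < N ∧ c ∈ Qcyc N} f

/-- `f` is the conductor of the character `χ`: the least positive integer `N` such that all
values of `χ` lie in `ℚ(ζ_N)`. -/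
def IsCharConductor {G : Type*} [Monoid G] (χ : G → ℂ) (f : ℕ) : Prop :=
  IsLeast {N : ℕ | 0 < N ∧ ∀ g, χ g ∈ Qcyc N} f

/-- Property 1.3 of Navarro–Tiep for `(G, χ, p)`: writing the conductor of `χ` as
`f = p ^ a * m` with `p ∤ m` (so that `p ^ a = p ^ (f.factorization p)` is the `p`-part of `f`),
there is a `p`-element `g ∈ G` such that `p ∤ [ℚ(ζ_{p^a}) : ℚ(χ(g))]`. -/
def Property13 {G : Type*} [Group G] (χ : G → ℂ) (p : ℕ) : Prop :=
  ∀ f : ℕ, IsCharConductor χ f →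
    ∃ g : G, (∃ j : ℕ, orderOf g = p ^ j) ∧
      ¬ p ∣ (Qadj (χ g)).relfinrank (Qcyc (p ^ f.factorization p))


set_option linter.unusedSectionVars false
set_option linter.unusedSimpArgs false
section GLbasics

variable {F : Type} [Field F] {n : ℕ}

/-- diagonal matrices in `GL_n` -/
noncomputable def dg : (Fin n → Fˣ) →* Matrix.GeneralLinearGroup (Fin n) F where
  toFun t := ⟨Matrix.diagonal fun i => (t i : F), Matrix.diagonal fun i => ((t i)⁻¹ : Fˣ).val,
    by simp [Matrix.diagonal_mul_diagonal], by simp [Matrix.diagonal_mul_diagonal]⟩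
  map_one' := by ext i j; simp
  map_mul' s t := by
    apply Units.ext
    simp [Matrix.diagonal_mul_diagonal]

/-- permutation matrices in `GL_n` -/
noncomputable def pm : Equiv.Perm (Fin n) →* Matrix.GeneralLinearGroup (Fin n) F where
  toFun σ := ⟨Matrix.of fun i j => if i = σ j then 1 else 0,
    Matrix.of fun i j => if i = σ⁻¹ j then 1 else 0,
    by ext i j; simp [Matrix.mul_apply, Matrix.one_apply],
    by ext i j; simp [Matrix.mul_apply, Matrix.one_apply]⟩
  map_one' := by ext i j; simp [Matrix.one_apply]; congr
  map_mul' s t := by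
    apply Units.ext
    ext i j; simp [Matrix.mul_apply]; congr

/-- transvections in `GL_n` -/
noncomputable def tv (i j : Fin n) (h : i ≠ j) (c : F) : Matrix.GeneralLinearGroup (Fin n) F :=
  ⟨Matrix.transvection i j c, Matrix.transvection i j (-c),
    by rw [Matrix.transvection_mul_transvection_same _ _ h]; simp,
    by rw [Matrix.transvection_mul_transvection_same _ _ h]; simp⟩

lemma gl_ext {g h : Matrix.GeneralLinearGroup (Fin n) F}
    (H : ∀ a b, (g : Matrix (Fin n) (Fin n) F) a b = (h : Matrix (Fin n) (Fin n) F) a b) : g = h :=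
  Units.ext (Matrix.ext H)

lemma dg_apply (t : Fin n → Fˣ) (a b : Fin n) :
    (dg t : Matrix (Fin n) (Fin n) F) a b = if a = b then (t a : F) else 0 := by
  simp [dg, Matrix.diagonal_apply]

lemma pm_apply (σ : Equiv.Perm (Fin n)) (a b : Fin n) :
    ((pm σ : Matrix.GeneralLinearGroup (Fin n) F) : Matrix (Fin n) (Fin n) F) a b
      = if a = σ b then 1 else 0 := by
  simp [pm]

lemma tv_apply (i j : Fin n) (h : i ≠ j) (c : F) (a b : Fin n) :
    (tv i j h c : Matrix (Fin n) (Fin n) F) a b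
      = (if a = b then 1 else 0) + (if a = i ∧ b = j then c else 0) := by
  simp [tv, Matrix.transvection, Matrix.one_apply, Matrix.single_apply, eq_comm]

lemma dg_mul_apply (t : Fin n → Fˣ) (g : Matrix.GeneralLinearGroup (Fin n) F) (a b : Fin n) :
    ((dg t * g : Matrix.GeneralLinearGroup (Fin n) F) : Matrix (Fin n) (Fin n) F) a b
      = t a * g a b := by
  simp [dg]

lemma mul_dg_apply (t : Fin n → Fˣ) (g : Matrix.GeneralLinearGroup (Fin n) F) (a b : Fin n) :
    ((g * dg t : Matrix.GeneralLinearGroup (Fin n) F) : Matrix (Fin n) (Fin n) F) a b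
      = g a b * t b := by
  simp [dg]

lemma pm_mul_apply (σ : Equiv.Perm (Fin n)) (g : Matrix.GeneralLinearGroup (Fin n) F)
    (a b : Fin n) :
    ((pm σ * g : Matrix.GeneralLinearGroup (Fin n) F) : Matrix (Fin n) (Fin n) F) a b
      = g (σ⁻¹ a) b := by
  rw [Units.val_mul, Matrix.mul_apply, Finset.sum_eq_single (σ⁻¹ a)]
  · simp [pm_apply]
  · intro c _ hc
    rw [pm_apply, if_neg, zero_mul]
    rintro rfl
    simp at hc
  · simp

lemma mul_pm_apply (σ : Equiv.Perm (Fin n)) (g : Matrix.GeneralLinearGroup (Fin n) F)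
    (a b : Fin n) :
    ((g * pm σ : Matrix.GeneralLinearGroup (Fin n) F) : Matrix (Fin n) (Fin n) F) a b
      = g a (σ b) := by
  simp [Matrix.mul_apply, pm_apply]

lemma tv_mul_apply (i j : Fin n) (h : i ≠ j) (c : F) (g : Matrix.GeneralLinearGroup (Fin n) F)
    (a b : Fin n) :
    ((tv i j h c * g : Matrix.GeneralLinearGroup (Fin n) F) : Matrix (Fin n) (Fin n) F) a b
      = g a b + if a = i then c * g j b else 0 := by
  rw [Units.val_mul, Matrix.mul_apply]
  simp only [tv_apply, add_mul, Finset.sum_add_distrib]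
  congr 1
  · simp
  · by_cases ha : a = i <;> simp [ha]

lemma mul_tv_apply (i j : Fin n) (h : i ≠ j) (c : F) (g : Matrix.GeneralLinearGroup (Fin n) F)
    (a b : Fin n) :
    ((g * tv i j h c : Matrix.GeneralLinearGroup (Fin n) F) : Matrix (Fin n) (Fin n) F) a b
      = g a b + if b = j then g a i * c else 0 := by
  rw [Units.val_mul, Matrix.mul_apply]
  simp only [tv_apply, mul_add, Finset.sum_add_distrib]
  congr 1
  · simp
  · by_cases ha : b = j <;> simp [ha]

lemma pm_mul_dg (σ : Equiv.Perm (Fin n)) (t : Fin n → Fˣ) :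
    (pm σ * dg t : Matrix.GeneralLinearGroup (Fin n) F) = dg (fun i => t (σ⁻¹ i)) * pm σ := by
  apply gl_ext; intro a b
  rw [mul_dg_apply, dg_mul_apply, pm_apply]
  split_ifs with h
  · subst h; simp
  · simp

lemma dg_mul_pm (σ : Equiv.Perm (Fin n)) (t : Fin n → Fˣ) :
    (dg t * pm σ : Matrix.GeneralLinearGroup (Fin n) F) = pm σ * dg (fun i => t (σ i)) := by
  rw [pm_mul_dg]; simp

lemma pm_mul_tv (σ : Equiv.Perm (Fin n)) (i j : Fin n) (h : i ≠ j) (c : F) :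
    pm σ * tv i j h c = tv (σ i) (σ j) (σ.injective.ne h) c * pm σ := by
  apply gl_ext; intro a b
  rw [mul_tv_apply, tv_mul_apply, pm_apply, pm_apply, pm_apply]
  by_cases h1 : j = b <;> by_cases h2 : a = σ i <;> simp [h1, h2, eq_comm]

lemma tv_mul_tv (i j : Fin n) (h : i ≠ j) (c d : F) :
    tv i j h c * tv i j h d = tv i j h (c + d) := by
  apply Units.ext
  simp [tv, Matrix.transvection_mul_transvection_same _ _ h]

lemma dg_mul_tv (t : Fin n → Fˣ) (i j : Fin n) (h : i ≠ j) (c : F) :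
    dg t * tv i j h c = tv i j h (t i * c * (t j)⁻¹) * dg t := by
  apply gl_ext; intro a b
  rw [mul_tv_apply, tv_mul_apply, dg_apply, dg_apply, dg_apply]
  by_cases hb : b = j <;> by_cases ha : a = i
  · simp [ha, hb]
  · simp [ha, hb]
  · simp [ha, hb, Ne.symm hb]
  · simp [ha, hb]

/-- the torus element in the `SL_2` relation -/
noncomputable def hT (i j : Fin n) (c : Fˣ) : Fin n → Fˣ :=
  fun a => if a = i then -c⁻¹ else if a = j then c else 1

lemma tv_lower (i j : Fin n) (h : i ≠ j) (c : Fˣ) :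
    tv j i h.symm (c : F) = tv i j h ((c⁻¹ : Fˣ) : F) * (dg (hT i j c) * pm (Equiv.swap i j))
      * tv i j h ((c⁻¹ : Fˣ) : F) := by
  have key : tv i j h (-((c⁻¹ : Fˣ) : F)) * tv j i h.symm (c : F) * tv i j h (-((c⁻¹ : Fˣ) : F))
      = (dg (hT i j c) * pm (Equiv.swap i j)) := by
    apply gl_ext; intro a b
    rw [mul_tv_apply, tv_mul_apply, tv_mul_apply, dg_mul_apply, pm_apply]
    simp only [tv_apply, hT]
    by_cases ha : a = i
    · subst ha
      by_cases hb : b = a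
      · subst hb; simp [h, h.symm]
      · by_cases hb' : b = j
        · subst hb'; simp [h, h.symm]
        · have : Equiv.swap a j b = b := Equiv.swap_apply_of_ne_of_ne hb hb'
          simp [hb, hb', h, h.symm, this, Ne.symm hb, Ne.symm hb']
    · by_cases ha' : a = j
      · subst ha'
        by_cases hb : b = i
        · subst hb; simp [h, h.symm]
        · by_cases hb' : b = a
          · subst hb'; simp [h, h.symm]
          · have : Equiv.swap i a b = b := Equiv.swap_apply_of_ne_of_ne hb hb'
            simp [hb, hb', h, h.symm, this, Ne.symm hb, Ne.symm hb']
      · by_cases hb : b = i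
        · subst hb; simp [h, h.symm, ha, ha']
        · by_cases hb' : b = j
          · subst hb'; simp [h, h.symm, ha, ha']
          · have : Equiv.swap i j b = b := Equiv.swap_apply_of_ne_of_ne hb hb'
            simp [hb, hb', h, h.symm, this, ha, ha']
  rw [← key]
  have e1 : tv i j h ((c⁻¹ : Fˣ) : F) * tv i j h (-((c⁻¹ : Fˣ) : F)) = 1 := by
    rw [tv_mul_tv, add_neg_cancel]; apply gl_ext; intro a b; simp [tv_apply, Matrix.one_apply]
  have e2 : tv i j h (-((c⁻¹ : Fˣ) : F)) * tv i j h ((c⁻¹ : Fˣ) : F) = 1 := by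
    rw [tv_mul_tv, neg_add_cancel]; apply gl_ext; intro a b; simp [tv_apply, Matrix.one_apply]
  calc _ = (tv i j h ((c⁻¹ : Fˣ) : F) * tv i j h (-((c⁻¹ : Fˣ) : F))) * tv j i h.symm (c : F) *
        (tv i j h (-((c⁻¹ : Fˣ) : F)) * tv i j h ((c⁻¹ : Fˣ) : F)) := by rw [e1, e2]; simp
    _ = _ := by group

lemma tv_zero (i j : Fin n) (h : i ≠ j) : tv i j h (0 : F) = 1 := by
  apply gl_ext; intro a b; simp [tv_apply, Matrix.one_apply]

/-- the unipotent radical attached to a function `κ` -/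
def Um [Finite F] (κ : Fin n → ℕ) : Subgroup (Matrix.GeneralLinearGroup (Fin n) F) :=
  let M : Submonoid (Matrix.GeneralLinearGroup (Fin n) F) :=
    { carrier := {g | ∀ i j, ¬ κ i < κ j → (g : Matrix (Fin n) (Fin n) F) i j
          = if i = j then 1 else 0}
      one_mem' := by intro i j _; simp [Matrix.one_apply]
      mul_mem' := by
        intro g h hg hh i j hij
        rw [Units.val_mul, Matrix.mul_apply]
        have : ∀ k, (g : Matrix (Fin n) (Fin n) F) i k * (h : Matrix (Fin n) (Fin n) F) k j
            = if k = i then (if i = j then 1 else 0) else 0 := by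
          intro k
          by_cases hik : κ i < κ k
          · have hki : k ≠ i := by rintro rfl; exact lt_irrefl _ hik
            have hkj : k ≠ j := by rintro rfl; exact hij hik
            rw [hh k j (by omega), if_neg hkj, if_neg hki, mul_zero]
          · rw [hg i k hik]
            by_cases h1 : i = k
            · subst h1; rw [hh i j hij]; simp
            · simp [h1, Ne.symm h1]
        simp [this] }
  { M with
    inv_mem' := by
      intro g hg
      have : g⁻¹ = g ^ (Nat.card (Matrix.GeneralLinearGroup (Fin n) F) - 1) := by
        rw [inv_eq_iff_mul_eq_one, ← pow_succ', Nat.sub_add_cancel Nat.card_pos, pow_card_eq_one']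
      show g⁻¹ ∈ M
      rw [this]
      exact M.pow_mem hg _ }

lemma mem_Um [Finite F] {κ : Fin n → ℕ} {g : Matrix.GeneralLinearGroup (Fin n) F} :
    g ∈ Um κ ↔ ∀ i j, ¬ κ i < κ j → (g : Matrix (Fin n) (Fin n) F) i j = if i = j then 1 else 0 :=
  Iff.rfl

/-- upper unitriangular matrices -/
def UU (F : Type) [Field F] [Finite F] (n : ℕ) : Subgroup (Matrix.GeneralLinearGroup (Fin n) F) :=
  Um (fun i => (i : ℕ))

lemma Um_le_UU [Finite F] {κ : Fin n → ℕ} (hκ : Monotone κ) : Um κ ≤ UU F n := by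
  intro g hg i j hij
  apply hg
  intro h
  exact absurd (hκ (not_lt.mp hij)) (not_le.mpr h)

lemma tv_mem_UU [Finite F] {i j : Fin n} (hij : i < j) (c : F) : tv i j hij.ne c ∈ UU F n := by
  intro a b hab
  rw [tv_apply]
  have : ¬ (a = i ∧ b = j) := by rintro ⟨rfl, rfl⟩; exact hab hij
  simp [this]

lemma dg_conj_UU [Finite F] {u : Matrix.GeneralLinearGroup (Fin n) F} (hu : u ∈ UU F n)
    (t : Fin n → Fˣ) : dg t * u * (dg t)⁻¹ ∈ UU F n := by
  intro a b hab
  rw [← map_inv, mul_dg_apply, dg_mul_apply, hu a b hab]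
  split_ifs with h
  · subst h; simp
  · simp

lemma dg_comm_Um [Finite F] {κ : Fin n → ℕ} (hκ : Monotone κ)
    {u : Matrix.GeneralLinearGroup (Fin n) F} (hu : u ∈ UU F n)
    (t : Fin n → Fˣ) (ht : ∀ i j, κ i = κ j → t i = t j) :
    dg t * u * (dg t)⁻¹ * u⁻¹ ∈ Um κ := by
  intro a b hab
  have huinv : u⁻¹ ∈ UU F n := inv_mem hu
  have h1 : ((dg t * u * (dg t)⁻¹ * u⁻¹ : Matrix.GeneralLinearGroup (Fin n) F)
      : Matrix (Fin n) (Fin n) F) a b - ((u * u⁻¹ : Matrix.GeneralLinearGroup (Fin n) F)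
      : Matrix (Fin n) (Fin n) F) a b = 0 := by
    rw [Units.val_mul _ u⁻¹, Units.val_mul u, Matrix.mul_apply, Matrix.mul_apply,
      ← Finset.sum_sub_distrib]
    apply Finset.sum_eq_zero
    intro k _
    rw [← sub_mul]
    by_cases hak : κ a = κ k
    · rw [← map_inv, mul_dg_apply, dg_mul_apply, ht a k hak]
      have : (t k : F) * (u : Matrix (Fin n) (Fin n) F) a k * ((t⁻¹ k : Fˣ) : F)
          = (u : Matrix (Fin n) (Fin n) F) a k := by
        rw [mul_right_comm]; simp
      rw [this]; simp
    · by_cases hlt : a < k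
      · have h2 : κ a < κ k := lt_of_le_of_ne (hκ hlt.le) hak
        have h3 : ¬ k ≤ b := fun h => hab (lt_of_lt_of_le h2 (hκ h))
        have h4 : k ≠ b := fun h => h3 h.le
        rw [huinv k b (fun h => h3 (le_of_lt h)), if_neg h4, mul_zero]
      · have : a ≠ k := fun h => hak (by rw [h])
        rw [dg_conj_UU hu t a k hlt, hu a k hlt, sub_self, zero_mul]
  rw [sub_eq_zero] at h1
  rw [h1]; simp [Matrix.one_apply]

/-- `U` elements with vanishing `(i, i+1)` entry are normalized by the simple reflection -/
lemma swap_conj_UU [Finite F] {i j : Fin n} (hij : (j : ℕ) = i + 1)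
    {u : Matrix.GeneralLinearGroup (Fin n) F} (hu : u ∈ UU F n)
    (h0 : (u : Matrix (Fin n) (Fin n) F) i j = 0) :
    pm (Equiv.swap i j) * u * pm (Equiv.swap i j) ∈ UU F n := by
  intro a b hab
  rw [mul_pm_apply, pm_mul_apply]
  have hs : (Equiv.swap i j)⁻¹ = Equiv.swap i j := Equiv.swap_inv i j
  rw [hs]
  simp only [UU, mem_Um] at hu
  have hab' : ¬ a < b := hab
  by_cases hc : Equiv.swap i j a < Equiv.swap i j b
  · -- then necessarily (a,b) = (j,i)
    have hne : a ≠ b := by rintro rfl; exact lt_irrefl _ hc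
    have : a = j ∧ b = i := by
      simp only [Equiv.swap_apply_def] at hc
      split_ifs at hc <;> simp only [Fin.lt_def, Fin.ext_iff] at * <;> omega
    obtain ⟨rfl, rfl⟩ := this
    simp [h0, hne]
  · rw [hu _ _ hc]
    simp

lemma swap_decomp [Finite F] {i j : Fin n} (hij : (j : ℕ) = i + 1) (h : i ≠ j)
    {u : Matrix.GeneralLinearGroup (Fin n) F} (hu : u ∈ UU F n) :
    ∃ u' ∈ UU F n, u * (tv i j h ((u : Matrix (Fin n) (Fin n) F) i j))⁻¹
      = pm (Equiv.swap i j) * u' * pm (Equiv.swap i j) := by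
  have hlt : i < j := by rw [Fin.lt_def]; omega
  set c := (u : Matrix (Fin n) (Fin n) F) i j with hc
  have hinv : (tv i j h c)⁻¹ = tv i j h (-c) := by
    rw [inv_eq_iff_mul_eq_one, tv_mul_tv, add_neg_cancel, tv_zero]
  have hmem : u * tv i j h (-c) ∈ UU F n := mul_mem hu (tv_mem_UU hlt _)
  have hz : ((u * tv i j h (-c) : Matrix.GeneralLinearGroup (Fin n) F)
      : Matrix (Fin n) (Fin n) F) i j = 0 := by
    have hii : (u : Matrix (Fin n) (Fin n) F) i i = 1 := by
      have := hu i i (lt_irrefl _); simpa using this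
    rw [mul_tv_apply, if_pos rfl, hii, hc]; ring
  refine ⟨_, swap_conj_UU hij hmem hz, ?_⟩
  have h2 : pm (Equiv.swap i j) * pm (Equiv.swap i j)
      = (1 : Matrix.GeneralLinearGroup (Fin n) F) := by
    rw [← map_mul, Equiv.swap_mul_self, map_one]
  rw [hinv]
  calc _ = (pm (Equiv.swap i j) * pm (Equiv.swap i j)) * (u * tv i j h (-c)) *
      (pm (Equiv.swap i j) * pm (Equiv.swap i j)) := by rw [h2]; simp
    _ = _ := by group

end GLbasics

section Weights

variable {F : Type} [Field F] [Fintype F] {n : ℕ} {V : Type*} [AddCommGroup V] [Module ℂ V]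

/-- `v` is a `U`-fixed weight vector of weight `θ` -/
def IsWt (ρ : Representation ℂ (Matrix.GeneralLinearGroup (Fin n) F) V)
    (θ : (Fin n → Fˣ) → ℂ) (v : V) : Prop :=
  v ≠ 0 ∧ (∀ u ∈ UU F n, ρ u v = v) ∧ ∀ t, ρ (dg t) v = θ t • v

lemma swap_swap_pm (i j : Fin n) : pm (Equiv.swap i j) * pm (Equiv.swap i j)
      = (1 : Matrix.GeneralLinearGroup (Fin n) F) := by
  rw [← map_mul, Equiv.swap_mul_self, map_one]

lemma wt_swap (ρ : Representation ℂ (Matrix.GeneralLinearGroup (Fin n) F) V)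
    (θ : (Fin n → Fˣ) → ℂ) (v : V) (hv : IsWt ρ θ v) (i j : Fin n) (hij : (j : ℕ) = i + 1) :
    ∃ v', IsWt ρ (fun t => θ (fun a => t (Equiv.swap i j a))) v' := by
  classical
  obtain ⟨hv0, hvU, hvT⟩ := hv
  have hlt : i < j := by rw [Fin.lt_def]; omega
  have h : i ≠ j := hlt.ne
  set s : Matrix.GeneralLinearGroup (Fin n) F := pm (Equiv.swap i j) with hs
  have hss : s * s = 1 := swap_swap_pm i j
  set v' : V := ∑ c : F, ρ (tv i j h c) (ρ s v) with hv'
  have hdg : ∀ t, ρ (dg t) v' = θ (fun a => t (Equiv.swap i j a)) • v' := by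
    intro t
    rw [hv', map_sum, Finset.smul_sum]
    have h1 : ∀ c : F, ρ (dg t) (ρ (tv i j h c) (ρ s v))
        = θ (fun a => t (Equiv.swap i j a)) • ρ (tv i j h (t i * c * (t j)⁻¹)) (ρ s v) := by
      intro c
      rw [← Module.End.mul_apply, ← map_mul, dg_mul_tv, map_mul, Module.End.mul_apply,
        ← Module.End.mul_apply (ρ (dg t)), ← map_mul, hs, dg_mul_pm, map_mul, Module.End.mul_apply,
        hvT, map_smul, map_smul]
    simp_rw [h1]
    let e : F ≃ F := (Units.mulLeft (t i)).trans (Units.mulRight (t j)⁻¹)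
    have he : ∀ c, e c = t i * c * (t j)⁻¹ := by intro c; simp [e]
    simp_rw [← he]
    exact Equiv.sum_comp e (fun c => θ (fun a => t (Equiv.swap i j a)) • ρ (tv i j h c) (ρ s v))
  have hshift : ∀ d : F, ρ (tv i j h d) v' = v' := by
    intro d
    rw [hv', map_sum]
    simp_rw [← Module.End.mul_apply (ρ (tv i j h d)), ← map_mul, tv_mul_tv]
    exact Equiv.sum_comp (Equiv.addLeft d) (fun c => ρ (tv i j h c) (ρ s v))
  refine ⟨v', ?_, ?_, hdg⟩
  · -- nonvanishing
    intro h0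
    have h1 : ∑ c : F, ρ (tv j i h.symm c) v = 0 := by
      have : ρ s v' = ∑ c : F, ρ (tv j i h.symm c) v := by
        rw [hv', map_sum]
        refine Finset.sum_congr rfl fun c _ => ?_
        rw [← Module.End.mul_apply (ρ (tv i j h c)), ← map_mul, ← Module.End.mul_apply, ← map_mul,
          ← mul_assoc, hs, pm_mul_tv, mul_assoc, swap_swap_pm, mul_one]
        simp
      rw [← this, h0, map_zero]
    have h2 : ∀ c : F, c ≠ 0 → ∑ d : F, ρ (tv i j h d) (ρ (tv j i h.symm c) v) = 0 := by
      intro c hc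
      obtain ⟨c, rfl⟩ : ∃ c' : Fˣ, (c' : F) = c := ⟨Units.mk0 c hc, rfl⟩
      rw [tv_lower i j h c, map_mul, Module.End.mul_apply, hvU _ (tv_mem_UU hlt _), map_mul,
        Module.End.mul_apply, map_mul, Module.End.mul_apply]
      have h6 : ∀ d : F, ρ (tv i j h d) (ρ (tv i j h ((c⁻¹ : Fˣ) : F))
          (ρ (dg (hT i j c)) (ρ (pm (Equiv.swap i j)) v)))
          = ρ (tv i j h (d + ((c⁻¹ : Fˣ) : F)) * dg (hT i j c)) (ρ (pm (Equiv.swap i j)) v) := by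
        intro d
        rw [← tv_mul_tv, map_mul, map_mul, Module.End.mul_apply, Module.End.mul_apply]
      simp_rw [h6]
      erw [Equiv.sum_comp (Equiv.addRight ((c⁻¹ : Fˣ) : F))
        (fun d => ρ (tv i j h d * dg (hT i j c)) (ρ (pm (Equiv.swap i j)) v))]
      have h3 : ρ (dg (hT i j c)) v' = 0 := by rw [h0, map_zero]
      rw [hv', map_sum] at h3
      simp_rw [← Module.End.mul_apply (ρ (dg _)), ← map_mul, dg_mul_tv] at h3
      let t := hT i j c
      let e : F ≃ F := (Units.mulLeft (t i)).trans (Units.mulRight (t j)⁻¹)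
      have he : ∀ c, e c = t i * c * (t j)⁻¹ := by intro c; simp [e]
      rw [← h3, ← Equiv.sum_comp e]
      refine Finset.sum_congr rfl fun d _ => ?_
      rw [he]
    have h4 : ∑ d : F, ρ (tv i j h d) (∑ c : F, ρ (tv j i h.symm c) v) = 0 := by simp [h1]
    simp_rw [map_sum] at h4
    rw [Finset.sum_comm, Finset.sum_eq_single 0] at h4
    · simp_rw [tv_zero, map_one, Module.End.one_apply, fun d => hvU _ (tv_mem_UU hlt d)] at h4
      rw [Finset.sum_const, ← Nat.cast_smul_eq_nsmul ℂ] at h4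
      rcases smul_eq_zero.mp h4 with h5 | h5
      · simp at h5
      · exact hv0 h5
    · intro c _ hc; exact h2 c hc
    · simp
  · -- U-invariance
    intro u hu
    rw [hv', map_sum]
    set d := (u : Matrix (Fin n) (Fin n) F) i j with hd
    have : ∀ c, ρ u (ρ (tv i j h c) (ρ s v)) = ρ (tv i j h (d + c)) (ρ s v) := by
      intro c
      have hm : (tv i j h (d + c))⁻¹ * (u * tv i j h c) ∈ UU F n :=
        mul_mem (inv_mem (tv_mem_UU hlt _)) (mul_mem hu (tv_mem_UU hlt _))
      have hz : (((tv i j h (d + c))⁻¹ * (u * tv i j h c) : Matrix.GeneralLinearGroup (Fin n) F)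
          : Matrix (Fin n) (Fin n) F) i j = 0 := by
        have hinv : (tv i j h (d + c))⁻¹ = tv i j h (-(d + c)) := by
          rw [inv_eq_iff_mul_eq_one, tv_mul_tv, add_neg_cancel, tv_zero]
        have hii : (u : Matrix (Fin n) (Fin n) F) i i = 1 := by
          have := hu i i (lt_irrefl _); simpa using this
        have hjj : (u : Matrix (Fin n) (Fin n) F) j j = 1 := by
          have := hu j j (lt_irrefl _); simpa using this
        have hji : (u : Matrix (Fin n) (Fin n) F) j i = 0 := by
          have := hu j i (by simp; omega); simpa [h.symm] using this
        rw [hinv, tv_mul_apply, if_pos rfl, mul_tv_apply, mul_tv_apply, if_pos rfl, if_pos rfl,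
          hii, hjj, hji, ← hd]
        ring
      have hc := hvU _ (swap_conj_UU hij hm hz)
      rw [← hs, map_mul, map_mul, Module.End.mul_apply, Module.End.mul_apply] at hc
      have hc2 : ρ ((tv i j h (d + c))⁻¹ * (u * tv i j h c)) (ρ s v) = ρ s v := by
        have := congrArg (ρ s) hc
        rwa [← Module.End.mul_apply, ← map_mul ρ, hss, map_one, Module.End.one_apply] at this
      have := congrArg (ρ (tv i j h (d + c))) hc2
      rw [← Module.End.mul_apply, ← map_mul ρ, mul_inv_cancel_left, map_mul,
        Module.End.mul_apply] at this
      exact this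
    simp_rw [this]
    exact Equiv.sum_comp (Equiv.addLeft d) (fun c => ρ (tv i j h c) (ρ s v))

lemma adj_induction {P : Equiv.Perm (Fin n) → Prop} (h1 : P 1)
    (hs : ∀ i j : Fin n, (j : ℕ) = i + 1 → P (Equiv.swap i j))
    (hm : ∀ a b, P a → P b → P (a * b)) (σ : Equiv.Perm (Fin n)) : P σ := by
  cases n with
  | zero => rwa [Subsingleton.elim σ 1]
  | succ m =>
    have : σ ∈ Submonoid.closure (Set.range fun i : Fin m ↦ Equiv.swap i.castSucc i.succ) := by
      rw [Equiv.Perm.mclosure_swap_castSucc_succ]; trivial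
    induction this using Submonoid.closure_induction with
    | mem x hx => obtain ⟨i, rfl⟩ := hx; exact hs _ _ (by simp)
    | one => exact h1
    | mul a b _ _ ha hb => exact hm _ _ ha hb

lemma wt_perm (ρ : Representation ℂ (Matrix.GeneralLinearGroup (Fin n) F) V)
    (σ : Equiv.Perm (Fin n)) : ∀ (θ : (Fin n → Fˣ) → ℂ) (v : V), IsWt ρ θ v →
    ∃ v', IsWt ρ (fun t => θ (fun a => t (σ a))) v' := by
  induction σ using adj_induction with
  | h1 => intro θ v hv; exact ⟨v, hv⟩
  | hs i j hij => intro θ v hv; exact wt_swap ρ θ v hv i j hij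
  | hm a b ha hb =>
    intro θ v hv
    obtain ⟨v', hv'⟩ := hb θ v hv
    obtain ⟨v'', hv''⟩ := ha _ v' hv'
    exact ⟨v'', hv''⟩

lemma span_bruhat (ρ : Representation ℂ (Matrix.GeneralLinearGroup (Fin n) F) V)
    (hirr : ∀ W : Submodule ℂ V, (∀ g, ∀ x ∈ W, ρ g x ∈ W) → W ≠ ⊥ → W = ⊤)
    (θ : (Fin n → Fˣ) → ℂ) (v : V) (hv : IsWt ρ θ v) :
    Submodule.span ℂ {x | ∃ u ∈ UU F n, ∃ σ : Equiv.Perm (Fin n), x = ρ u (ρ (pm σ) v)} = ⊤ := by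
  classical
  obtain ⟨hv0, hvU, hvT⟩ := hv
  set S : Set V := {x | ∃ u ∈ UU F n, ∃ σ : Equiv.Perm (Fin n), x = ρ u (ρ (pm σ) v)} with hS
  set W := Submodule.span ℂ S with hW
  let st : Matrix.GeneralLinearGroup (Fin n) F → Prop := fun g => ∀ x ∈ W, ρ g x ∈ W
  have st_of : ∀ g, (∀ x ∈ S, ρ g x ∈ W) → st g := by
    intro g hg x hx
    have : W ≤ W.comap (ρ g) := by
      rw [hW, Submodule.span_le]; exact hg
    exact this hx
  have st_mul : ∀ g h, st g → st h → st (g * h) := by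
    intro g h hg hh x hx
    rw [map_mul, Module.End.mul_apply]
    exact hg _ (hh _ hx)
  have memS : ∀ u ∈ UU F n, ∀ σ, ρ u (ρ (pm σ) v) ∈ W := fun u hu σ =>
    Submodule.subset_span ⟨u, hu, σ, rfl⟩
  have stU : ∀ u ∈ UU F n, st u := by
    intro u hu
    apply st_of
    rintro _ ⟨u', hu', σ, rfl⟩
    rw [← Module.End.mul_apply, ← map_mul]
    exact memS _ (mul_mem hu hu') σ
  have stT : ∀ t, st (dg t) := by
    intro t
    apply st_of
    rintro _ ⟨u, hu, σ, rfl⟩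
    have : dg t * u * pm σ = (dg t * u * (dg t)⁻¹) * pm σ * dg (fun i => t (σ i)) := by
      rw [mul_assoc _ (pm σ), ← dg_mul_pm]; group
    rw [← Module.End.mul_apply, ← map_mul, ← Module.End.mul_apply, ← map_mul, this, map_mul,
      Module.End.mul_apply, hvT, map_smul, map_mul, Module.End.mul_apply]
    exact W.smul_mem _ (memS _ (dg_conj_UU hu t) σ)
  -- root subgroup elements acting on `w v`
  have posroot : ∀ (i j : Fin n) (h : i ≠ j) (c : F) (σ : Equiv.Perm (Fin n)),
      σ⁻¹ i < σ⁻¹ j → ρ (tv i j h c) (ρ (pm σ) v) = ρ (pm σ) v := by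
    intro i j h c σ hσ
    have : tv i j h c * pm σ = pm σ * tv (σ⁻¹ i) (σ⁻¹ j) hσ.ne c := by
      rw [pm_mul_tv]; simp
    rw [← Module.End.mul_apply, ← map_mul, this, map_mul, Module.End.mul_apply,
      hvU _ (tv_mem_UU hσ c)]
  have stS : ∀ i j : Fin n, (j : ℕ) = i + 1 → st (pm (Equiv.swap i j)) := by
    intro i j hij
    have hlt : i < j := by rw [Fin.lt_def]; omega
    have h : i ≠ j := hlt.ne
    apply st_of
    rintro _ ⟨u, hu, σ, rfl⟩
    set s : Matrix.GeneralLinearGroup (Fin n) F := pm (Equiv.swap i j) with hs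
    have hss : s * s = 1 := swap_swap_pm i j
    obtain ⟨u', hu', he⟩ := swap_decomp hij h hu
    set c := (u : Matrix (Fin n) (Fin n) F) i j with hc
    have h1 : s * u = u' * (s * tv i j h c) := by
      have : u = s * u' * s * tv i j h c := by rw [← he]; group
      calc s * u = s * (s * u' * s * tv i j h c) := by rw [← this]
        _ = (s * s) * u' * s * tv i j h c := by group
        _ = _ := by rw [hss]; group
    rw [← Module.End.mul_apply, ← map_mul, h1, map_mul, Module.End.mul_apply]
    apply stU u' hu'
    rw [map_mul, Module.End.mul_apply]
    rcases lt_or_ge (σ⁻¹ i) (σ⁻¹ j) with hσ | hσ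
    · rw [posroot i j h c σ hσ, ← Module.End.mul_apply, hs, ← map_mul, ← map_mul]
      have := memS 1 (one_mem _) (Equiv.swap i j * σ)
      simpa using this
    · by_cases hc0 : c = 0
      · rw [hc0, tv_zero, map_one, Module.End.one_apply, ← Module.End.mul_apply, hs, ← map_mul,
          ← map_mul]
        have := memS 1 (one_mem _) (Equiv.swap i j * σ)
        simpa using this
      · obtain ⟨c', hc'⟩ : ∃ c' : Fˣ, (c' : F) = c := ⟨Units.mk0 c hc0, rfl⟩
        set σ' := Equiv.swap i j * σ with hσ'
        have h2 : σ = Equiv.swap i j * σ' := by rw [hσ', ← mul_assoc]; simp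
        have h3 : σ'⁻¹ i < σ'⁻¹ j := by
          rw [hσ', mul_inv_rev]
          simp only [Equiv.Perm.mul_apply, Equiv.swap_inv, Equiv.swap_apply_left,
            Equiv.swap_apply_right]
          exact lt_of_le_of_ne hσ (fun h' => h (σ⁻¹.injective h').symm)
        have h4 : s * tv i j h c * pm σ = tv j i h.symm c * pm σ' := by
          rw [h2, map_mul, ← hs, hs, pm_mul_tv, mul_assoc, ← mul_assoc (pm (Equiv.swap i j)),
            swap_swap_pm]
          simp
        rw [← Module.End.mul_apply, ← map_mul, ← Module.End.mul_apply, ← map_mul, ]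
        rw [h4, ← hc', tv_lower i j h c', map_mul, Module.End.mul_apply, map_mul,
          Module.End.mul_apply, posroot i j h _ σ' h3, map_mul, Module.End.mul_apply]
        apply stU _ (tv_mem_UU hlt _)
        rw [map_mul, Module.End.mul_apply]
        apply stT
        rw [← Module.End.mul_apply, ← map_mul, ← map_mul]
        have := memS 1 (one_mem _) (Equiv.swap i j * σ')
        simpa using this
  have stP : ∀ σ : Equiv.Perm (Fin n), st (pm σ) := by
    intro σ
    induction σ using adj_induction with
    | h1 => intro x hx; simpa using hx
    | hs i j hij => exact stS i j hij
    | hm a b ha hb => rw [map_mul]; exact st_mul _ _ ha hb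
  have stTv : ∀ (i j : Fin n) (h : i ≠ j) (c : F), st (tv i j h c) := by
    intro i j h c
    rcases lt_or_gt_of_ne h with hlt | hlt
    · exact stU _ (tv_mem_UU hlt c)
    · have : tv i j h c = pm (Equiv.swap i j) * tv j i h.symm c * pm (Equiv.swap i j) := by
        rw [pm_mul_tv, mul_assoc, swap_swap_pm]; simp
      rw [this]
      exact st_mul _ _ (st_mul _ _ (stP _) (stU _ (tv_mem_UU hlt c))) (stP _)
  have stG : ∀ g, st g := by
    intro g
    let P : Matrix (Fin n) (Fin n) F → Prop := fun M =>
      ∃ g : Matrix.GeneralLinearGroup (Fin n) F, (g : Matrix (Fin n) (Fin n) F) = M ∧ st g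
    have : P g := by
      apply Matrix.diagonal_transvection_induction_of_det_ne_zero P
      · have := g.isUnit.map (Matrix.detMonoidHom)
        exact this.ne_zero
      · intro D hD
        rw [Matrix.det_diagonal, Finset.prod_ne_zero_iff] at hD
        refine ⟨dg (fun i => Units.mk0 (D i) (hD i (Finset.mem_univ _))), ?_, stT _⟩
        simp [dg]
      · intro t
        exact ⟨tv t.i t.j t.hij t.c, rfl, stTv _ _ _ _⟩
      · rintro A B - - ⟨a, rfl, ha⟩ ⟨b, rfl, hb⟩
        exact ⟨a * b, rfl, st_mul _ _ ha hb⟩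
    obtain ⟨g', h1, h2⟩ := this
    rwa [← Units.ext h1]
  refine hirr W stG ?_
  intro hbot
  have : v ∈ W := by
    have := memS 1 (one_mem _) 1
    simpa using this
  rw [hbot] at this
  exact hv0 (by simpa using this)

end Weights

section Avg

variable {G : Type*} [Group G] {V : Type*} [AddCommGroup V] [Module ℂ V]

/-- averaging operator over a finite subgroup -/
noncomputable def avg (ρ : Representation ℂ G V) (H : Subgroup G) [Fintype H] : V →ₗ[ℂ] V :=
  (Fintype.card H : ℂ)⁻¹ • ∑ u : H, ρ u

lemma mul_avg (ρ : Representation ℂ G V) (H : Subgroup G) [Fintype H] {h : G} (hh : h ∈ H) :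
    ρ h * avg ρ H = avg ρ H := by
  rw [avg, mul_smul_comm, Finset.mul_sum]
  congr 1
  rw [← Equiv.sum_comp (Equiv.mulLeft (⟨h, hh⟩ : H)) (fun u : H => ρ u)]
  simp

lemma avg_mul (ρ : Representation ℂ G V) (H : Subgroup G) [Fintype H] {h : G} (hh : h ∈ H) :
    avg ρ H * ρ h = avg ρ H := by
  rw [avg, smul_mul_assoc, Finset.sum_mul]
  congr 1
  rw [← Equiv.sum_comp (Equiv.mulRight (⟨h, hh⟩ : H)) (fun u : H => ρ u)]
  simp

lemma avg_fixed (ρ : Representation ℂ G V) (H : Subgroup G) [Fintype H] {v : V}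
    (hv : ∀ h ∈ H, ρ h v = v) : avg ρ H v = v := by
  simp only [avg, LinearMap.smul_apply, LinearMap.sum_apply]
  have : ∀ u : H, ρ u v = v := fun u => hv u u.2
  simp_rw [this]
  rw [Finset.sum_const, ← Nat.cast_smul_eq_nsmul ℂ, smul_smul, Finset.card_univ,
    inv_mul_cancel₀, one_smul]
  simp

lemma avg_idem (ρ : Representation ℂ G V) (H : Subgroup G) [Fintype H] :
    avg ρ H * avg ρ H = avg ρ H := by
  ext v
  apply avg_fixed
  intro h hh
  rw [← Module.End.mul_apply, mul_avg ρ H hh]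

lemma avg_comm (ρ : Representation ℂ G V) (H : Subgroup G) [Fintype H] {g : G}
    (hg : ∀ h ∈ H, g * h * g⁻¹ ∈ H) : ρ g * avg ρ H = avg ρ H * ρ g := by
  rw [avg, mul_smul_comm, smul_mul_assoc, Finset.mul_sum, Finset.sum_mul]
  congr 1
  let f : H → H := fun h => ⟨g * h * g⁻¹, hg h h.2⟩
  have hf : Function.Bijective f := by
    apply Finite.injective_iff_bijective.mp
    intro a b hab
    have h1 : g * (a : G) * g⁻¹ = g * b * g⁻¹ := congrArg Subtype.val hab
    exact Subtype.ext (mul_left_cancel (mul_right_cancel h1))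
  rw [← hf.sum_comp (fun u : H => ρ u * ρ g)]
  refine Finset.sum_congr rfl fun u _ => ?_
  simp only [f]
  rw [← map_mul, ← map_mul]
  congr 1
  group

lemma trace_avg (ρ : Representation ℂ G V) (H : Subgroup G) [Fintype H]
    {g : G} (hg : ∀ h ∈ H, g * h * g⁻¹ ∈ H) (hc : ∀ h ∈ H, h * g = g * h → h = 1) :
    LinearMap.trace ℂ V (avg ρ H * ρ g) = LinearMap.trace ℂ V (ρ g) := by
  rw [avg, smul_mul_assoc, Finset.sum_mul, map_smul, map_sum]
  let f : H → H := fun h => ⟨h * (g * h⁻¹ * g⁻¹), H.mul_mem h.2 (hg _ (H.inv_mem h.2))⟩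
  have hf : Function.Bijective f := by
    apply Finite.injective_iff_bijective.mp
    intro a b hab
    simp only [f, Subtype.mk.injEq] at hab
    have h1 : ((b : G)⁻¹ * a) * g = g * ((b : G)⁻¹ * a) := by
      have : (a : G) * g * (a : G)⁻¹ = b * g * (b : G)⁻¹ := by
        have := congrArg (· * g) hab
        simpa [mul_assoc] using this
      calc ((b : G)⁻¹ * a) * g = (b : G)⁻¹ * (a * g * (a : G)⁻¹) * a := by group
        _ = _ := by rw [this]; group
    have h2 := hc _ (H.mul_mem (H.inv_mem b.2) a.2) h1
    apply Subtype.ext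
    rw [inv_mul_eq_one] at h2
    exact h2.symm
  rw [← hf.sum_comp]
  have : ∀ h : H, LinearMap.trace ℂ V (ρ (f h) * ρ g) = LinearMap.trace ℂ V (ρ g) := by
    intro h
    have e : ρ (f h) * ρ g = ρ h * (ρ g * ρ (h : G)⁻¹) := by
      rw [← map_mul, ← map_mul, ← map_mul]
      congr 1
      simp [f, mul_assoc]
    rw [e, LinearMap.trace_mul_comm, mul_assoc, ← map_mul, inv_mul_cancel, map_one, mul_one]
  simp_rw [this]
  rw [Finset.sum_const, Finset.card_univ, ← Nat.cast_smul_eq_nsmul ℂ, smul_smul,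
    inv_mul_cancel₀, one_smul]
  simp

end Avg

section Levi

variable {F : Type} [Field F] [Fintype F] {n : ℕ} {V : Type*} [AddCommGroup V] [Module ℂ V]

lemma levi_entry {κ : Fin n → ℕ} {z : Fin n → Fˣ} (hz : ∀ i j, z i = z j → κ i = κ j)
    {g : Matrix.GeneralLinearGroup (Fin n) F} (hg : g * dg z = dg z * g) (i j : Fin n)
    (h : (g : Matrix (Fin n) (Fin n) F) i j ≠ 0) : κ i = κ j := by
  have h1 : ((g * dg z : Matrix.GeneralLinearGroup (Fin n) F) : Matrix (Fin n) (Fin n) F) i j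
    = ((dg z * g : Matrix.GeneralLinearGroup (Fin n) F) : Matrix (Fin n) (Fin n) F) i j := by
    rw [hg]
  rw [mul_dg_apply, dg_mul_apply, mul_comm] at h1
  exact hz _ _ (Units.ext (mul_right_cancel₀ h h1)).symm

lemma levi_norm {κ : Fin n → ℕ} {z : Fin n → Fˣ} (hz : ∀ i j, z i = z j → κ i = κ j)
    {g : Matrix.GeneralLinearGroup (Fin n) F} (hg : g * dg z = dg z * g) :
    ∀ u ∈ Um (F := F) κ, g * u * g⁻¹ ∈ Um κ := by
  intro u hu a b hab
  have hg' : g⁻¹ * dg z = dg z * g⁻¹ := by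
    have : Commute g (dg z) := hg
    exact this.inv_left
  have key : ∀ k l, (g : Matrix (Fin n) (Fin n) F) a k *
      ((u : Matrix (Fin n) (Fin n) F) k l - (1 : Matrix (Fin n) (Fin n) F) k l) *
      ((g⁻¹ : Matrix.GeneralLinearGroup (Fin n) F) : Matrix (Fin n) (Fin n) F) l b = 0 := by
    intro k l
    by_contra hne
    have h1 : (g : Matrix (Fin n) (Fin n) F) a k ≠ 0 := by
      intro h; apply hne; rw [h]; ring
    have h2 : ((g⁻¹ : Matrix.GeneralLinearGroup (Fin n) F) : Matrix (Fin n) (Fin n) F) l b ≠ 0 := by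
      intro h; apply hne; rw [h]; ring
    have e1 := levi_entry hz hg _ _ h1
    have e2 := levi_entry hz hg' _ _ h2
    apply hne
    rw [hu k l (by omega), Matrix.one_apply]; ring
  have h3 : ((g * u * g⁻¹ : Matrix.GeneralLinearGroup (Fin n) F) : Matrix (Fin n) (Fin n) F)
      = (g : Matrix (Fin n) (Fin n) F) * ((u : Matrix (Fin n) (Fin n) F) - 1)
        * ((g⁻¹ : Matrix.GeneralLinearGroup (Fin n) F) : Matrix (Fin n) (Fin n) F) + 1 := by
    rw [mul_sub, sub_mul, mul_one, ← Units.val_mul g, ← Units.val_mul (g * u), ← Units.val_mul g]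
    simp
  rw [h3, Matrix.add_apply, Matrix.mul_apply, Finset.sum_eq_zero, zero_add, Matrix.one_apply]
  intro l _
  rw [Matrix.mul_apply, Finset.sum_mul]
  apply Finset.sum_eq_zero
  intro k _
  rw [Matrix.sub_apply]
  exact key k l

noncomputable instance (κ : Fin n → ℕ) : Fintype (Um (F := F) κ) := Fintype.ofFinite _

lemma trace_levi (ρ : Representation ℂ (Matrix.GeneralLinearGroup (Fin n) F) V)
    {κ : Fin n → ℕ} {z : Fin n → Fˣ} (hz : ∀ i j, z i = z j → κ i = κ j)
    {g : Matrix.GeneralLinearGroup (Fin n) F} (hg : g * dg z = dg z * g)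
    (hg' : ∀ h, h * g = g * h → h * dg z = dg z * h) :
    LinearMap.trace ℂ V (avg ρ (Um κ) * ρ g) = LinearMap.trace ℂ V (ρ g) := by
  apply trace_avg ρ _ (levi_norm hz hg)
  intro u hu hug
  apply gl_ext
  intro a b
  by_cases h : κ a < κ b
  · by_contra hne
    have hab : a ≠ b := by rintro rfl; exact lt_irrefl _ h
    rw [Units.val_one, Matrix.one_apply, if_neg hab] at hne
    exact h.ne (levi_entry hz (hg' u hug) _ _ hne)
  · rw [hu a b h, Units.val_one, Matrix.one_apply]

lemma dg_norm_Um (κ : Fin n → ℕ) (t : Fin n → Fˣ) :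
    ∀ u ∈ Um (F := F) κ, dg t * u * (dg t)⁻¹ ∈ Um κ := by
  intro u hu a b hab
  rw [← map_inv, mul_dg_apply, dg_mul_apply, hu a b hab]
  split_ifs with h
  · subst h; simp
  · simp

/-- action of block scalars on the spanning vectors of `V^{U_κ}` -/
lemma avg_weight (ρ : Representation ℂ (Matrix.GeneralLinearGroup (Fin n) F) V)
    (θ : (Fin n → Fˣ) → ℂ) (v : V) (hv : IsWt ρ θ v) {κ : Fin n → ℕ} (hκ : Monotone κ)
    (t : Fin n → Fˣ) (ht : ∀ i j, κ i = κ j → t i = t j)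
    {u : Matrix.GeneralLinearGroup (Fin n) F} (hu : u ∈ UU F n) (σ : Equiv.Perm (Fin n)) :
    (avg ρ (Um κ) * ρ (dg t)) (ρ u (ρ (pm σ) v))
      = θ (fun i => t (σ i)) • avg ρ (Um κ) (ρ u (ρ (pm σ) v)) := by
  have h1 := dg_comm_Um hκ hu t ht
  have h2 : dg t * u * pm σ = (dg t * u * (dg t)⁻¹ * u⁻¹) * (u * (pm σ * dg (fun i => t (σ i)))) := by
    rw [← dg_mul_pm]; group
  have h3 : ρ (dg t) (ρ u (ρ (pm σ) v)) = ρ (dg t * u * pm σ) v := by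
    simp [map_mul, Module.End.mul_apply]
  rw [Module.End.mul_apply, h3, h2, map_mul, Module.End.mul_apply, ← Module.End.mul_apply,
    avg_mul ρ _ h1, map_mul, Module.End.mul_apply, map_mul, Module.End.mul_apply, hv.2.2,
    map_smul, map_smul, map_smul]

end Levi

section Eig

variable {F : Type} [Field F] [Fintype F] {n : ℕ} {V : Type*} [AddCommGroup V] [Module ℂ V]

lemma exists_wt [FiniteDimensional ℂ V]
    (ρ : Representation ℂ (Matrix.GeneralLinearGroup (Fin n) F) V)
    (z : Fin n → Fˣ) (hz : Function.Injective z) (h0 : LinearMap.trace ℂ V (ρ (dg z)) ≠ 0) :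
    ∃ (θ : (Fin n → Fˣ) → ℂ) (v : V), IsWt ρ θ v := by
  classical
  have h1 := trace_levi ρ (κ := fun i => (i : ℕ)) (z := z) (fun i j h => by rw [hz h])
    (g := dg z) rfl (fun h hh => hh)
  set E := avg ρ (Um (F := F) (fun i : Fin n => (i : ℕ))) with hE
  have hE0 : E ≠ 0 := by
    intro h
    rw [h, zero_mul, map_zero] at h1
    exact h0 h1.symm
  let 𝒮 : Set (Submodule ℂ V) := {W | W ≠ ⊥ ∧ W ≤ LinearMap.range E ∧
    ∀ t : Fin n → Fˣ, ∀ x ∈ W, ρ (dg t) x ∈ W}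
  have hne : 𝒮.Nonempty := by
    refine ⟨LinearMap.range E, ?_, le_rfl, ?_⟩
    · rwa [Ne, LinearMap.range_eq_bot]
    · rintro t _ ⟨x, rfl⟩
      refine ⟨ρ (dg t) x, ?_⟩
      rw [← Module.End.mul_apply, ← avg_comm ρ _ (dg_norm_Um _ t)]
      rfl
  obtain ⟨W, ⟨hW0, hWE, hWT⟩, hmin⟩ := IsArtinian.set_has_minimal 𝒮 hne
  have hex : ∀ t : Fin n → Fˣ, ∃ μ : ℂ, ∀ x ∈ W, ρ (dg t) x = μ • x := by
    intro t
    have : Nontrivial W := Submodule.nontrivial_iff_ne_bot.mpr hW0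
    obtain ⟨μ, hμ⟩ := Module.End.exists_eigenvalue ((ρ (dg t)).restrict (hWT t))
    obtain ⟨y, hy⟩ := hμ.exists_hasEigenvector
    refine ⟨μ, ?_⟩
    let W' := W ⊓ Module.End.eigenspace (ρ (dg t)) μ
    have hW' : W' ∈ 𝒮 := by
      refine ⟨?_, inf_le_left.trans hWE, ?_⟩
      · intro hb
        have : (y : V) ∈ W' := by
          refine ⟨y.2, ?_⟩
          rw [SetLike.mem_coe, Module.End.mem_eigenspace_iff]
          have := congrArg Subtype.val hy.apply_eq_smul
          simpa using this
        rw [hb] at this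
        exact hy.2 (by simpa using this)
      · rintro s x ⟨hx1, hx2⟩
        refine ⟨hWT s x hx1, ?_⟩
        rw [SetLike.mem_coe, Module.End.mem_eigenspace_iff] at hx2 ⊢
        rw [← Module.End.mul_apply, ← map_mul, ← map_mul, mul_comm, map_mul, map_mul,
          Module.End.mul_apply, hx2, map_smul]
    have h2 := hmin W' hW'
    have h3 : W' = W := by
      by_contra hne'
      exact h2 (lt_of_le_of_ne inf_le_left hne')
    intro x hx
    rw [← h3] at hx
    exact Module.End.mem_eigenspace_iff.mp hx.2
  choose θ hθ using hex
  obtain ⟨v, hv, hv0⟩ := Submodule.exists_mem_ne_zero_of_ne_bot hW0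
  refine ⟨θ, v, hv0, ?_, fun t => hθ t v hv⟩
  intro u hu
  obtain ⟨x, rfl⟩ := hWE hv
  have h5 := mul_avg ρ (Um (F := F) (fun i : Fin n => (i : ℕ))) (h := u) hu
  exact LinearMap.congr_fun h5 x

lemma avg_eq_of_wt (ρ : Representation ℂ (Matrix.GeneralLinearGroup (Fin n) F) V)
    (hirr : ∀ W : Submodule ℂ V, (∀ g, ∀ x ∈ W, ρ g x ∈ W) → W ≠ ⊥ → W = ⊤)
    (θ : (Fin n → Fˣ) → ℂ) (v : V) (hv : IsWt ρ θ v) {κ : Fin n → ℕ} (hκ : Monotone κ)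
    (t : Fin n → Fˣ) (ht : ∀ i j, κ i = κ j → t i = t j)
    (h1 : ∀ σ : Equiv.Perm (Fin n), θ (fun i => t (σ i)) = 1) :
    avg ρ (Um κ) * ρ (dg t) = avg ρ (Um κ) := by
  apply LinearMap.ext_on (span_bruhat ρ hirr θ v hv)
  rintro _ ⟨u, hu, σ, rfl⟩
  rw [avg_weight ρ θ v hv hκ t ht hu σ, h1, one_smul]

lemma eigs (ρ : Representation ℂ (Matrix.GeneralLinearGroup (Fin n) F) V) [FiniteDimensional ℂ V]
    [NeZero n]
    (hirr : ∀ W : Submodule ℂ V, (∀ g, ∀ x ∈ W, ρ g x ∈ W) → W ≠ ⊥ → W = ⊤)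
    (θ : (Fin n → Fˣ) → ℂ) (v : V) (hv : IsWt ρ θ v) (z : Fˣ) (hz : z ≠ 1) :
    ∃ R : Multiset ℂ, LinearMap.trace ℂ V (ρ (dg (Pi.mulSingle 0 z))) = R.sum ∧
      (∀ μ ∈ R, μ = 0 ∨ ∃ j, μ = θ (Pi.mulSingle j z)) ∧
      ∀ j, θ (Pi.mulSingle j z) ∈ R := by
  classical
  let κ : Fin n → ℕ := fun i => if i = 0 then 0 else 1
  have hκ : Monotone κ := by
    intro i j hij
    simp only [κ]
    split_ifs with h1 h2 h2
    · rfl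
    · omega
    · subst h2; exact absurd (nonpos_iff_eq_zero.mp hij) h1
    · rfl
  set t : Fin n → Fˣ := Pi.mulSingle 0 z with ht
  have htκ : ∀ i j, κ i = κ j → t i = t j := by
    intro i j hij
    simp only [κ] at hij
    by_cases hi : i = 0 <;> by_cases hj : j = 0 <;> simp [hi, hj, ht, Pi.mulSingle_apply] at hij ⊢
  have hκt : ∀ i j, t i = t j → κ i = κ j := by
    intro i j hij
    simp only [ht, Pi.mulSingle_apply] at hij
    by_cases hi : i = 0 <;> by_cases hj : j = 0 <;> simp [hi, hj, κ, hz, Ne.symm hz] at hij ⊢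
  have htσ : ∀ σ : Equiv.Perm (Fin n), (fun i => t (σ i)) = Pi.mulSingle (σ⁻¹ 0) z := by
    intro σ
    funext i
    simp only [ht, Pi.mulSingle_apply]
    congr 1
    rw [Equiv.Perm.eq_inv_iff_eq]
  have htr := trace_levi ρ hκt (g := dg t) rfl (fun h hh => hh)
  set E := avg ρ (Um (F := F) κ) with hE
  set A := E * ρ (dg t) with hA
  have hcomm : ρ (dg t) * E = E * ρ (dg t) := avg_comm ρ _ (dg_norm_Um _ t)
  have hEA : E * A = A := by rw [hA, ← mul_assoc, avg_idem]
  have hAE : A * E = A := by rw [hA, mul_assoc, hcomm, ← mul_assoc, avg_idem]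
  have hspan : ∀ x, ∀ P : Polynomial ℂ, (∀ j, P.IsRoot (θ (Pi.mulSingle j z))) →
      (Polynomial.aeval A P) (E x) = 0 := by
    intro x P hP
    have : (Polynomial.aeval A P) ∘ₗ E = 0 := by
      apply LinearMap.ext_on (span_bruhat ρ hirr θ v hv)
      rintro _ ⟨u, hu, σ, rfl⟩
      have h1 := avg_weight ρ θ v hv hκ t htκ hu σ
      rw [← hE, ← hA, htσ] at h1
      rw [LinearMap.comp_apply, LinearMap.zero_apply]
      set y := ρ u (ρ (pm σ) v)
      have h2 : A (E y) = θ (Pi.mulSingle (σ⁻¹ 0) z) • E y := by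
        rw [← Module.End.mul_apply, hAE, h1]
      by_cases hy : E y = 0
      · rw [hy, map_zero]
      · rw [Module.End.aeval_apply_of_hasEigenvector
          (⟨Module.End.mem_eigenspace_iff.mpr h2, hy⟩ : Module.End.HasEigenvector A _ _)]
        rw [Polynomial.IsRoot.def.mp (hP (σ⁻¹ 0)), zero_smul]
    exact LinearMap.congr_fun this x
  refine ⟨A.charpoly.roots, ?_, ?_, ?_⟩
  · rw [← htr]
    exact Module.End.trace_eq_sum_roots_charpoly_of_splits (IsAlgClosed.splits _)
  · intro μ hμ
    have hμ' : Module.End.HasEigenvalue A μ := by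
      rw [Module.End.hasEigenvalue_iff_isRoot_charpoly]
      exact (Polynomial.mem_roots'.mp hμ).2
    obtain ⟨y, hy⟩ := hμ'.exists_hasEigenvector
    by_cases h0 : μ = 0
    · exact Or.inl h0
    right
    by_contra! hne
    let P : Polynomial ℂ := ∏ j : Fin n, (Polynomial.X - Polynomial.C (θ (Pi.mulSingle j z)))
    have hP : ∀ j, P.IsRoot (θ (Pi.mulSingle j z)) := by
      intro j
      rw [Polynomial.IsRoot, Polynomial.eval_prod]
      exact Finset.prod_eq_zero (Finset.mem_univ j) (by simp)
    have hyE : E y = y := by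
      have h1 := hy.apply_eq_smul
      have h2 : E (A y) = A y := by rw [← Module.End.mul_apply, hEA]
      rw [h1, map_smul] at h2
      exact smul_right_injective V h0 h2
    have h3 := hspan y P hP
    rw [hyE, Module.End.aeval_apply_of_hasEigenvector hy] at h3
    rcases smul_eq_zero.mp h3 with h4 | h4
    · rw [Polynomial.eval_prod, Finset.prod_eq_zero_iff] at h4
      obtain ⟨j, -, hj⟩ := h4
      simp [sub_eq_zero] at hj
      exact hne j hj
    · exact hy.2 h4
  · intro j
    obtain ⟨v', hv'⟩ := wt_perm ρ (Equiv.swap 0 j) θ v hv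
    have h1 : A v' = θ (Pi.mulSingle j z) • v' := by
      have h2 : E v' = v' := avg_fixed ρ _ (fun h hh => hv'.2.1 h (Um_le_UU hκ hh))
      rw [hA, Module.End.mul_apply, hv'.2.2, map_smul, h2]
      show θ (fun a => t (Equiv.swap 0 j a)) • v' = _
      rw [htσ]
      simp
    rw [Polynomial.mem_roots (LinearMap.charpoly_monic A).ne_zero,
      ← Module.End.hasEigenvalue_iff_isRoot_charpoly]
    exact Module.End.hasEigenvalue_of_hasEigenvector
      (⟨Module.End.mem_eigenspace_iff.mpr h1, hv'.1⟩ : Module.End.HasEigenvector A _ _)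

end Eig

section Conj

variable {F : Type} [Field F] [Fintype F] {n : ℕ} {V : Type*} [AddCommGroup V] [Module ℂ V]

lemma dg_inj : Function.Injective (dg : (Fin n → Fˣ) →* Matrix.GeneralLinearGroup (Fin n) F) := by
  intro s t h
  funext i
  have : (dg s : Matrix (Fin n) (Fin n) F) i i = (dg t : Matrix (Fin n) (Fin n) F) i i := by rw [h]
  simp only [dg_apply, if_true] at this
  exact Units.ext this

lemma index_dg {p : ℕ} (hp : p.Prime) (hpq : p ∣ Fintype.card F - 1) (hn : n < p) :
    ¬ p ∣ (dg : (Fin n → Fˣ) →* Matrix.GeneralLinearGroup (Fin n) F).range.index := by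
  classical
  set q := Fintype.card F with hq
  have hq1 : 1 < q := Fintype.one_lt_card
  have hcT : Nat.card (dg : (Fin n → Fˣ) →* Matrix.GeneralLinearGroup (Fin n) F).range
      = (q - 1) ^ n := by
    rw [Nat.card_congr (MonoidHom.ofInjective dg_inj).toEquiv.symm, Nat.card_eq_fintype_card,
      Fintype.card_pi, Finset.prod_const, Fintype.card_units]
    simp [hq]
  have h1 := Subgroup.card_mul_index
    (dg : (Fin n → Fˣ) →* Matrix.GeneralLinearGroup (Fin n) F).range
  rw [hcT, Matrix.card_GL_field] at h1
  have h2 : ∀ i : Fin n, q ^ n - q ^ (i : ℕ) = (q - 1) * (q ^ (i : ℕ) *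
      ∑ l ∈ Finset.range (n - i), q ^ l) := by
    intro i
    have h3 : q ^ n = q ^ (i : ℕ) * q ^ (n - i) := by rw [← pow_add]; congr 1; omega
    have h4 := Nat.geomSum_eq hq1 (n - i)
    have h5 : q - 1 ∣ q ^ (n - (i : ℕ)) - 1 := by
      simpa using Nat.sub_dvd_pow_sub_pow q 1 (n - i)
    rw [h4, mul_left_comm, Nat.mul_div_cancel' h5, h3, Nat.mul_sub, mul_one]
  rw [← hq] at h1
  simp_rw [h2, Finset.prod_mul_distrib (f := fun _ => q - 1)] at h1
  rw [Finset.prod_const, Finset.card_univ, Fintype.card_fin] at h1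
  have h6 := Nat.eq_of_mul_eq_mul_left (pow_pos (by omega) n) h1
  rw [h6]
  intro hd
  rw [hp.prime.dvd_finsetProd_iff] at hd
  obtain ⟨i, -, hi⟩ := hd
  have hqm : (q : ZMod p) = 1 := by
    have : ((q - 1 : ℕ) : ZMod p) = 0 := (ZMod.natCast_eq_zero_iff _ _).mpr hpq
    rw [Nat.cast_sub hq1.le, sub_eq_zero] at this
    simpa using this
  rw [← ZMod.natCast_eq_zero_iff] at hi
  push_cast at hi
  rw [hqm] at hi
  simp only [one_pow, Finset.sum_const, Finset.card_range, one_mul, nsmul_eq_mul, mul_one] at hi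
  rw [ZMod.natCast_eq_zero_iff] at hi
  have := Nat.le_of_dvd (by omega) hi
  omega

lemma conj_dg {p : ℕ} (hp : p.Prime) (hpq : p ∣ Fintype.card F - 1) (hn : n < p)
    (x : Matrix.GeneralLinearGroup (Fin n) F) (e : ℕ) (hx : x ^ p ^ e = 1) :
    ∃ (h : Matrix.GeneralLinearGroup (Fin n) F) (z : Fin n → Fˣ), h * x * h⁻¹ = dg z := by
  classical
  have := Fact.mk hp
  set T := (dg : (Fin n → Fˣ) →* Matrix.GeneralLinearGroup (Fin n) F).range with hT
  have hP : IsPGroup p (Subgroup.zpowers x) := by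
    rintro ⟨y, hy⟩
    obtain ⟨k, rfl⟩ := Subgroup.mem_zpowers_iff.mp hy
    refine ⟨e, ?_⟩
    apply Subtype.ext
    simp only [SubmonoidClass.mk_pow, OneMemClass.coe_one]
    rw [← zpow_natCast, ← zpow_mul, mul_comm, zpow_mul, zpow_natCast, hx, one_zpow]
  have hidx := index_dg (F := F) hp hpq hn
  obtain ⟨a, ha⟩ := hP.nonempty_fixed_point_of_prime_not_dvd_card
    (Matrix.GeneralLinearGroup (Fin n) F ⧸ T) hidx
  obtain ⟨y, rfl⟩ := QuotientGroup.mk_surjective a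
  have h1 := ha ⟨x, Subgroup.mem_zpowers x⟩
  have h2 : ((x * y : Matrix.GeneralLinearGroup (Fin n) F) :
    Matrix.GeneralLinearGroup (Fin n) F ⧸ T) = y := h1
  have h3 := QuotientGroup.eq.mp h2.symm
  obtain ⟨z, hz⟩ := h3
  exact ⟨y⁻¹, z, by rw [hz]; group⟩

lemma conj_dg_sorted {p : ℕ} (hp : p.Prime) (hpq : p ∣ Fintype.card F - 1) (hn : n < p)
    (x : Matrix.GeneralLinearGroup (Fin n) F) (e : ℕ) (hx : x ^ p ^ e = 1) :
    ∃ (h : Matrix.GeneralLinearGroup (Fin n) F) (z : Fin n → Fˣ) (κ : Fin n → ℕ),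
      h * x * h⁻¹ = dg z ∧ Monotone κ ∧ ∀ i j, z i = z j ↔ κ i = κ j := by
  classical
  obtain ⟨h, z, hz⟩ := conj_dg hp hpq hn x e hx
  let ι : Fˣ → ℕ := fun a => Fintype.equivFin Fˣ a
  have hι : Function.Injective ι := Fin.val_injective.comp (Fintype.equivFin Fˣ).injective
  let σ := Tuple.sort (ι ∘ z)
  refine ⟨pm σ⁻¹ * h, z ∘ σ, (ι ∘ z) ∘ σ, ?_, Tuple.monotone_sort _, ?_⟩
  · have h1 : pm σ⁻¹ * h * x * (pm σ⁻¹ * h)⁻¹ = pm σ⁻¹ * (h * x * h⁻¹) * (pm σ⁻¹)⁻¹ := by group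
    rw [h1, hz, pm_mul_dg, inv_inv, mul_inv_cancel_right]
    rfl
  · intro i j
    exact hι.eq_iff.symm

lemma char_pow_eq (ρ : Representation ℂ (Matrix.GeneralLinearGroup (Fin n) F) V)
    (hirr : ∀ W : Submodule ℂ V, (∀ g, ∀ x ∈ W, ρ g x ∈ W) → W ≠ ⊥ → W = ⊤)
    (θ : (Fin n → Fˣ) → ℂ) (v : V) (hv : IsWt ρ θ v)
    {p : ℕ} (hp : p.Prime) (hpq : p ∣ Fintype.card F - 1) (hn : n < p)
    (e m b : ℕ) (hcard : Nat.card (Matrix.GeneralLinearGroup (Fin n) F) = p ^ e * m)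
    (hpm : p.Coprime m)
    (hθ : ∀ z : Fin n → Fˣ, (∀ i, z i ^ p ^ e = 1) → ∀ k, p ^ b ∣ k → θ (z ^ k) = 1)
    (k : ℕ) (hk : p ^ b * m ∣ k)
    (hcop : (k + 1).Coprime (Nat.card (Matrix.GeneralLinearGroup (Fin n) F)))
    (g : Matrix.GeneralLinearGroup (Fin n) F) :
    LinearMap.trace ℂ V (ρ (g ^ (k + 1))) = LinearMap.trace ℂ V (ρ g) := by
  obtain ⟨α, hα1, hα2⟩ := Nat.chineseRemainder (Nat.Coprime.pow_left e hpm) 1 0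
  have hcardpow : ∀ y : Matrix.GeneralLinearGroup (Fin n) F, y ^ (p ^ e * m) = 1 := by
    intro y; rw [← hcard]; exact pow_card_eq_one'
  obtain ⟨α', hα'⟩ := (Nat.modEq_zero_iff_dvd).mp hα2
  have hx : (g ^ α) ^ p ^ e = 1 := by
    rw [← pow_mul, hα', show m * α' * p ^ e = (p ^ e * m) * α' by ring, pow_mul, hcardpow, one_pow]
  obtain ⟨h, z, κ, hz, hκ, hzκ⟩ := conj_dg_sorted hp hpq hn (g ^ α) e hx
  set g' := h * g * h⁻¹ with hg'
  have hconj : ∀ y, LinearMap.trace ℂ V (ρ (h * y * h⁻¹)) = LinearMap.trace ℂ V (ρ y) := by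
    intro y
    rw [map_mul, LinearMap.trace_mul_comm, ← map_mul]
    congr 2; group
  have hpowc : ∀ l : ℕ, g' ^ l = h * g ^ l * h⁻¹ := fun l => conj_pow
  have hα : g' ^ α = dg z := by rw [hpowc, hz]
  have hzp : ∀ i, z i ^ p ^ e = 1 := by
    have : dg (z ^ p ^ e) = (1 : Matrix.GeneralLinearGroup (Fin n) F) := by
      rw [map_pow, ← hα, ← pow_mul, mul_comm, pow_mul]
      rw [← pow_mul, hα', show p ^ e * (m * α') = (p ^ e * m) * α' by ring, pow_mul, hcardpow,
        one_pow]
    have h2 := dg_inj (this.trans (map_one dg).symm)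
    intro i
    exact congrFun h2 i
  have hkey : g' ^ (k + 1) = dg (z ^ k) * g' := by
    rw [pow_succ, map_pow, ← hα, ← pow_mul]
    congr 1
    obtain ⟨k', hk'⟩ := hk
    have hmod : k ≡ α * k [MOD (p ^ e * m)] := by
      rw [← Nat.modEq_and_modEq_iff_modEq_mul (Nat.Coprime.pow_left e hpm)]
      constructor
      · have := (hα1.mul_right k).symm
        rwa [one_mul] at this
      · have h1 : m ∣ k := ⟨p ^ b * k', by rw [hk']; ring⟩
        exact ((Nat.modEq_zero_iff_dvd).mpr h1).trans
          ((Nat.modEq_zero_iff_dvd).mpr (h1.mul_left α)).symm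
    exact pow_eq_pow_iff_modEq.mpr (hmod.of_dvd (orderOf_dvd_of_pow_eq_one (hcardpow g')))
  have hcommz : g' * dg z = dg z * g' := by rw [← hα]; exact (Commute.refl g').pow_right α
  have hcommz' : ∀ y, y * g' = g' * y → y * dg z = dg z * y := by
    intro y hy
    rw [← hα]
    exact Commute.pow_right hy α
  have t1 := trace_levi ρ (fun i j => (hzκ i j).mp) hcommz hcommz'
  have hcomm2 : g' ^ (k + 1) * dg z = dg z * g' ^ (k + 1) :=
    Commute.pow_left hcommz (k + 1)
  have hcomm2' : ∀ y, y * g' ^ (k + 1) = g' ^ (k + 1) * y → y * dg z = dg z * y := by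
    intro y hy
    apply hcommz'
    obtain ⟨l, hl⟩ := exists_pow_eq_self_of_coprime
      (hcop.coprime_dvd_right (orderOf_dvd_natCard g'))
    have : Commute y ((g' ^ (k + 1)) ^ l) := Commute.pow_right hy l
    rw [hl] at this
    exact this
  have t2 := trace_levi ρ (fun i j => (hzκ i j).mp) hcomm2 hcomm2'
  have e1 : avg ρ (Um (F := F) κ) * ρ (dg (z ^ k)) = avg ρ (Um κ) := by
    apply avg_eq_of_wt ρ hirr θ v hv hκ
    · intro i j hij
      simp [(hzκ i j).mpr hij]
    · intro σ
      exact hθ (fun i => z (σ i)) (fun i => hzp _) k ((Dvd.intro _ rfl).trans hk)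
  have e2 : avg ρ (Um κ) * ρ (g' ^ (k + 1)) = avg ρ (Um κ) * ρ g' := by
    rw [hkey, map_mul ρ, ← mul_assoc (avg ρ (Um κ)), e1]
  have t3 := hconj (g ^ (k + 1))
  rw [← hpowc] at t3
  rw [← t3, ← hconj g, ← t2, e2, t1]

end Conj

section Cyc


noncomputable local instance (priority := 2000) algQa (K : IntermediateField ℚ ℂ) : Algebra ℚ K :=
  IntermediateField.algebra' K

lemma pow_one_of_dvd {M : Type*} [Monoid M] {y : M} {a b : ℕ} (h : a ∣ b) (hy : y ^ a = 1) :
    y ^ b = 1 := by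
  obtain ⟨k, rfl⟩ := h
  rw [pow_mul, hy, one_pow]

lemma pow_congr_mod {M : Type*} [Monoid M] {y : M} {m u w : ℕ} (hy : y ^ m = 1)
    (h : u ≡ w [MOD m]) : y ^ u = y ^ w := by
  rw [pow_eq_pow_mod u hy, pow_eq_pow_mod w hy, h]

lemma mem_Qcyc_of_pow {N : ℕ} {z : ℂ} (hz : z ^ N = 1) : z ∈ Qcyc N :=
  IntermediateField.subset_adjoin ℚ _ hz

lemma Qcyc_mono {M N : ℕ} (h : M ∣ N) : Qcyc M ≤ Qcyc N := by
  apply IntermediateField.adjoin.mono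
  rintro z (hz : z ^ M = 1)
  obtain ⟨k, rfl⟩ := h
  show z ^ (M * k) = 1
  rw [pow_mul, hz, one_pow]

lemma exists_prim (N : ℕ) (hN : 0 < N) : ∃ ζ : ℂ, IsPrimitiveRoot ζ N :=
  ⟨_, Complex.isPrimitiveRoot_exp N hN.ne'⟩

lemma Qcyc_eq_adjoin {N : ℕ} (hN : 0 < N) {ζ : ℂ} (hζ : IsPrimitiveRoot ζ N) :
    Qcyc N = IntermediateField.adjoin ℚ {ζ} := by
  have : NeZero N := ⟨hN.ne'⟩
  apply le_antisymm
  · apply IntermediateField.adjoin_le_iff.mpr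
    rintro z (hz : z ^ N = 1)
    obtain ⟨i, -, rfl⟩ := hζ.eq_pow_of_pow_eq_one hz
    exact pow_mem (IntermediateField.mem_adjoin_simple_self ℚ ζ) i
  · apply IntermediateField.adjoin_le_iff.mpr
    rintro z rfl
    exact mem_Qcyc_of_pow hζ.pow_eq_one

lemma Qcyc_isCyc {N : ℕ} (hN : 0 < N) : IsCyclotomicExtension {N} ℚ (Qcyc N) := by
  have : NeZero N := ⟨hN.ne'⟩
  have h := IntermediateField.isCyclotomicExtension_adjoin_of_exists_isPrimitiveRoot {N} ℚ ℂ
    (fun n hn hn0 => exists_prim n (Nat.pos_of_ne_zero hn0))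
  have e : Qcyc N =
      IntermediateField.adjoin ℚ {b : ℂ | ∃ n ∈ ({N} : Set ℕ), n ≠ 0 ∧ b ^ n = 1} := by
    unfold Qcyc
    congr 1
    ext z
    simp [hN.ne']
  rw [e]
  exact h

lemma Qcyc_fd {N : ℕ} (hN : 0 < N) : FiniteDimensional ℚ (Qcyc N) := by
  have := Qcyc_isCyc hN
  have : NeZero N := ⟨hN.ne'⟩
  exact IsCyclotomicExtension.finiteDimensional {N} ℚ (Qcyc N)

lemma Qcyc_gal {N : ℕ} (hN : 0 < N) : IsGalois ℚ (Qcyc N) := by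
  have := Qcyc_isCyc hN
  have : NeZero N := ⟨hN.ne'⟩
  exact IsCyclotomicExtension.isGalois {N} ℚ (Qcyc N)

lemma Qcyc_finrank {N : ℕ} (hN : 0 < N) : Module.finrank ℚ (Qcyc N) = N.totient := by
  have := Qcyc_isCyc hN
  have : NeZero N := ⟨hN.ne'⟩
  have h := IsCyclotomicExtension.finrank (n := N) (K := ℚ) (Qcyc N)
    (Polynomial.cyclotomic.irreducible_rat hN)
  exact h

/-- Galois descent. -/
lemma mem_of_fixed {N : ℕ} (hN : 0 < N) (K : IntermediateField ℚ ℂ) (hK : K ≤ Qcyc N)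
    (x : Qcyc N)
    (h : ∀ σ : (Qcyc N) ≃ₐ[ℚ] (Qcyc N), (∀ y : Qcyc N, (y : ℂ) ∈ K → σ y = y) → σ x = x) :
    (x : ℂ) ∈ K := by
  have := Qcyc_fd hN
  have := Qcyc_gal hN
  rw [← IntermediateField.mem_restrict hK,
    ← IsGalois.fixedField_fixingSubgroup (IntermediateField.restrict hK)]
  rintro ⟨σ, hσ⟩
  apply h
  intro y hy
  exact hσ ⟨y, (IntermediateField.mem_restrict hK y).mpr hy⟩

lemma aut_pow {N : ℕ} (hN : 0 < N) (σ : (Qcyc N) ≃ₐ[ℚ] (Qcyc N)) :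
    ∃ t : ℕ, t.Coprime N ∧ ∀ y : Qcyc N, y ^ N = 1 → σ y = y ^ t := by
  have : NeZero N := ⟨hN.ne'⟩
  have := Qcyc_isCyc hN
  have hζ := IsCyclotomicExtension.zeta_spec N ℚ (Qcyc N)
  have h1 := hζ.map_of_injective (f := σ) σ.injective
  obtain ⟨t, -, ht⟩ := hζ.eq_pow_of_pow_eq_one h1.pow_eq_one
  refine ⟨t, ?_, ?_⟩
  · rw [← ht] at h1
    exact (hζ.pow_iff_coprime hN t).mp h1
  · intro y hy
    obtain ⟨i, -, rfl⟩ := hζ.eq_pow_of_pow_eq_one hy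
    rw [map_pow, ← ht, pow_right_comm]

lemma exists_aut {N : ℕ} (hN : 0 < N) (t : ℕ) (ht : t.Coprime N) :
    ∃ σ : (Qcyc N) ≃ₐ[ℚ] (Qcyc N), ∀ y : Qcyc N, y ^ N = 1 → σ y = y ^ t := by
  have : NeZero N := ⟨hN.ne'⟩
  have := Qcyc_isCyc hN
  have hζ := IsCyclotomicExtension.zeta_spec N ℚ (Qcyc N)
  refine ⟨IsCyclotomicExtension.fromZetaAut (hζ.pow_of_coprime t ht)
    (Polynomial.cyclotomic.irreducible_rat hN), ?_⟩
  intro y hy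
  obtain ⟨i, -, rfl⟩ := hζ.eq_pow_of_pow_eq_one hy
  rw [map_pow, IsCyclotomicExtension.fromZetaAut_spec, pow_right_comm]

/-- two automorphisms agreeing on `N`-th roots of unity agree on `Qcyc N` -/
lemma aut_eq_on {L M : ℕ} (σ τ : (Qcyc L) ≃ₐ[ℚ] (Qcyc L)) (hML : M ∣ L)
    (h : ∀ y : Qcyc L, y ^ M = 1 → σ y = τ y) (y : Qcyc L) (hy : (y : ℂ) ∈ Qcyc M) :
    σ y = τ y := by
  have key : (σ : Qcyc L →ₐ[ℚ] Qcyc L).comp (IntermediateField.inclusion (Qcyc_mono hML)) =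
      (τ : Qcyc L →ₐ[ℚ] Qcyc L).comp (IntermediateField.inclusion (Qcyc_mono hML)) := by
    apply IntermediateField.algHom_ext_of_eq_adjoin ℚ (S := Qcyc M) rfl
    intro x hx
    apply h
    apply Subtype.ext
    exact hx
  exact DFunLike.congr_fun key ⟨y, hy⟩

lemma modEq_of_fix {L M t : ℕ} (hL : 0 < L) (hML : M ∣ L)
    (h : ∀ y : Qcyc L, y ^ M = 1 → y ^ t = y) : t ≡ 1 [MOD M] := by
  obtain ⟨ζ, hζ⟩ := exists_prim M (Nat.pos_of_dvd_of_pos hML hL)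
  have h1 := h ⟨ζ, Qcyc_mono hML (mem_Qcyc_of_pow hζ.pow_eq_one)⟩
    (Subtype.ext hζ.pow_eq_one)
  have h2 : ζ ^ t = ζ := congrArg Subtype.val h1
  have h3 : ζ ^ t = ζ ^ 1 := by rw [h2, pow_one]
  have h4 : IsOfFinOrder ζ :=
    isOfFinOrder_iff_pow_eq_one.mpr ⟨M, Nat.pos_of_dvd_of_pos hML hL, hζ.pow_eq_one⟩
  rw [hζ.eq_orderOf]
  exact h4.pow_eq_pow_iff_modEq.mp h3

lemma Qcyc_inf {A B : ℕ} (hA : 0 < A) (hB : 0 < B) {x : ℂ} (h1 : x ∈ Qcyc A) (h2 : x ∈ Qcyc B) :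
    x ∈ Qcyc (Nat.gcd A B) := by
  have hL : 0 < A * B := Nat.mul_pos hA hB
  have hg : Nat.gcd A B ∣ A * B := (Nat.gcd_dvd_left A B).mul_right B
  refine mem_of_fixed hL _ (Qcyc_mono hg) ⟨x, Qcyc_mono (Dvd.intro _ rfl) h1⟩ ?_
  intro σ hσ
  obtain ⟨t, htc, ht⟩ := aut_pow hL σ
  have htg : t ≡ 1 [MOD (Nat.gcd A B)] := by
    apply modEq_of_fix hL hg
    intro y hy
    rw [← ht y]
    · apply hσ
      apply mem_Qcyc_of_pow
      exact congrArg Subtype.val hy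
    · exact pow_one_of_dvd hg hy
  obtain ⟨s, hsA, hsB⟩ := Nat.chineseRemainder' htg.symm
  have hsc : s.Coprime (A * B) := by
    apply Nat.Coprime.mul_right
    · rw [Nat.Coprime, hsA.gcd_eq, Nat.gcd_one_left]
    · rw [Nat.Coprime, hsB.gcd_eq]
      exact htc.coprime_dvd_right (Dvd.intro_left _ rfl)
  obtain ⟨τ, hτ⟩ := exists_aut hL s hsc
  have hp : ∀ (y : Qcyc (A * B)) (M u w : ℕ), y ^ M = 1 → u ≡ w [MOD M] → y ^ u = y ^ w := by
    intro y M u w hy huw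
    exact pow_congr_mod hy huw
  have e1 := aut_eq_on σ τ (M := B) (Dvd.intro_left _ rfl) (fun y hy => by
    have hy' : y ^ (A * B) = 1 := pow_one_of_dvd (Dvd.intro_left _ rfl) hy
    rw [ht y hy', hτ y hy']
    exact hp y B _ _ hy hsB.symm) ⟨x, Qcyc_mono (Dvd.intro _ rfl) h1⟩ h2
  have e2 := aut_eq_on τ 1 (M := A) (Dvd.intro _ rfl) (fun y hy => by
    have hy' : y ^ (A * B) = 1 := pow_one_of_dvd (Dvd.intro _ rfl) hy
    rw [hτ y hy', AlgEquiv.one_apply, hp y A _ _ hy hsA, pow_one])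
    ⟨x, Qcyc_mono (Dvd.intro _ rfl) h1⟩ h1
  rw [e1, e2]
  rfl

lemma sum_mem_Qcyc {N : ℕ} {R : Multiset ℂ} (hR : ∀ ω ∈ R, ω ^ N = 1) : R.sum ∈ Qcyc N :=
  multiset_sum_mem _ fun ω hω => mem_Qcyc_of_pow (hR ω hω)

lemma aut_sum {N t : ℕ} (σ : (Qcyc N) ≃ₐ[ℚ] (Qcyc N))
    (ht : ∀ y : Qcyc N, y ^ N = 1 → σ y = y ^ t)
    {R : Multiset ℂ} (hR : ∀ ω ∈ R, ω ^ N = 1) (x : Qcyc N) (hx : (x : ℂ) = R.sum) :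
    ((σ x : Qcyc N) : ℂ) = (R.map (· ^ t)).sum := by
  lift R to Multiset (Qcyc N) using fun ω hω => mem_Qcyc_of_pow (hR ω hω)
  have hx' : x = R.sum := by
    apply Subtype.ext
    rw [hx]
    exact (map_multiset_sum (Qcyc N).val R).symm
  rw [hx', map_multiset_sum, Multiset.map_map]
  have : R.map σ = R.map (· ^ t) := by
    apply Multiset.map_congr rfl
    intro y hy
    apply ht
    apply Subtype.ext
    exact hR _ (Multiset.mem_map_of_mem _ hy)
  rw [this]
  have h3 := map_multiset_sum (Qcyc N).val (R.map (· ^ t))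
  rw [Multiset.map_map] at h3
  exact h3

lemma sum_mem_of_pow_eq {N M : ℕ} (hN : 0 < N) (hMN : M ∣ N) {R : Multiset ℂ}
    (hR : ∀ ω ∈ R, ω ^ N = 1)
    (h : ∀ t : ℕ, t.Coprime N → t ≡ 1 [MOD M] → (R.map (· ^ t)).sum = R.sum) :
    R.sum ∈ Qcyc M := by
  refine mem_of_fixed hN _ (Qcyc_mono hMN) ⟨R.sum, sum_mem_Qcyc hR⟩ ?_
  intro σ hσ
  obtain ⟨t, htc, ht⟩ := aut_pow hN σ
  apply Subtype.ext
  rw [aut_sum σ ht hR _ rfl]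
  apply h t htc
  apply modEq_of_fix hN hMN
  intro y hy
  rw [← ht y]
  · apply hσ
    apply mem_Qcyc_of_pow
    exact congrArg Subtype.val hy
  · exact pow_one_of_dvd hMN hy

end Cyc

section Vanish

lemma sum_eq_sum_count {N : ℕ} (hN : 0 < N) {ζ : ℂ} (hζ : IsPrimitiveRoot ζ N)
    (R : Multiset ℂ) (hR : ∀ ω ∈ R, ω ^ N = 1) :
    R.sum = ∑ e ∈ Finset.range N, (R.count (ζ ^ e) : ℂ) * ζ ^ e := by
  classical
  have : NeZero N := ⟨hN.ne'⟩
  rw [Finset.sum_multiset_count]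
  have hinj : Set.InjOn (fun e => ζ ^ e) (Finset.range N : Set ℕ) := by
    intro i hi j hj h
    exact hζ.pow_inj (Finset.mem_range.mp hi) (Finset.mem_range.mp hj) h
  have h1 := Finset.sum_image (s := Finset.range N) (g := fun e => ζ ^ e)
    (f := fun w => (R.count w : ℂ) * w) hinj
  rw [← h1]
  simp only [nsmul_eq_mul]
  apply Finset.sum_subset
  · intro w hw
    obtain ⟨i, hi, rfl⟩ := hζ.eq_pow_of_pow_eq_one (hR w (Multiset.mem_toFinset.mp hw))
    exact Finset.mem_image.mpr ⟨i, Finset.mem_range.mpr hi, rfl⟩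
  · intro w _ hw
    rw [Multiset.mem_toFinset] at hw
    simp [Multiset.count_eq_zero_of_notMem hw]

lemma count_periodic {p b : ℕ} (hp : p.Prime) {ζ : ℂ} (hζ : IsPrimitiveRoot ζ (p ^ (b + 1)))
    (R : Multiset ℂ) (hR : ∀ ω ∈ R, ω ^ p ^ (b + 1) = 1) (h0 : R.sum = 0)
    (k : ℕ) (hk : k < p ^ (b + 1)) : R.count (ζ ^ k) = R.count (ζ ^ (k % p ^ b)) := by
  classical
  set N := p ^ (b + 1) with hNdef
  set q := p ^ b with hq
  have hN : 0 < N := pow_pos hp.pos _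
  have hqpos : 0 < q := pow_pos hp.pos _
  have hNq : N = p * q := by rw [hNdef, hq, pow_succ, mul_comm]
  let P : Polynomial ℚ := ∑ e ∈ Finset.range N,
    Polynomial.C (R.count (ζ ^ e) : ℚ) * Polynomial.X ^ e
  have hPc : ∀ k < N, P.coeff k = R.count (ζ ^ k) := by
    intro k hk
    simp [P, Polynomial.finsetSum_coeff, Polynomial.coeff_X_pow, hk]
  have hPd : P.degree < N := by
    rw [Polynomial.degree_lt_iff_coeff_zero]
    intro m hm
    simp [P, Polynomial.finsetSum_coeff, Polynomial.coeff_X_pow, hm]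
  have hP0 : Polynomial.aeval ζ P = 0 := by
    rw [sum_eq_sum_count hN hζ R hR] at h0
    simp only [P, map_sum, map_mul, map_pow, Polynomial.aeval_X, Polynomial.aeval_C]
    simpa using h0
  have hdvd := minpoly.dvd ℚ ζ hP0
  rw [← Polynomial.cyclotomic_eq_minpoly_rat hζ hN] at hdvd
  obtain ⟨Q, hQ⟩ := hdvd
  have hQd : Q.degree < q := by
    by_cases hQ0 : Q = 0
    · rw [hQ0, Polynomial.degree_zero]; exact WithBot.bot_lt_coe _
    rw [hQ, Polynomial.degree_mul, Polynomial.degree_cyclotomic, hNdef,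
      Nat.totient_prime_pow_succ hp, Polynomial.degree_eq_natDegree hQ0] at hPd
    rw [Polynomial.degree_eq_natDegree hQ0]
    rw [← hNdef, hNq, ← hq] at hPd
    have h2 : q * (p - 1) + Q.natDegree < p * q := by exact_mod_cast hPd
    have h3 : q * (p - 1) + q = p * q := by
      obtain ⟨r, rfl⟩ : ∃ r, p = r + 1 := ⟨p - 1, by have := hp.pos; omega⟩
      simp; ring
    have : Q.natDegree < q := by omega
    exact_mod_cast this
  have hcf : ∀ e < q, ∀ i < p, P.coeff (e + i * q) = Q.coeff e := by
    intro e he i hi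
    rw [hQ, hNdef, Polynomial.cyclotomic_prime_pow_eq_geom_sum hp, Finset.sum_mul,
      Polynomial.finsetSum_coeff, Finset.sum_eq_single i]
    · rw [← pow_mul, Polynomial.coeff_X_pow_mul', ← hq, mul_comm q i, if_pos (by omega)]
      congr 1; omega
    · intro j hj hji
      rw [← pow_mul, Polynomial.coeff_X_pow_mul', ← hq, mul_comm q j]
      split_ifs with hle
      · apply Polynomial.coeff_eq_zero_of_degree_lt
        refine hQd.trans_le ?_
        have hlt : j < i := by
          by_contra hcon
          have h5 : i + 1 ≤ j := by omega
          have h6 : (i + 1) * q ≤ j * q := Nat.mul_le_mul_right q h5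
          rw [add_mul] at h6
          omega
        have h6 : (j + 1) * q ≤ i * q := Nat.mul_le_mul_right q hlt
        rw [add_mul] at h6
        have : q ≤ e + i * q - j * q := by omega
        exact_mod_cast this
      · rfl
    · intro hi'
      exact absurd (Finset.mem_range.mpr hi) hi'
  have hkq : k % q < q := Nat.mod_lt _ hqpos
  have hki : k / q < p := by
    rw [Nat.div_lt_iff_lt_mul hqpos, ← hNq]; exact hk
  have e1 := hcf (k % q) hkq (k / q) hki
  have e2 := hcf (k % q) hkq 0 hp.pos
  rw [mul_comm, Nat.mod_add_div, hPc k hk] at e1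
  rw [zero_mul, add_zero, hPc _ (lt_of_lt_of_le hkq (by rw [hNq]; exact Nat.le_mul_of_pos_left q hp.pos))] at e2
  have := e1.trans e2.symm
  exact_mod_cast this

lemma count_shift {p b : ℕ} (hp : p.Prime)
    (R : Multiset ℂ) (hR : ∀ ω ∈ R, ω ^ p ^ (b + 1) = 1) (h0 : R.sum = 0)
    (ω η : ℂ) (hω : ω ^ p ^ (b + 1) = 1) (hη : η ^ p = 1) : R.count (ω * η) = R.count ω := by
  have hN : 0 < p ^ (b + 1) := pow_pos hp.pos _
  have : NeZero (p ^ (b + 1)) := ⟨hN.ne'⟩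
  obtain ⟨ζ, hζ⟩ := exists_prim (p ^ (b + 1)) hN
  have hωη : (ω * η) ^ p ^ (b + 1) = 1 := by
    rw [mul_pow, hω, one_mul]
    exact pow_one_of_dvd (Dvd.intro_left (p ^ b) (pow_succ p b).symm) hη
  obtain ⟨i, hi, hi'⟩ := hζ.eq_pow_of_pow_eq_one hω
  obtain ⟨j, hj, hj'⟩ := hζ.eq_pow_of_pow_eq_one hωη
  rw [← hj', count_periodic hp hζ R hR h0 j hj, ← hi', count_periodic hp hζ R hR h0 i hi]
  have h4 : IsOfFinOrder ζ :=
    isOfFinOrder_iff_pow_eq_one.mpr ⟨_, hN, hζ.pow_eq_one⟩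
  have h5 : ζ ^ (j * p) = ζ ^ (i * p) := by
    rw [pow_mul, hj', pow_mul, hi', mul_pow, hη, mul_one]
  have h6 := h4.pow_eq_pow_iff_modEq.mp h5
  rw [← hζ.eq_orderOf, pow_succ] at h6
  have h7 : j ≡ i [MOD p ^ b] := Nat.ModEq.mul_right_cancel' hp.ne_zero h6
  rw [h7]

lemma dvd_card_of_sum_zero {p : ℕ} (hp : p.Prime)
    (R : Multiset ℂ) (hR : ∀ ω ∈ R, ω ^ p = 1) (h0 : R.sum = 0) : p ∣ R.card := by
  classical
  obtain ⟨ζ, hζ⟩ := exists_prim p hp.pos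
  have : NeZero p := ⟨hp.ne_zero⟩
  rw [← Multiset.toFinset_sum_count_eq]
  have h1 : ∑ a ∈ R.toFinset, R.count a = ∑ a ∈ Polynomial.nthRootsFinset p (1 : ℂ), R.count a := by
    apply Finset.sum_subset
    · intro w hw
      rw [Polynomial.mem_nthRootsFinset hp.pos]
      exact hR w (Multiset.mem_toFinset.mp hw)
    · intro w _ hw
      rw [Multiset.mem_toFinset] at hw
      exact Multiset.count_eq_zero_of_notMem hw
  have h2 : ∀ a ∈ Polynomial.nthRootsFinset p (1 : ℂ), R.count a = R.count 1 := by
    intro a ha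
    rw [Polynomial.mem_nthRootsFinset hp.pos] at ha
    have := count_shift (b := 0) hp R (by simpa using hR) h0 1 a (by simp) ha
    rwa [one_mul] at this
  rw [h1, Finset.sum_congr rfl h2, Finset.sum_const, hζ.card_nthRootsFinset, smul_eq_mul]
  exact Dvd.intro _ rfl

lemma modEq_of_pow_modEq {p b t : ℕ} (hp : p.Prime) (hodd : Odd p) (hb : 1 ≤ b)
    (h : t ^ p ≡ 1 [MOD p ^ (b + 1)]) : t ≡ 1 [MOD p ^ b] := by
  have := Fact.mk hp
  have h1 : t ≡ 1 [MOD p] := by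
    have h2 : t ^ p ≡ 1 [MOD p] := h.of_dvd (dvd_pow_self p (by omega))
    rw [← ZMod.natCast_eq_natCast_iff] at h2 ⊢
    push_cast at h2 ⊢
    rwa [ZMod.pow_card] at h2
  have hd : (p : ℤ) ∣ (t : ℤ) - 1 := by
    have := (Nat.modEq_iff_dvd.mp h1.symm)
    simpa using this
  have hnd : ¬ (p : ℤ) ∣ (t : ℤ) := by
    intro hcon
    have := (Int.dvd_sub hcon hd)
    simp at this
    exact hp.one_lt.ne' (by exact_mod_cast Int.natCast_dvd_natCast.mp this |> Nat.dvd_one.mp)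
  have h3 := Int.emultiplicity_pow_sub_pow hp hodd hd hnd p
  have h4 : ((p ^ (b + 1) : ℕ) : ℤ) ∣ (t : ℤ) ^ p - 1 ^ p := by
    have := (Nat.modEq_iff_dvd.mp h.symm)
    simpa using this
  push_cast at h4
  rw [pow_dvd_iff_le_emultiplicity, h3, Nat.Prime.emultiplicity_self hp] at h4
  have h5 : (b : ℕ∞) ≤ emultiplicity (p : ℤ) ((t : ℤ) - 1) := by
    push_cast at h4
    exact (ENat.add_le_add_iff_right ENat.one_ne_top).mp h4
  rw [← pow_dvd_iff_le_emultiplicity] at h5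
  apply Nat.ModEq.symm
  rw [Nat.modEq_iff_dvd]
  exact_mod_cast h5

end Vanish

section MainField


noncomputable local instance (priority := 2000) algQb (K : IntermediateField ℚ ℂ) : Algebra ℚ K :=
  IntermediateField.algebra' K

lemma relfinrank_card {N : ℕ} (hN : 0 < N) (K : IntermediateField ℚ ℂ) (hK : K ≤ Qcyc N) :
    K.relfinrank (Qcyc N) = Nat.card (IntermediateField.restrict hK).fixingSubgroup := by
  have := Qcyc_fd hN
  have := Qcyc_gal hN
  rw [IsGalois.card_fixingSubgroup_eq_finrank]
  have h1 := IntermediateField.finrank_bot_mul_relfinrank hK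
  have h2 := Module.finrank_mul_finrank ℚ (IntermediateField.restrict hK) (Qcyc N)
  have h3 : Module.finrank ℚ K = Module.finrank ℚ (IntermediateField.restrict hK) :=
    (IntermediateField.restrictAlgEquiv hK).toLinearEquiv.finrank_eq
  rw [← h3] at h2
  have h4 := h1.trans h2.symm
  have h5 : Module.finrank ℚ K ≠ 0 := by
    intro h0
    rw [h0, zero_mul] at h1
    have : 0 < Module.finrank ℚ (Qcyc N) := Module.finrank_pos
    omega
  exact Nat.eq_of_mul_eq_mul_left (Nat.pos_of_ne_zero h5) h4

lemma Qadj_le {c : ℂ} {K : IntermediateField ℚ ℂ} (h : c ∈ K) : Qadj c ≤ K :=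
  IntermediateField.adjoin_simple_le_iff.mpr h

lemma mem_Qadj (c : ℂ) : c ∈ Qadj c := IntermediateField.mem_adjoin_simple_self ℚ c

lemma main_lemma {p b : ℕ} (hp : p.Prime) (hodd : Odd p) (hb : 1 ≤ b) (R : Multiset ℂ)
    (hR : ∀ ω ∈ R, ω ^ p ^ (b + 1) = 1) (hcard : R.toFinset.card < p)
    (ω₀ : ℂ) (hω₀ : ω₀ ∈ R) (hprim : IsPrimitiveRoot ω₀ (p ^ (b + 1))) :
    ¬ p ∣ (Qadj R.sum).relfinrank (Qcyc (p ^ (b + 1))) := by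
  classical
  intro hdvd
  have := Fact.mk hp
  set N := p ^ (b + 1) with hNdef
  have hN : 0 < N := pow_pos hp.pos _
  have hpN : p ∣ N := dvd_pow_self p (by omega)
  have := Qcyc_fd hN
  have hmem : R.sum ∈ Qcyc N := sum_mem_Qcyc hR
  have hK : Qadj R.sum ≤ Qcyc N := Qadj_le hmem
  rw [relfinrank_card hN _ hK] at hdvd
  obtain ⟨⟨τ, hτK⟩, hτ⟩ := exists_prime_orderOf_dvd_card' p hdvd
  have hτp : τ ^ p = 1 := by
    have := pow_orderOf_eq_one (⟨τ, hτK⟩ : (IntermediateField.restrict hK).fixingSubgroup)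
    rw [hτ] at this
    exact congrArg Subtype.val this
  have hτ1 : τ ≠ 1 := by
    rintro rfl
    have h1 : (⟨1, hτK⟩ : (IntermediateField.restrict hK).fixingSubgroup) = 1 := rfl
    rw [h1, orderOf_one] at hτ
    exact hp.one_lt.ne hτ
  let c : Qcyc N := ⟨R.sum, hmem⟩
  have hτc : τ c = c :=
    hτK ⟨c, (IntermediateField.mem_restrict hK c).mpr (mem_Qadj _)⟩
  obtain ⟨t, htc, ht⟩ := aut_pow hN τ
  have hti : ∀ i : ℕ, ∀ y : Qcyc N, y ^ N = 1 → (τ ^ i) y = y ^ t ^ i := by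
    intro i
    induction i with
    | zero => intro y _; simp
    | succ i ih =>
      intro y hy
      rw [pow_succ, AlgEquiv.mul_apply, ht y hy, map_pow, ih y hy, ← pow_mul, pow_succ]
  have hτic : ∀ i : ℕ, (τ ^ i) c = c := by
    intro i
    induction i with
    | zero => simp
    | succ i ih => rw [pow_succ, AlgEquiv.mul_apply, hτc, ih]
  have htp : t ^ p ≡ 1 [MOD N] := by
    apply modEq_of_fix hN dvd_rfl
    intro y hy
    rw [← hti p y hy, hτp, AlgEquiv.one_apply]
  have ht1 : ¬ t ≡ 1 [MOD N] := by
    intro h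
    apply hτ1
    ext y : 1
    apply aut_eq_on τ 1 dvd_rfl _ y y.2
    intro y hy
    rw [ht y hy, AlgEquiv.one_apply, pow_congr_mod hy h, pow_one]
  have htb : t ≡ 1 [MOD p ^ b] := modEq_of_pow_modEq hp hodd hb htp
  have htpos : 1 ≤ t := by
    rcases Nat.eq_zero_or_pos t with h | h
    · rw [h, Nat.coprime_zero_left] at htc
      exact absurd htc (Nat.one_lt_pow (by omega) hp.one_lt).ne'
    · exact h
  obtain ⟨s, hs⟩ : ∃ s, t = 1 + p ^ b * s := by
    obtain ⟨s, hs⟩ := (Nat.modEq_iff_dvd' htpos).mp htb.symm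
    exact ⟨s, by omega⟩
  have hps : ¬ p ∣ s := by
    rintro ⟨r, rfl⟩
    apply ht1
    rw [hs, hNdef, pow_succ]
    show (1 + p ^ b * (p * r)) % (p ^ b * p) = 1 % (p ^ b * p)
    rw [← mul_assoc, Nat.add_mul_mod_self_left]
  have htmp : t ≡ 1 [MOD p] := htb.of_dvd (dvd_pow_self p (by omega))
  let ξ : ℂ → ℂ := fun ω => ω ^ (p ^ b * s)
  have hξp : ∀ ω ∈ R, ξ ω ^ p = 1 := by
    intro ω hω
    simp only [ξ]
    rw [← pow_mul]
    exact pow_one_of_dvd (Dvd.intro s (by rw [hNdef, pow_succ]; ring)) (hR ω hω)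
  have hωt : ∀ i : ℕ, ∀ ω ∈ R, ω ^ t ^ i = ω * ξ ω ^ i := by
    intro i ω hω
    induction i with
    | zero => simp
    | succ i ih =>
      have h1 : ω ^ t = ω * ξ ω := by rw [hs, pow_add, pow_one]
      have h2 : ξ ω ^ t = ξ ω := by rw [pow_congr_mod (hξp ω hω) htmp, pow_one]
      rw [pow_succ, pow_mul, ih, mul_pow, h1, pow_right_comm, h2, pow_succ]
      ring
  have hci : ∀ i : ℕ, (R.map (fun ω => ω * ξ ω ^ i)).sum = R.sum := by
    intro i
    have h1 := aut_sum (τ ^ i) (hti i) hR c rfl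
    rw [hτic i] at h1
    rw [show R.sum = (c : ℂ) from rfl, h1]
    congr 1
    exact Multiset.map_congr rfl fun ω hω => (hωt i ω hω).symm
  have hsum : (R.map (fun ω => ∑ i ∈ Finset.range p, ω * ξ ω ^ i)).sum = p * R.sum := by
    rw [Multiset.sum_map_sum, Finset.sum_congr rfl fun i _ => hci i]
    simp
  have hval : ∀ ω ∈ R, ∑ i ∈ Finset.range p, ω * ξ ω ^ i = if ξ ω = 1 then p * ω else 0 := by
    intro ω hω
    rw [← Finset.mul_sum]
    split_ifs with h
    · simp [h, mul_comm]
    · have := geom_sum_mul (ξ ω) p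
      rw [hξp ω hω, sub_self] at this
      rcases mul_eq_zero.mp this with h1 | h1
      · rw [h1, mul_zero]
      · exact absurd (sub_eq_zero.mp h1) h
  rw [Multiset.map_congr rfl hval] at hsum
  have hfil : (R.map (fun ω => if ξ ω = 1 then (p : ℂ) * ω else 0)).sum =
      p * (R.filter (fun ω => ξ ω = 1)).sum := by
    clear_value ξ
    clear * -
    induction R using Multiset.induction_on with
    | empty => simp
    | cons a R ih =>
      by_cases h : ξ a = 1
      · simp [h, ih, mul_add]
      · simp [h, ih]
  rw [hfil] at hsum
  have hpc : (p : ℂ) ≠ 0 := by exact_mod_cast hp.ne_zero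
  have h1 := mul_left_cancel₀ hpc hsum
  have h2 := congrArg Multiset.sum (Multiset.filter_add_not (fun ω => ξ ω = 1) R)
  rw [Multiset.sum_add, h1] at h2
  set R' := R.filter (fun ω => ¬ ξ ω = 1) with hR'
  have h3 : R'.sum = 0 := by simpa using h2
  have hω₀R' : ω₀ ∈ R' := by
    rw [hR', Multiset.mem_filter]
    refine ⟨hω₀, fun h => hps ?_⟩
    have h4 := (hprim.pow_eq_one_iff_dvd _).mp h
    rw [hNdef, pow_succ] at h4
    exact Nat.dvd_of_mul_dvd_mul_left (pow_pos hp.pos b) h4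
  have hsub : (Polynomial.nthRootsFinset p (1 : ℂ)).image (fun η => ω₀ * η) ⊆ R.toFinset := by
    intro w hw
    obtain ⟨η, hη, rfl⟩ := Finset.mem_image.mp hw
    rw [Polynomial.mem_nthRootsFinset hp.pos] at hη
    have h4 := count_shift hp R' (fun ω hω => hR ω (Multiset.mem_of_mem_filter hω)) h3 ω₀ η
      (hR _ hω₀) hη
    have h5 : 0 < R'.count ω₀ := Multiset.count_pos.mpr hω₀R'
    rw [← h4] at h5
    exact Multiset.mem_toFinset.mpr (Multiset.mem_of_mem_filter (Multiset.count_pos.mp h5))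
  have hle := Finset.card_le_card hsub
  obtain ⟨ζ, hζ⟩ := exists_prim p hp.pos
  rw [Finset.card_image_of_injective _ (mul_right_injective₀ (hprim.ne_zero hN.ne')),
    hζ.card_nthRootsFinset] at hle
  omega

end MainField

section TraceRoots

lemma trace_pow_roots {V : Type*} [AddCommGroup V] [Module ℂ V] [FiniteDimensional ℂ V]
    (A : Module.End ℂ V) {N : ℕ} (hN : 0 < N) (hA : A ^ N = 1) :
    ∃ R : Multiset ℂ, R.card = Module.finrank ℂ V ∧ (∀ ω ∈ R, ω ^ N = 1) ∧
      ∀ t : ℕ, LinearMap.trace ℂ V (A ^ t) = (R.map (· ^ t)).sum := by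
  classical
  have hss : A.IsSemisimple := by
    apply Module.End.isSemisimple_of_squarefree_aeval_eq_zero
      (p := Polynomial.X ^ N - Polynomial.C (1 : ℂ))
    · apply Polynomial.Separable.squarefree
      exact Polynomial.separable_X_pow_sub_C 1 (by exact_mod_cast hN.ne') one_ne_zero
    · simp [hA]
  have htop : ⨆ μ : ℂ, A.eigenspace μ = ⊤ :=
    Module.End.IsSemisimple.iSup_eigenspace_eq_top hss
  have hIntl : DirectSum.IsInternal (fun μ : ℂ => A.eigenspace μ) :=
    DirectSum.isInternal_submodule_of_iSupIndep_of_iSup_eq_top A.eigenspaces_iSupIndep htop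
  have hfin : {μ : ℂ | A.eigenspace μ ≠ ⊥}.Finite :=
    WellFoundedGT.finite_ne_bot_of_iSupIndep A.eigenspaces_iSupIndep
  have hpow : ∀ (μ : ℂ) (t : ℕ) (x : V), x ∈ A.eigenspace μ → (A ^ t) x = μ ^ t • x := by
    intro μ t x hx
    rw [Module.End.mem_eigenspace_iff] at hx
    induction t with
    | zero => simp
    | succ t ih => rw [pow_succ, Module.End.mul_apply, hx, map_smul, ih, smul_smul, pow_succ,
        mul_comm]
  let R : Multiset ℂ := ∑ μ ∈ hfin.toFinset,
    Multiset.replicate (Module.finrank ℂ (A.eigenspace μ)) μ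
  have htr : ∀ t : ℕ, LinearMap.trace ℂ V (A ^ t) = (R.map (· ^ t)).sum := by
    intro t
    have hmaps : ∀ μ : ℂ, Set.MapsTo (A ^ t) (A.eigenspace μ) (A.eigenspace μ) := by
      intro μ x hx
      rw [SetLike.mem_coe] at hx ⊢
      rw [hpow μ t x hx]
      exact Submodule.smul_mem _ _ hx
    rw [LinearMap.trace_eq_sum_trace_restrict' hIntl hfin hmaps]
    have h1 : (R.map (· ^ t)).sum = ∑ μ ∈ hfin.toFinset,
        (Module.finrank ℂ (A.eigenspace μ) : ℂ) * μ ^ t := by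
      have h2 := map_sum (Multiset.mapAddMonoidHom (fun x : ℂ => x ^ t))
        (fun μ => Multiset.replicate (Module.finrank ℂ (A.eigenspace μ)) μ) hfin.toFinset
      rw [Multiset.coe_mapAddMonoidHom] at h2
      rw [h2, ← Multiset.coe_sumAddMonoidHom, map_sum]
      simp
    rw [h1]
    apply Finset.sum_congr rfl
    intro μ _
    have h3 : (A ^ t).restrict (hmaps μ) = μ ^ t • LinearMap.id := by
      ext x
      exact hpow μ t x x.2
    rw [h3, map_smul, LinearMap.trace_id, smul_eq_mul, mul_comm]
  refine ⟨R, ?_, ?_, htr⟩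
  · have h := htr 0
    simp at h
    exact_mod_cast h.symm
  · intro ω hω
    obtain ⟨μ, hμ, hω'⟩ := Multiset.mem_sum.mp hω
    rw [Multiset.eq_of_mem_replicate hω']
    have h1 : A.eigenspace μ ≠ ⊥ := by simpa using hμ
    obtain ⟨x, hx, hx0⟩ := Submodule.exists_mem_ne_zero_of_ne_bot h1
    have h2 := hpow μ N x hx
    rw [hA, Module.End.one_apply] at h2
    have h3 : (μ ^ N - 1) • x = 0 := by rw [sub_smul, ← h2, one_smul, sub_self]
    rcases smul_eq_zero.mp h3 with h | h
    · exact sub_eq_zero.mp h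
    · exact absurd h hx0

end TraceRoots

section Irr

lemma irr_of_simple {G : Type} [Group G] (V : FDRep ℂ G) (hV : Simple V) :
    ∀ W : Submodule ℂ V, (∀ g, ∀ x ∈ W, V.ρ g x ∈ W) → W ≠ ⊥ → W = ⊤ := by
  intro W hW hW0
  let σ : Representation ℂ G W :=
    { toFun := fun g => (V.ρ g).restrict (hW g)
      map_one' := by
        ext x
        simp
      map_mul' := fun g h => by
        ext x
        simp [LinearMap.restrict_apply] }
  let ι : FDRep.of σ ⟶ V :=
    { hom := FGModuleCat.ofHom W.subtype
      comm := fun g => by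
        ext x
        rfl }
  have hmono : Mono ι := by
    apply (Action.forget (FGModuleCat ℂ) G).mono_of_mono_map
    apply (forget₂ (FGModuleCat ℂ) (ModuleCat ℂ)).mono_of_mono_map
    rw [ModuleCat.mono_iff_injective]
    exact Subtype.val_injective
  have hne : ι ≠ 0 := by
    intro h
    obtain ⟨x, hx, hx0⟩ := Submodule.exists_mem_ne_zero_of_ne_bot hW0
    apply hx0
    have h1 := congrArg (fun f : FDRep.of σ ⟶ V => f.hom.hom.hom (⟨x, hx⟩ : W)) h
    exact h1
  have hiso : IsIso ι := isIso_of_mono_of_nonzero hne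
  let e := FDRep.isoToLinearEquiv (asIso ι)
  rw [eq_top_iff]
  intro x _
  have h2 : (e (e.symm x) : V) = x := e.apply_symm_apply x
  have h3 : ∀ y : W, e y = (y : V) := fun y => rfl
  rw [h3] at h2
  rw [← h2]
  exact Subtype.property _

end Irr

section Assembly

variable {F : Type} [Field F] [Fintype F] {n : ℕ}

lemma exists_level (Θ : (Fin n → Fˣ) →* ℂ) {p : ℕ} (hp : p.Prime) :
    ∃ (z₀ : Fˣ) (k b : ℕ), orderOf z₀ = p ^ k ∧ b ≤ k ∧
      (∀ j, Θ (Pi.mulSingle j z₀) ^ p ^ b = 1) ∧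
      (1 ≤ b → ∃ j, IsPrimitiveRoot (Θ (Pi.mulSingle j z₀)) (p ^ b)) ∧
      ∀ e, ∀ z : Fin n → Fˣ, (∀ i, z i ^ p ^ e = 1) → ∀ k', p ^ b ∣ k' → Θ (z ^ k') = 1 := by
  classical
  obtain ⟨y, hy⟩ := IsCyclic.exists_generator (α := Fˣ)
  have hy0 : orderOf y ≠ 0 := (orderOf_pos y).ne'
  obtain ⟨k, r, hr, hkr⟩ := Nat.exists_eq_pow_mul_and_not_dvd hy0 p hp.ne_one
  have hr0 : r ≠ 0 := by
    rintro rfl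
    exact hr (dvd_zero _)
  have hord : orderOf (y ^ r) = p ^ k := by
    rw [orderOf_pow_of_dvd hr0 (hkr ▸ dvd_mul_left _ _), hkr,
      Nat.mul_div_cancel _ (Nat.pos_of_ne_zero hr0)]
  have hex : ∃ b, ∀ j, Θ (Pi.mulSingle j (y ^ r)) ^ p ^ b = 1 := by
    refine ⟨k, fun j => ?_⟩
    rw [← map_pow, ← Pi.mulSingle_pow, ← hord, pow_orderOf_eq_one, Pi.mulSingle_one, map_one]
  refine ⟨y ^ r, k, Nat.find hex, hord, ?_, Nat.find_spec hex, ?_, ?_⟩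
  · apply Nat.find_min'
    intro j
    rw [← map_pow, ← Pi.mulSingle_pow, ← hord, pow_orderOf_eq_one, Pi.mulSingle_one, map_one]
  · intro hb
    obtain ⟨b', hb'⟩ : ∃ b', Nat.find hex = b' + 1 := ⟨Nat.find hex - 1, by omega⟩
    have h1 := Nat.find_min hex (m := b') (by omega)
    push Not at h1
    obtain ⟨j, hj⟩ := h1
    refine ⟨j, ?_⟩
    have h2 := Nat.find_spec hex j
    rw [hb'] at h2 ⊢
    have := Fact.mk hp
    rw [← orderOf_eq_prime_pow hj h2]
    exact IsPrimitiveRoot.orderOf _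
  · intro e z hz k' hk'
    have hz1 : ∀ i, ∃ c : ℕ, z i = (y ^ r) ^ c := by
      intro i
      obtain ⟨s, hs⟩ := (mem_powers_iff_mem_zpowers.mpr (hy (z i)))
      simp only at hs
      have h1 := hz i
      rw [← hs, ← pow_mul] at h1
      have h2 := orderOf_dvd_of_pow_eq_one h1
      have h3 : r ∣ s * p ^ e := (Dvd.intro_left _ hkr.symm).trans h2
      have h4 : r ∣ s := Nat.Coprime.dvd_of_dvd_mul_right
        ((Nat.Coprime.pow_left e ((Nat.Prime.coprime_iff_not_dvd hp).mpr hr)).symm) h3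
      obtain ⟨c, hc⟩ := h4
      exact ⟨c, by rw [← pow_mul, ← hc, hs]⟩
    choose c hc using hz1
    have h5 : z = ∏ i, Pi.mulSingle i (z i) := (Finset.univ_prod_mulSingle z).symm
    rw [map_pow, h5, map_prod, ← Finset.prod_pow]
    apply Finset.prod_eq_one
    intro i _
    rw [hc i, Pi.mulSingle_pow, map_pow, ← pow_mul, mul_comm, pow_mul]
    rw [pow_one_of_dvd hk' (Nat.find_spec hex i), one_pow]

lemma wt_hom {V : Type*} [AddCommGroup V] [Module ℂ V]
    (ρ : Representation ℂ (Matrix.GeneralLinearGroup (Fin n) F) V)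
    (θ : (Fin n → Fˣ) → ℂ) (v : V) (hv : IsWt ρ θ v) :
    ∃ Θ : (Fin n → Fˣ) →* ℂ, ∀ t, θ t = Θ t := by
  obtain ⟨hv0, -, ht⟩ := hv
  have key : ∀ a b : ℂ, a • v = b • v → a = b := fun a b h => smul_left_injective ℂ hv0 h
  refine ⟨{ toFun := θ, map_one' := ?_, map_mul' := ?_ }, fun t => rfl⟩
  · apply key
    rw [← ht 1, map_one, map_one, one_smul, Module.End.one_apply]
  · intro s t
    apply key
    rw [← ht, map_mul, map_mul, Module.End.mul_apply, ht t, map_smul, ht s, smul_smul, mul_comm]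

lemma not_dvd_small {p : ℕ} (hp : p.Prime) (a d : ℕ) (ha : a ≤ 1) :
    ¬ p ∣ (Qadj (d : ℂ)).relfinrank (Qcyc (p ^ a)) := by
  have h1 : Qadj (d : ℂ) = ⊥ := by
    rw [eq_bot_iff]
    exact Qadj_le (natCast_mem _ d)
  rw [h1, IntermediateField.relfinrank_bot_left, Qcyc_finrank (pow_pos hp.pos a)]
  have h2 := hp.two_le
  interval_cases a
  · simp only [pow_zero, Nat.totient_one, Nat.dvd_one]
    exact hp.ne_one
  · rw [pow_one, Nat.totient_prime hp]
    exact Nat.not_dvd_of_pos_of_lt (by omega) (by omega)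

lemma not_dvd_big {p : ℕ} (hp : p.Prime) (hodd : Odd p) (f b : ℕ) (hf : 0 < f)
    (ha : 2 ≤ f.factorization p) (hab : f.factorization p ≤ b)
    (R : Multiset ℂ) (hR : ∀ ω ∈ R, ω ^ p ^ b = 1) (hcard : R.toFinset.card < p)
    (ω₀ : ℂ) (hω₀ : ω₀ ∈ R) (hprim : IsPrimitiveRoot ω₀ (p ^ b)) (hsum : R.sum ∈ Qcyc f) :
    ¬ p ∣ (Qadj R.sum).relfinrank (Qcyc (p ^ f.factorization p)) := by
  obtain ⟨b', rfl⟩ : ∃ b', b = b' + 1 := ⟨b - 1, by omega⟩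
  have h1 := main_lemma hp hodd (b := b') (by omega) R hR hcard ω₀ hω₀ hprim
  set a := f.factorization p with hadef
  rcases Nat.lt_or_ge a (b' + 1) with hlt | hge
  · exfalso
    apply h1
    have h2 : R.sum ∈ Qcyc (Nat.gcd f (p ^ (b' + 1))) :=
      Qcyc_inf hf (pow_pos hp.pos _) hsum (sum_mem_Qcyc hR)
    have h3 : Nat.gcd f (p ^ (b' + 1)) ∣ p ^ a := by
      obtain ⟨i, hi, h4⟩ := (Nat.dvd_prime_pow hp).mp (Nat.gcd_dvd_right f (p ^ (b' + 1)))
      rw [h4]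
      apply pow_dvd_pow
      rw [hadef, ← hp.pow_dvd_iff_le_factorization hf.ne', ← h4]
      exact Nat.gcd_dvd_left _ _
    have h5 : Qadj R.sum ≤ Qcyc (p ^ a) := Qadj_le (Qcyc_mono h3 h2)
    have h6 : p ∣ (Qcyc (p ^ a)).relfinrank (Qcyc (p ^ (b' + 1))) := by
      have h7 := IntermediateField.finrank_bot_mul_relfinrank
        (Qcyc_mono (pow_dvd_pow p hlt.le) : Qcyc (p ^ a) ≤ Qcyc (p ^ (b' + 1)))
      rw [Qcyc_finrank (pow_pos hp.pos _), Qcyc_finrank (pow_pos hp.pos _),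
        Nat.totient_prime_pow_succ hp] at h7
      obtain ⟨a', ha'⟩ : ∃ a', a = a' + 1 := ⟨a - 1, by omega⟩
      rw [ha', Nat.totient_prime_pow_succ hp] at h7
      rw [ha']
      have h8 : b' = a' + 1 + (b' - a' - 1) := by omega
      have h9 : 0 < p ^ a' * (p - 1) :=
        Nat.mul_pos (pow_pos hp.pos _) (Nat.sub_pos_of_lt hp.one_lt)
      refine ⟨p ^ (b' - a' - 1), Nat.eq_of_mul_eq_mul_left h9 (h7.trans ?_)⟩
      conv_lhs => rw [h8]
      ring
    exact h6.trans (IntermediateField.relfinrank_dvd_of_le_left _ h5)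
  · have : a = b' + 1 := le_antisymm hab hge
    rw [this]
    exact h1

end Assembly

/-- Property 1.3 holds for `GLₙ(F_q)` and any odd prime `p` with `p ∣ q - 1`
and `p > n(n-1)`, for every irreducible character of degree not divisible by `p`. -/
theorem stmt12 (F : Type) [Field F] [Fintype F] [DecidableEq F]
    (n : ℕ) (hn : 1 ≤ n)
    (p : ℕ) (hp : p.Prime) (hodd : Odd p)
    (hpq : p ∣ Fintype.card F - 1) (hpn : n * (n - 1) < p)
    (V : FDRep ℂ (Matrix.GeneralLinearGroup (Fin n) F)) (hV : Simple V)
    (hdeg : ¬ p ∣ Module.finrank ℂ V) :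
    Property13 V.character p := by
  classical
  have : NeZero n := ⟨by omega⟩
  have := Fact.mk hp
  have hp3 : 3 ≤ p := by
    obtain ⟨c, hc⟩ := hodd
    have := hp.two_le
    omega
  have hnp : n < p := by
    rcases Nat.lt_or_ge n 2 with h | h
    · omega
    · have : n * 1 ≤ n * (n - 1) := Nat.mul_le_mul_left n (by omega)
      omega
  have hirr := irr_of_simple V hV
  have hchar : ∀ g, V.character g = LinearMap.trace ℂ V (V.ρ g) := fun g => rfl
  have hcardF : Fintype.card Fˣ = Fintype.card F - 1 := Fintype.card_units F
  -- a weight vector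
  obtain ⟨z, hz⟩ := exists_prime_orderOf_dvd_card p (hcardF ▸ hpq : p ∣ Fintype.card Fˣ)
  have hinj : Function.Injective (fun i : Fin n => z ^ (i : ℕ)) := by
    intro i j hij
    have := pow_injOn_Iio_orderOf (x := z) (by simp only [Set.mem_Iio]; omega)
      (by simp only [Set.mem_Iio]; omega) hij
    exact Fin.ext this
  have hne0 : LinearMap.trace ℂ V (V.ρ (dg (fun i : Fin n => z ^ (i : ℕ)))) ≠ 0 := by
    intro h0
    have hA : V.ρ (dg (fun i : Fin n => z ^ (i : ℕ))) ^ p = 1 := by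
      rw [← map_pow, ← map_pow]
      have : (fun i : Fin n => z ^ (i : ℕ)) ^ p = 1 := by
        funext i
        rw [Pi.pow_apply, Pi.one_apply, ← pow_mul, mul_comm, pow_mul, ← hz, pow_orderOf_eq_one,
          one_pow]
      rw [this, map_one, map_one]
    obtain ⟨R, hR1, hR2, hR3⟩ := trace_pow_roots _ hp.pos hA
    have h1 := hR3 1
    rw [pow_one, h0] at h1
    simp only [pow_one, Multiset.map_id'] at h1
    exact hdeg (hR1 ▸ dvd_card_of_sum_zero hp R hR2 h1.symm)
  obtain ⟨θ, v, hv⟩ := exists_wt V.ρ _ hinj hne0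
  obtain ⟨Θ, hΘ⟩ := wt_hom V.ρ θ v hv
  obtain ⟨z₀, k, b, hz₀, hbk, hb1, hb2, hb3⟩ := exists_level Θ hp
  have hordg : orderOf (dg (Pi.mulSingle (0 : Fin n) z₀)) = p ^ k := by
    rw [orderOf_injective dg dg_inj, ← hz₀]
    exact orderOf_injective (MonoidHom.mulSingle (fun _ : Fin n => Fˣ) 0)
      (fun a b h => by simpa using congrFun h 0) z₀
  -- the order of the group
  set N := Nat.card (Matrix.GeneralLinearGroup (Fin n) F) with hN
  have hN0 : N ≠ 0 := Nat.card_pos.ne'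
  obtain ⟨e, m, hm, hem⟩ := Nat.exists_eq_pow_mul_and_not_dvd hN0 p hp.ne_one
  have hpm : p.Coprime m := (Nat.Prime.coprime_iff_not_dvd hp).mpr hm
  have hm0 : 0 < m := by
    rcases Nat.eq_zero_or_pos m with h | h
    · exact absurd (h ▸ dvd_zero p) hm
    · exact h
  have hke : k ≤ e := by
    have h1 : p ^ k ∣ p ^ e * m := by
      rw [← hem, ← hordg]
      exact orderOf_dvd_natCard _
    have h2 := Nat.Coprime.dvd_of_dvd_mul_right (Nat.Coprime.pow_left k hpm) h1
    exact (Nat.pow_dvd_pow_iff_le_right hp.one_lt).mp h2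
  have hMN : p ^ b * m ∣ N := by
    rw [hem]
    exact mul_dvd_mul_right (pow_dvd_pow p (hbk.trans hke)) m
  have hval : ∀ g, V.character g ∈ Qcyc (p ^ b * m) := by
    intro g
    have hA : V.ρ g ^ N = 1 := by
      rw [← map_pow, hN, pow_card_eq_one', map_one]
    obtain ⟨R, hR1, hR2, hR3⟩ := trace_pow_roots _ (Nat.pos_of_ne_zero hN0) hA
    have hR4 : V.character g = R.sum := by
      have h1 := hR3 1
      simp only [pow_one, Multiset.map_id'] at h1
      exact h1
    rw [hR4]
    apply sum_mem_of_pow_eq (Nat.pos_of_ne_zero hN0) hMN hR2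
    intro t ht htM
    rcases Nat.eq_zero_or_pos t with h0 | hpos
    · have hN1 : N = 1 := by
        rw [h0, Nat.coprime_zero_left] at ht
        exact ht
      rw [h0]
      congr 1
      conv_rhs => rw [← Multiset.map_id R]
      apply Multiset.map_congr rfl
      intro ω hω
      have := hR2 ω hω
      rw [hN1, pow_one] at this
      rw [this, one_pow, id]
    · obtain ⟨k', rfl⟩ : ∃ k', t = k' + 1 := ⟨t - 1, by omega⟩
      rw [← hR3, ← map_pow, ← hR4, hchar]
      apply char_pow_eq V.ρ hirr θ v hv hp hpq hnp e m b hem hpm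
      · intro z' hz' k'' hk''
        rw [hΘ]
        exact hb3 e z' hz' k'' hk''
      · have h1 := (Nat.modEq_iff_dvd' (by omega)).mp htM.symm
        simpa using h1
      · exact ht
  intro f hf
  have hf0 : 0 < f := hf.1.1
  have hfM : f ∣ p ^ b * m := by
    have hM0 : 0 < p ^ b * m := Nat.mul_pos (pow_pos hp.pos _) hm0
    have h1 : Nat.gcd f (p ^ b * m) ∈ {N : ℕ | 0 < N ∧ ∀ g, V.character g ∈ Qcyc N} :=
      ⟨Nat.gcd_pos_of_pos_left _ hf0, fun g => Qcyc_inf hf0 hM0 (hf.1.2 g) (hval g)⟩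
    have h2 := hf.2 h1
    have h3 : Nat.gcd f (p ^ b * m) = f :=
      le_antisymm (Nat.gcd_le_left _ hf0) h2
    rw [← h3]
    exact Nat.gcd_dvd_right _ _
  rcases Nat.lt_or_ge (f.factorization p) 2 with hlt | hge
  · refine ⟨1, ⟨0, by simp⟩, ?_⟩
    rw [FDRep.char_one]
    exact not_dvd_small hp _ _ (by omega)
  · have hab : f.factorization p ≤ b := by
      have h1 : p ^ f.factorization p ∣ p ^ b * m := (Nat.ordProj_dvd f p).trans hfM
      have h2 := Nat.Coprime.dvd_of_dvd_mul_right (Nat.Coprime.pow_left _ hpm) h1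
      exact (Nat.pow_dvd_pow_iff_le_right hp.one_lt).mp h2
    refine ⟨dg (Pi.mulSingle 0 z₀), ⟨k, hordg⟩, ?_⟩
    have hz1 : z₀ ≠ 1 := by
      rintro rfl
      rw [orderOf_one] at hz₀
      have := Nat.one_lt_pow (n := k) (by omega) hp.one_lt
      omega
    obtain ⟨R, hR1, hR2, hR3⟩ := eigs V.ρ hirr θ v hv z₀ hz1
    obtain ⟨j, hj⟩ := hb2 (by omega)
    have hsum : (R.filter (fun ω => ω ≠ 0)).sum = R.sum := by
      have h1 := congrArg Multiset.sum (Multiset.filter_add_not (fun ω : ℂ => ω ≠ 0) R)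
      rw [Multiset.sum_add] at h1
      have h2 : (R.filter (fun ω => ¬ ω ≠ 0)).sum = 0 := by
        apply Multiset.sum_eq_zero
        intro x hx
        simpa using (Multiset.mem_filter.mp hx).2
      rw [h2, add_zero] at h1
      exact h1
    have hmem : ∀ ω ∈ R.filter (fun ω => ω ≠ 0), ∃ j, ω = Θ (Pi.mulSingle j z₀) := by
      intro ω hω
      obtain ⟨h1, h2⟩ := Multiset.mem_filter.mp hω
      rcases hR2 ω h1 with h | ⟨j, h⟩
      · exact absurd h h2
      · exact ⟨j, by rw [h, hΘ]⟩
    have hc : V.character (dg (Pi.mulSingle 0 z₀)) = (R.filter (fun ω => ω ≠ 0)).sum := by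
      rw [hsum, hchar, hR1]
    rw [hc]
    refine not_dvd_big hp hodd f b hf0 hge hab _ ?_ ?_ (Θ (Pi.mulSingle j z₀)) ?_ hj ?_
    · intro ω hω
      obtain ⟨i, rfl⟩ := hmem ω hω
      exact hb1 i
    · have hsub : (R.filter (fun ω => ω ≠ 0)).toFinset ⊆
          Finset.univ.image (fun i : Fin n => Θ (Pi.mulSingle i z₀)) := by
        intro ω hω
        obtain ⟨i, rfl⟩ := hmem ω (Multiset.mem_toFinset.mp hω)
        exact Finset.mem_image_of_mem _ (Finset.mem_univ _)
      have h1 := (Finset.card_le_card hsub).trans Finset.card_image_le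
      rw [Finset.card_univ, Fintype.card_fin] at h1
      omega
    · rw [Multiset.mem_filter]
      exact ⟨hΘ _ ▸ hR3 j, hj.ne_zero (pow_pos hp.pos _).ne'⟩
    · rw [← hc]
      exact hf.1.2 _
end

section
/- Let n ≥ 1 be an integer, q a prime power, and p an odd prime such that p divides q−1 and p > n. Then for every irreducible complex character χ of GL_n(F_q) (the group of invertible n×n matrices over the field with q elements) with p ∤ χ(1), Property 1.3 holds for (GL_n(F_q), χ, p). -/
open CategoryTheory

namespace NT

/-- The canonical `ℚ`-algebra structure, preferred over the one from `DivisionRing`. -/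
noncomputable local instance ratAlg {E : Type*} [Field E] [Algebra ℚ E]
    (K : IntermediateField ℚ E) : Algebra ℚ K := K.algebra'

theorem inf_finrank_le {E : Type*} [Field E] [Algebra ℚ E] [FiniteDimensional ℚ E] [IsGalois ℚ E]
    (A B : IntermediateField ℚ E) (h : A ⊔ B = ⊤) :
    Module.finrank ℚ (A ⊓ B : IntermediateField ℚ E) * Module.finrank ℚ E
      ≤ Module.finrank ℚ A * Module.finrank ℚ B := by
  have h1 : A.fixingSubgroup ⊓ B.fixingSubgroup = ⊥ := by
    rw [← IntermediateField.fixingSubgroup_sup, h, IntermediateField.fixingSubgroup_top]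
  have hA : A.fixingSubgroup ≤ (A ⊓ B).fixingSubgroup :=
    IntermediateField.fixingSubgroup_le inf_le_left
  have hB : B.fixingSubgroup ≤ (A ⊓ B).fixingSubgroup :=
    IntermediateField.fixingSubgroup_le inf_le_right
  have hcard : Nat.card A.fixingSubgroup * Nat.card B.fixingSubgroup
      ≤ Nat.card (A ⊓ B).fixingSubgroup := by
    rw [← Nat.card_prod]
    refine Nat.card_le_card_of_injective
      (fun x : A.fixingSubgroup × B.fixingSubgroup =>
        (⟨x.1.1 * x.2.1, mul_mem (hA x.1.2) (hB x.2.2)⟩ : (A ⊓ B).fixingSubgroup)) ?_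
    intro x y hxy
    have hxy' : x.1.1 * x.2.1 = y.1.1 * y.2.1 := congrArg Subtype.val hxy
    have := Subgroup.mul_injective_of_disjoint (disjoint_iff.mpr h1)
    exact this hxy'
  rw [IsGalois.card_fixingSubgroup_eq_finrank, IsGalois.card_fixingSubgroup_eq_finrank,
    IsGalois.card_fixingSubgroup_eq_finrank] at hcard
  have e1 := Module.finrank_mul_finrank ℚ A E
  have e2 := Module.finrank_mul_finrank ℚ B E
  have e3 := Module.finrank_mul_finrank ℚ (A ⊓ B : IntermediateField ℚ E) E
  set a := Module.finrank ℚ A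
  set b := Module.finrank ℚ B
  set c := Module.finrank ℚ (A ⊓ B : IntermediateField ℚ E)
  set a' := Module.finrank A E
  set b' := Module.finrank B E
  set c' := Module.finrank (A ⊓ B : IntermediateField ℚ E) E
  set N := Module.finrank ℚ E with hN
  have hNpos : 0 < N := Module.finrank_pos
  -- c * N * N = c * a*a' * b*b' ≤ c * c' * a * b = N * a * b
  have : (c * N) * N ≤ (a * b) * N := by
    calc (c * N) * N = (c * (a * a')) * (b * b') := by rw [e1, e2]
      _ = c * a * b * (a' * b') := by ring
      _ ≤ c * a * b * c' := Nat.mul_le_mul_left _ hcard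
      _ = (a * b) * (c * c') := by ring
      _ = (a * b) * N := by rw [e3]
  exact Nat.le_of_mul_le_mul_right this hNpos

theorem Qcyc_eq {N : ℕ} {ζ : ℂ} (h : IsPrimitiveRoot ζ N) (hN : 0 < N) :
    Qcyc N = IntermediateField.adjoin ℚ {ζ} := by
  have : NeZero N := ⟨hN.ne'⟩
  apply le_antisymm
  · refine IntermediateField.adjoin_le_iff.mpr ?_
    intro z hz
    obtain ⟨i, -, rfl⟩ := h.eq_pow_of_pow_eq_one hz
    exact pow_mem (IntermediateField.mem_adjoin_simple_self ℚ ζ) i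
  · refine IntermediateField.adjoin_le_iff.mpr ?_
    rintro z rfl
    exact IntermediateField.subset_adjoin _ _ h.pow_eq_one

theorem mem_Qcyc {N : ℕ} {z : ℂ} (h : z ^ N = 1) : z ∈ Qcyc N :=
  IntermediateField.subset_adjoin _ _ h

instance Qcyc_cyc (N : ℕ) [NeZero N] : IsCyclotomicExtension {N} ℚ (Qcyc N) := by
  have h := Complex.isPrimitiveRoot_exp N (NeZero.ne N)
  exact (IntermediateField.isCyclotomicExtension_singleton_iff_eq_adjoin N ℚ ℂ _ h).mpr
    (Qcyc_eq h (NeZero.pos N))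

instance Qcyc_fin (N : ℕ) [NeZero N] : FiniteDimensional ℚ (Qcyc N) :=
  IsCyclotomicExtension.finite_of_singleton N ℚ _

instance Qcyc_gal (N : ℕ) [NeZero N] : IsGalois ℚ (Qcyc N) :=
  IsCyclotomicExtension.isGalois {N} ℚ _

theorem Qcyc_finrank (N : ℕ) [NeZero N] : Module.finrank ℚ (Qcyc N) = N.totient :=
  IsCyclotomicExtension.finrank _ (Polynomial.cyclotomic.irreducible_rat (NeZero.pos N))

theorem Qcyc_mono {A B : ℕ} (h : A ∣ B) : Qcyc A ≤ Qcyc B := by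
  refine IntermediateField.adjoin_le_iff.mpr ?_
  intro z hz
  obtain ⟨k, rfl⟩ := h
  apply mem_Qcyc
  rw [pow_mul, show z ^ A = 1 from hz, one_pow]

theorem Qcyc_inf (A B : ℕ) [NeZero A] [NeZero B] : Qcyc A ⊓ Qcyc B = Qcyc (A.gcd B) := by
  have : NeZero (A.lcm B) := ⟨Nat.lcm_ne_zero (NeZero.ne _) (NeZero.ne _)⟩
  have : NeZero (A.gcd B) := ⟨Nat.gcd_ne_zero_left (NeZero.ne _)⟩
  have hsup : Qcyc A ⊔ Qcyc B = Qcyc (A.lcm B) := by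
    have := IntermediateField.isCyclotomicExtension_lcm_sup ℚ ℂ A B (Qcyc A) (Qcyc B)
    exact IntermediateField.isCyclotomicExtension_eq {A.lcm B} ℚ ℂ _ _
  symm
  have hle : Qcyc (A.gcd B) ≤ Qcyc A ⊓ Qcyc B :=
    le_inf (Qcyc_mono (Nat.gcd_dvd_left _ _)) (Qcyc_mono (Nat.gcd_dvd_right _ _))
  have : FiniteDimensional ℚ (Qcyc A ⊓ Qcyc B : IntermediateField ℚ ℂ) :=
    FiniteDimensional.of_injective (IntermediateField.inclusion
      (inf_le_left : Qcyc A ⊓ Qcyc B ≤ Qcyc A)).toLinearMap (IntermediateField.inclusion_injective inf_le_left)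
  refine IntermediateField.eq_of_le_of_finrank_le hle ?_
  have hAN : Qcyc A ≤ Qcyc (A.lcm B) := Qcyc_mono (Nat.dvd_lcm_left _ _)
  have hBN : Qcyc B ≤ Qcyc (A.lcm B) := Qcyc_mono (Nat.dvd_lcm_right _ _)
  have key := inf_finrank_le (IntermediateField.restrict hAN) (IntermediateField.restrict hBN) (by
    apply IntermediateField.lift_injective
    rw [IntermediateField.lift_sup, IntermediateField.lift_restrict, IntermediateField.lift_restrict,
      IntermediateField.lift_top, hsup])
  have f1 : ∀ {X Y : IntermediateField ℚ ℂ} (h : X ≤ Y),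
      Module.finrank ℚ (IntermediateField.restrict h) = Module.finrank ℚ X := fun h =>
    (IntermediateField.restrictAlgEquiv h).toLinearEquiv.finrank_eq.symm
  have f2 : IntermediateField.restrict hAN ⊓ IntermediateField.restrict hBN
      = IntermediateField.restrict (inf_le_left.trans hAN : Qcyc A ⊓ Qcyc B ≤ _) := by
    apply IntermediateField.lift_injective
    rw [IntermediateField.lift_inf, IntermediateField.lift_restrict, IntermediateField.lift_restrict, IntermediateField.lift_restrict]
  rw [f2, f1, f1, f1, Qcyc_finrank, Qcyc_finrank, Qcyc_finrank] at key
  rw [Qcyc_finrank]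
  have h3 := Nat.totient_gcd_mul_totient_mul A B
  have h4 : (A.gcd B).totient * (A.lcm B).totient = A.totient * B.totient := by
    have h5 := Nat.totient_gcd_mul_totient_mul (A.gcd B) (A.lcm B)
    rw [Nat.gcd_mul_lcm, Nat.gcd_eq_left ((Nat.gcd_dvd_left A B).trans (Nat.dvd_lcm_left A B))] at h5
    rw [h3] at h5
    exact (Nat.eq_of_mul_eq_mul_right (NeZero.pos (A.gcd B)) h5).symm
  rw [← h4] at key
  exact Nat.le_of_mul_le_mul_right key (Nat.totient_pos.mpr (NeZero.pos _))



theorem exists_poly {ζ : ℂ} {N : ℕ} [NeZero N] (h : IsPrimitiveRoot ζ N) (S : Multiset ℂ)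
    (hS : ∀ z ∈ S, z ^ N = 1) :
    ∃ f : Polynomial ℤ, Polynomial.aeval ζ f = S.sum ∧ f.eval 1 = (Multiset.card S : ℤ) := by
  induction S using Multiset.induction_on with
  | empty => exact ⟨0, by simp, by simp⟩
  | cons a s ih =>
    obtain ⟨f, h1, h2⟩ := ih fun z hz => hS z (Multiset.mem_cons_of_mem hz)
    obtain ⟨i, -, hi⟩ := h.eq_pow_of_pow_eq_one (hS a (Multiset.mem_cons_self a s))
    refine ⟨Polynomial.X ^ i + f, ?_, ?_⟩
    · simp [h1, hi]
    · simp [h2, add_comm]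

theorem dvd_card_sub {p : ℕ} [Fact p.Prime] (k : ℕ) (S T : Multiset ℂ)
    (hS : ∀ z ∈ S, z ^ (p ^ (k + 1)) = 1) (hT : ∀ z ∈ T, z ^ (p ^ (k + 1)) = 1)
    (h : S.sum = T.sum) : (p : ℤ) ∣ (Multiset.card S : ℤ) - Multiset.card T := by
  have hp : p.Prime := Fact.out
  have : NeZero (p ^ (k + 1)) := ⟨pow_ne_zero _ hp.ne_zero⟩
  have hζ := Complex.isPrimitiveRoot_exp (p ^ (k + 1)) (NeZero.ne _)
  obtain ⟨f, f1, f2⟩ := exists_poly hζ S hS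
  obtain ⟨g, g1, g2⟩ := exists_poly hζ T hT
  have h0 : Polynomial.aeval (Complex.exp (2 * Real.pi * Complex.I / (p ^ (k + 1) : ℕ))) (f - g) = 0 := by
    rw [map_sub, f1, g1, h, sub_self]
  have h1 := minpoly.isIntegrallyClosed_dvd (hζ.isIntegral (NeZero.pos _)) h0
  rw [← Polynomial.cyclotomic_eq_minpoly hζ (NeZero.pos _)] at h1
  have h2 := Polynomial.eval_dvd (x := (1 : ℤ)) h1
  rw [Polynomial.eval_one_cyclotomic_prime_pow, Polynomial.eval_sub, f2, g2] at h2
  exact h2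

theorem linInd {p b : ℕ} [Fact p.Prime] (hb : 1 ≤ b) {ζ : ℂ} (hζ : IsPrimitiveRoot ζ (p ^ (b + 1))) :
    p ≤ (minpoly (Qcyc (p ^ b)) ζ).natDegree := by
  have hp : p.Prime := Fact.out
  have : NeZero (p ^ (b + 1)) := ⟨pow_ne_zero _ hp.ne_zero⟩
  have : NeZero (p ^ b) := ⟨pow_ne_zero _ hp.ne_zero⟩
  have hIntg : IsIntegral (Qcyc (p ^ b)) ζ := (hζ.isIntegral (NeZero.pos _)).tower_top
  rw [← IntermediateField.adjoin.finrank hIntg]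
  let M := IntermediateField.adjoin (Qcyc (p ^ b)) {ζ}
  change p ≤ Module.finrank (Qcyc (p ^ b)) M
  have hfin : FiniteDimensional (Qcyc (p ^ b)) M := IntermediateField.adjoin.finiteDimensional hIntg
  have hle : Qcyc (p ^ (b + 1)) ≤ M.restrictScalars ℚ := by
    rw [Qcyc_eq hζ (NeZero.pos _)]
    refine IntermediateField.adjoin_le_iff.mpr ?_
    rintro z rfl
    exact IntermediateField.mem_adjoin_simple_self (Qcyc (p ^ b)) _
  have e : Module.finrank ℚ (Qcyc (p ^ b)) * Module.finrank (Qcyc (p ^ b)) M = Module.finrank ℚ M :=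
    Module.finrank_mul_finrank ℚ (Qcyc (p ^ b)) M
  have hfin2 : FiniteDimensional ℚ M := Module.Finite.trans (Qcyc (p ^ b)) M
  have hle2 : Module.finrank ℚ (Qcyc (p ^ (b + 1))) ≤ Module.finrank ℚ M :=
    LinearMap.finrank_le_finrank_of_injective (f :=
      (IntermediateField.inclusion hle).toLinearMap) (IntermediateField.inclusion_injective hle)
  rw [← e, Qcyc_finrank, Qcyc_finrank, pow_succ', Nat.totient_mul_of_prime_of_dvd hp
    (dvd_pow_self p (by omega)), mul_comm] at hle2
  exact Nat.le_of_mul_le_mul_left hle2 (Nat.totient_pos.mpr (NeZero.pos _))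

theorem extract {p b : ℕ} [Fact p.Prime] (hb : 1 ≤ b) {ζ : ℂ}
    (hζ : IsPrimitiveRoot ζ (p ^ (b + 1))) {ι : Type*} (S : Finset ι) (z : ι → ℂ)
    (hz : ∀ w ∈ S, z w ^ (p ^ (b + 1)) = 1) (hsum : ∑ w ∈ S, z w ∈ Qcyc (p ^ b)) :
    p ∣ (S.filter fun w => z w ^ (p ^ b) = ζ ^ (p ^ b)).card := by
  classical
  have hp : p.Prime := Fact.out
  have : NeZero (p ^ (b + 1)) := ⟨pow_ne_zero _ hp.ne_zero⟩
  have hex : ∀ w, ∃ a : ℕ, w ∈ S → ζ ^ a = z w := by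
    intro w
    by_cases hw : w ∈ S
    · obtain ⟨i, -, hi⟩ := hζ.eq_pow_of_pow_eq_one (hz w hw)
      exact ⟨i, fun _ => hi⟩
    · exact ⟨0, fun h => absurd h hw⟩
  choose a ha using hex
  have hζp : ζ ^ p ∈ Qcyc (p ^ b) := mem_Qcyc (by rw [← pow_mul, ← pow_succ', hζ.pow_eq_one])
  let K := Qcyc (p ^ b)
  let t : K := ⟨ζ ^ p, hζp⟩
  let β : Fin p → K := fun x => ∑ w ∈ S.filter (fun w => a w % p = x), t ^ (a w / p)
  have hli : LinearIndependent K (fun x : Fin p => ζ ^ (x : ℕ)) := by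
    have h1 := linearIndependent_pow (K := K) ζ
    exact h1.comp (Fin.castLE (linInd hb hζ)) (Fin.castLE_injective _)
  have hX : ∑ w ∈ S, z w = ∑ x : Fin p, (β x) • (ζ ^ (x : ℕ)) := by
    have h1 : ∀ x : Fin p, (β x) • (ζ ^ (x : ℕ)) = ∑ w ∈ S.filter (fun w => a w % p = x), z w := by
      intro x
      rw [Algebra.smul_def, map_sum, Finset.sum_mul]
      refine Finset.sum_congr rfl fun w hw => ?_
      rw [Finset.mem_filter] at hw
      rw [← ha w hw.1, map_pow]
      change (ζ ^ p) ^ (a w / p) * _ = _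
      rw [← pow_mul, ← pow_add, ← hw.2, Nat.div_add_mod]
    simp_rw [h1]
    rw [← Finset.sum_fiberwise_of_maps_to (s := S) (t := Finset.univ)
      (g := fun w => (⟨a w % p, Nat.mod_lt _ hp.pos⟩ : Fin p)) (fun _ _ => Finset.mem_univ _)]
    refine Finset.sum_congr rfl fun x _ => ?_
    refine Finset.sum_congr ?_ fun _ _ => rfl
    ext w
    simp [Fin.ext_iff]
  let X : K := ⟨_, hsum⟩
  have hX2 : ∑ x : Fin p, (β x - if (x : ℕ) = 0 then X else 0) • (ζ ^ (x : ℕ)) = 0 := by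
    simp_rw [sub_smul, Finset.sum_sub_distrib]
    rw [← hX, Finset.sum_eq_single (⟨0, hp.pos⟩ : Fin p)]
    · simp only [if_true, pow_zero, Algebra.smul_def, mul_one]
      exact sub_self _
    · intro x _ hx
      rw [if_neg, zero_smul]
      intro h; exact hx (Fin.ext h)
    · simp
  have hβ := (Fintype.linearIndependent_iff.mp hli) _ hX2 ⟨1, hp.one_lt⟩
  simp only [one_ne_zero, if_false, sub_zero] at hβ
  -- now the sum of `p`-power roots of unity is zero
  have h0 : ∑ w ∈ S.filter (fun w => a w % p = 1), (ζ ^ p) ^ (a w / p) = 0 := by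
    have := congrArg (algebraMap K ℂ) hβ
    rw [map_sum, map_zero] at this
    exact this
  have h2 := dvd_card_sub (p := p) b ((S.filter (fun w => a w % p = 1)).val.map
    fun w => (ζ ^ p) ^ (a w / p)) 0 (by
      intro y hy
      obtain ⟨w, -, rfl⟩ := Multiset.mem_map.mp hy
      rw [← pow_mul, ← pow_mul, show p * (a w / p * p ^ (b + 1)) = p ^ (b + 1) * (p * (a w / p)) by ring,
        pow_mul, hζ.pow_eq_one, one_pow]) (by simp) (by
      rw [Multiset.sum_zero]; exact h0)
  simp only [Multiset.card_map, Multiset.card_zero, Nat.cast_zero, sub_zero, Finset.card_val] at h2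
  have h3 : (S.filter fun w => z w ^ (p ^ b) = ζ ^ (p ^ b)) = S.filter (fun w => a w % p = 1) := by
    apply Finset.filter_congr
    intro w hw
    rw [← ha w hw, ← pow_mul]
    have h5 : p ^ (b + 1) = orderOf ζ := hζ.eq_orderOf
    rw [(hζ.isOfFinOrder (NeZero.ne _)).pow_eq_pow_iff_modEq, ← h5, pow_succ']
    have h6 : (a w * p ^ b ≡ p ^ b [MOD p * p ^ b]) ↔ (a w * p ^ b ≡ 1 * p ^ b [MOD p * p ^ b]) := by
      rw [one_mul]
    rw [h6, Nat.ModEq.mul_right_cancel_iff' (pow_ne_zero b hp.ne_zero), Nat.ModEq,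
      Nat.mod_eq_of_lt hp.one_lt]
  rw [h3]
  exact_mod_cast h2

theorem unique_sub {G : Type*} [Group G] [Finite G] [IsCyclic G] {p : ℕ} (hp : 0 < p)
    (H K : Subgroup G) (hH : Nat.card H = p) (hK : Nat.card K = p) : H = K := by
  classical
  have := Fintype.ofFinite G
  have h1 := IsCyclic.card_pow_eq_one_le (α := G) hp
  have h2 : ∀ L : Subgroup G, Nat.card L = p → (L : Set G) = {g : G | g ^ p = 1} := by
    intro L hL
    apply Set.eq_of_subset_of_ncard_le
    · intro x hx
      have := pow_card_eq_one' (x := (⟨x, hx⟩ : L))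
      rw [hL] at this
      exact congrArg Subtype.val this
    · rw [show (L : Set G).ncard = p from hL, Set.ncard_eq_toFinset_card']
      convert h1
      ext; simp
    · exact Set.toFinite _
  exact SetLike.coe_injective ((h2 H hH).trans (h2 K hK).symm)

theorem not_dvd_relfinrank {p k : ℕ} [Fact p.Prime] (hp2 : p ≠ 2) (hk : 1 ≤ k) {c : ℂ}
    (hc : c ∈ Qcyc (p ^ (k + 1))) (hc' : c ∉ Qcyc (p ^ k)) :
    ¬ p ∣ (Qadj c).relfinrank (Qcyc (p ^ (k + 1))) := by
  intro hdvd
  have hp : p.Prime := Fact.out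
  have : NeZero (p ^ (k + 1)) := ⟨pow_ne_zero _ hp.ne_zero⟩
  have : NeZero (p ^ k) := ⟨pow_ne_zero _ hp.ne_zero⟩
  have hle : Qadj c ≤ Qcyc (p ^ (k + 1)) := IntermediateField.adjoin_le_iff.mpr (by
    rintro z rfl; exact hc)
  have hle2 : Qcyc (p ^ k) ≤ Qcyc (p ^ (k + 1)) := Qcyc_mono (pow_dvd_pow _ (by omega))
  set E := Qcyc (p ^ (k + 1))
  let A := IntermediateField.restrict hle
  let B := IntermediateField.restrict hle2
  have fr : ∀ {X Y : IntermediateField ℚ ℂ} (h : X ≤ Y),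
      Module.finrank ℚ (IntermediateField.restrict h) = Module.finrank ℚ X := fun h =>
    (IntermediateField.restrictAlgEquiv h).toLinearEquiv.finrank_eq.symm
  have cyc : IsCyclic Gal(E/ℚ) := by
    have e := IsCyclotomicExtension.autEquivPow (n := p ^ (k + 1)) (K := ℚ) E
      (Polynomial.cyclotomic.irreducible_rat (NeZero.pos _))
    have := ZMod.isCyclic_units_of_prime_pow p hp hp2 (k + 1)
    exact e.isCyclic.mpr this
  have hE := Qcyc_finrank (p ^ (k + 1))
  have hEpos : 0 < Module.finrank ℚ E := Module.finrank_pos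
  have eA := Module.finrank_mul_finrank ℚ A E
  have eB := Module.finrank_mul_finrank ℚ B E
  have hB : Module.finrank B E = p := by
    rw [fr, Qcyc_finrank, show Module.finrank ℚ E = _ from hE, pow_succ',
      Nat.totient_mul_of_prime_of_dvd hp (dvd_pow_self p (by omega)), mul_comm] at eB
    exact Nat.eq_of_mul_eq_mul_right (Nat.totient_pos.mpr (NeZero.pos _)) eB
  have hA : Module.finrank A E = (Qadj c).relfinrank E := by
    have h1 := IntermediateField.finrank_bot_mul_relfinrank hle
    rw [fr] at eA
    have h2 : Module.finrank ℚ (Qadj c) ≠ 0 := by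
      intro h; rw [h, zero_mul] at eA; omega
    exact Nat.eq_of_mul_eq_mul_left (Nat.pos_of_ne_zero h2) (eA.trans h1.symm)
  rw [← hA] at hdvd
  -- unique subgroup of order p
  have hcA : p ∣ Nat.card A.fixingSubgroup := by
    rwa [IsGalois.card_fixingSubgroup_eq_finrank]
  have hcB : Nat.card B.fixingSubgroup = p := by
    rw [IsGalois.card_fixingSubgroup_eq_finrank, hB]
  have hsub : B.fixingSubgroup ≤ A.fixingSubgroup := by
    obtain ⟨x, hx⟩ := exists_prime_orderOf_dvd_card' p hcA
    have hz : Subgroup.zpowers (x : Gal(E/ℚ)) = B.fixingSubgroup := by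
      apply unique_sub hp.pos _ _ _ hcB
      rw [Nat.card_zpowers, Subgroup.orderOf_coe, hx]
    rw [← hz, Subgroup.zpowers_le]
    exact x.2
  have hAB : A ≤ B := by
    rw [← IsGalois.fixedField_fixingSubgroup A, ← IsGalois.fixedField_fixingSubgroup B]
    exact IntermediateField.fixedField_le hsub
  apply hc'
  have h1 : (⟨c, hc⟩ : E) ∈ A := (IntermediateField.mem_restrict hle _).mpr
    (IntermediateField.mem_adjoin_simple_self ℚ c)
  exact (IntermediateField.mem_restrict hle2 _).mp (hAB h1)

theorem not_dvd_small {p a : ℕ} (hp : p.Prime) (ha : a ≤ 1) (d : ℕ) :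
    ¬ p ∣ (Qadj (d : ℂ)).relfinrank (Qcyc (p ^ a)) := by
  have : NeZero (p ^ a) := ⟨pow_ne_zero _ hp.ne_zero⟩
  have h : Qadj (d : ℂ) = ⊥ := by
    rw [Qadj, IntermediateField.adjoin_simple_eq_bot_iff]
    exact natCast_mem _ d
  rw [h, IntermediateField.relfinrank_bot_left, Qcyc_finrank]
  intro hd
  interval_cases a
  · simp at hd; exact hp.ne_one hd
  · rw [pow_one, Nat.totient_prime hp] at hd
    have := Nat.le_of_dvd (Nat.sub_pos_of_lt hp.one_lt) hd
    have := hp.pos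
    omega

end NT


namespace NT
open Module

theorem invariant_eq_top {G : Type} [Group G] (V : FDRep ℂ G) (hV : Simple V)
    (W : Submodule ℂ V) (hW : ∀ g : G, ∀ v ∈ W, V.ρ g v ∈ W) (v : V) (hv : v ∈ W) (hv0 : v ≠ 0) :
    W = ⊤ := by
  let R : Representation ℂ G W :=
    { toFun := fun g => (V.ρ g).restrict (hW g)
      map_one' := by ext x; simp
      map_mul' := by intro g h; ext x; simp }
  let f : FDRep.of R ⟶ V :=
    { hom := FGModuleCat.ofHom W.subtype
      comm := by
        intro g
        ext x
        rfl }
  have hinj : Function.Injective f.hom.hom.hom := Subtype.val_injective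
  have hm : Mono f := by
    refine ⟨fun {Z} a b hab => ?_⟩
    ext z
    have := congrArg (fun k => k.hom.hom.hom z) hab
    exact this
  have hne : f ≠ 0 := by
    intro h
    have := congrArg (fun k => k.hom.hom.hom (⟨v, hv⟩ : W)) h
    exact hv0 this
  have hiso : IsIso f := isIso_of_mono_of_nonzero hne
  rw [eq_top_iff]
  intro y _
  have h2 : (inv f ≫ f) = 𝟙 V := IsIso.inv_hom_id f
  have h3 := congrArg (fun k => k.hom.hom.hom y) h2
  have h4 : f.hom.hom.hom ((inv f).hom.hom.hom y) = y := h3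
  rw [← h4]
  exact Subtype.mem _

section lin
variable {V : Type*} [AddCommGroup V] [Module ℂ V] [FiniteDimensional ℂ V]
set_option linter.unusedSectionVars false

theorem trace_roots (X : End ℂ V) : ∃ S : Multiset ℂ, S.sum = LinearMap.trace ℂ V X ∧
    Multiset.card S = finrank ℂ V ∧ ∀ μ ∈ S, ∃ v : V, v ≠ 0 ∧ X v = μ • v := by
  refine ⟨X.charpoly.roots, (Module.End.trace_eq_sum_roots_charpoly_of_splits
    (IsAlgClosed.splits _)).symm, ?_, ?_⟩
  · rw [IsAlgClosed.card_roots_eq_natDegree, LinearMap.charpoly_natDegree]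
  · intro μ hμ
    have h1 := (Polynomial.mem_roots'.mp hμ).2
    rw [← Module.End.hasEigenvalue_iff_isRoot_charpoly] at h1
    obtain ⟨v, hv⟩ := h1.exists_hasEigenvector
    exact ⟨v, hv.2, hv.apply_eq_smul⟩

theorem pow_apply_eig (X : End ℂ V) {μ : ℂ} {v : V} (h : X v = μ • v) (m : ℕ) :
    (X ^ m) v = μ ^ m • v := by
  induction m with
  | zero => simp
  | succ m ih => rw [pow_succ', Module.End.mul_apply, ih, map_smul, h, smul_smul, ← pow_succ]

theorem trace_mem (X : End ℂ V) (M : ℕ) (h : X ^ (M + 1) = X) : LinearMap.trace ℂ V X ∈ Qcyc M := by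
  obtain ⟨S, h1, -, h3⟩ := trace_roots X
  rw [← h1]
  apply multiset_sum_mem
  intro μ hμ
  obtain ⟨v, hv, hXv⟩ := h3 μ hμ
  have h4 := pow_apply_eig X hXv (M + 1)
  rw [h, hXv] at h4
  have h5 : μ = μ ^ (M + 1) := smul_left_injective ℂ hv h4
  by_cases h0 : μ = 0
  · rw [h0]; exact zero_mem _
  · apply mem_Qcyc
    rw [pow_succ] at h5
    exact mul_right_cancel₀ h0 (by rw [← h5, one_mul])

theorem trace_roots_one (X : End ℂ V) (M : ℕ) (h : X ^ M = 1) :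
    ∃ S : Multiset ℂ, S.sum = LinearMap.trace ℂ V X ∧
    Multiset.card S = finrank ℂ V ∧ ∀ μ ∈ S, μ ^ M = 1 := by
  obtain ⟨S, h1, h2, h3⟩ := trace_roots X
  refine ⟨S, h1, h2, fun μ hμ => ?_⟩
  obtain ⟨v, hv, hXv⟩ := h3 μ hμ
  have h4 := pow_apply_eig X hXv M
  rw [h] at h4
  exact (smul_left_injective ℂ hv (by simpa using h4)).symm

end lin

section avg
variable {G : Type*} [Group G] [Finite G] {V : Type*} [AddCommGroup V] [Module ℂ V]

/-- average of a representation over a subgroup -/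
noncomputable def avg (ρ : G →* End ℂ V) (N : Subgroup G) : End ℂ V :=
  (Nat.card N : ℂ)⁻¹ • ∑ᶠ n : N, ρ n

variable (ρ : G →* End ℂ V) (N : Subgroup G)

theorem avg_apply_of_fixed (v : V) (hv : ∀ n ∈ N, ρ n v = v) : avg ρ N v = v := by
  have := Fintype.ofFinite N
  rw [avg, finsum_eq_sum_of_fintype, LinearMap.smul_apply, LinearMap.sum_apply,
    Finset.sum_congr rfl (fun (n : N) _ => hv n n.2), Finset.sum_const, Finset.card_univ,
    ← Nat.card_eq_fintype_card, ← Nat.cast_smul_eq_nsmul ℂ, smul_smul, inv_mul_cancel₀, one_smul]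
  exact_mod_cast Nat.card_pos.ne'

theorem mul_avg (n : G) (hn : n ∈ N) : ρ n * avg ρ N = avg ρ N := by
  have := Fintype.ofFinite N
  rw [avg, finsum_eq_sum_of_fintype, mul_smul_comm, Finset.mul_sum]
  congr 1
  refine Fintype.sum_equiv (Equiv.mulLeft (⟨n, hn⟩ : N)) _ _ fun m => ?_
  simp

theorem avg_mul (n : G) (hn : n ∈ N) : avg ρ N * ρ n = avg ρ N := by
  have := Fintype.ofFinite N
  rw [avg, finsum_eq_sum_of_fintype, smul_mul_assoc, Finset.sum_mul]
  congr 1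
  refine Fintype.sum_equiv (Equiv.mulRight (⟨n, hn⟩ : N)) _ _ fun m => ?_
  simp

theorem avg_comm (l : G) (hl : ∀ m ∈ N, l⁻¹ * m * l ∈ N) : ρ l * avg ρ N = avg ρ N * ρ l := by
  have := Fintype.ofFinite N
  rw [avg, finsum_eq_sum_of_fintype, smul_mul_assoc, mul_smul_comm, Finset.sum_mul, Finset.mul_sum]
  congr 1
  symm
  let φ : N → N := fun m => ⟨l⁻¹ * m * l, hl m m.2⟩
  have hφ : Function.Bijective φ := by
    rw [← Finite.injective_iff_bijective]
    intro a b hab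
    have := congrArg Subtype.val hab
    have h2 : l⁻¹ * (a : G) * l = l⁻¹ * (b : G) * l := this
    exact Subtype.ext (mul_left_cancel (mul_right_cancel h2))
  refine Fintype.sum_bijective φ hφ _ _ fun m => ?_
  simp only [φ, ← map_mul]
  congr 1
  group

theorem avg_idem : avg ρ N * avg ρ N = avg ρ N := by
  ext v
  rw [Module.End.mul_apply]
  apply avg_apply_of_fixed
  intro n hn
  rw [← Module.End.mul_apply, mul_avg ρ N n hn]

theorem trace_avg (x : G) (hx : ∀ m ∈ N, x⁻¹ * m * x ∈ N) (hc : ∀ m ∈ N, m * x = x * m → m = 1) :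
    LinearMap.trace ℂ V (ρ x * avg ρ N) = LinearMap.trace ℂ V (ρ x) := by
  have := Fintype.ofFinite N
  rw [avg, finsum_eq_sum_of_fintype, mul_smul_comm, Finset.mul_sum, map_smul, map_sum]
  let φ : N → N := fun m => ⟨x⁻¹ * m * x * (m : G)⁻¹, N.mul_mem (hx m m.2) (N.inv_mem m.2)⟩
  have hφ : Function.Bijective φ := by
    rw [← Finite.injective_iff_bijective]
    intro a b hab
    have h1 : x⁻¹ * (a : G) * x * (a : G)⁻¹ = x⁻¹ * b * x * (b : G)⁻¹ := congrArg Subtype.val hab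
    have h2 : (a : G) * x * (a : G)⁻¹ = b * x * (b : G)⁻¹ := by
      have := congrArg (fun y => x * y) h1
      simpa [mul_assoc] using this
    have h3 := hc ((b : G)⁻¹ * a) (N.mul_mem (N.inv_mem b.2) a.2) (by
      have := congrArg (fun y => (b : G)⁻¹ * y * a) h2
      simpa [mul_assoc] using this)
    exact Subtype.ext (inv_mul_eq_one.mp h3).symm
  have h : ∑ m : N, LinearMap.trace ℂ V (ρ x * ρ m) = ∑ m : N, LinearMap.trace ℂ V (ρ x) := by
    symm
    refine Fintype.sum_bijective φ hφ _ _ fun m => ?_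
    have e : ρ x * ρ (φ m : G) = ρ (m : G) * (ρ x * ρ (m : G)⁻¹) := by
      simp only [φ, ← map_mul]
      congr 1
      group
    rw [e, LinearMap.trace_mul_comm, mul_assoc, ← map_mul, inv_mul_cancel, map_one, mul_one]
  rw [h, Finset.sum_const, Finset.card_univ, ← Nat.card_eq_fintype_card,
    ← Nat.cast_smul_eq_nsmul ℂ, smul_smul, inv_mul_cancel₀, one_smul]
  exact_mod_cast Nat.card_pos.ne'

end avg
end NT


namespace NT
open Module

section mat
variable {F : Type} [Field F] {n : ℕ}

/-- diagonal torus -/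
noncomputable def dg : (Fin n → Fˣ) →* Matrix.GeneralLinearGroup (Fin n) F :=
  MonoidHom.toHomUnits
    { toFun := fun t => Matrix.diagonal fun i => (t i : F)
      map_one' := by simp
      map_mul' := by intro s t; simp }

theorem dg_apply (t : Fin n → Fˣ) (i j : Fin n) :
    (dg t : Matrix (Fin n) (Fin n) F) i j = if i = j then (t i : F) else 0 :=
  Matrix.diagonal_apply _ _ _

theorem dg_val (t : Fin n → Fˣ) :
    ((dg t : Matrix.GeneralLinearGroup (Fin n) F) : Matrix (Fin n) (Fin n) F) =
      Matrix.diagonal fun i => (t i : F) := rfl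

/-- permutation matrices -/
noncomputable def pm : Equiv.Perm (Fin n) →* Matrix.GeneralLinearGroup (Fin n) F :=
  MonoidHom.toHomUnits
    { toFun := fun w => Matrix.of fun i j => if i = w j then 1 else 0
      map_one' := by ext i j; simp only [Matrix.of_apply, Matrix.one_apply]; rfl
      map_mul' := by
        intro s t; ext i j
        simp [Matrix.mul_apply]
        rfl }

theorem pm_apply (w : Equiv.Perm (Fin n)) (i j : Fin n) :
    ((pm w : Matrix.GeneralLinearGroup (Fin n) F) : Matrix (Fin n) (Fin n) F) i j = if i = w j then 1 else 0 := rfl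

theorem mul_dg_apply (g : Matrix.GeneralLinearGroup (Fin n) F) (t : Fin n → Fˣ) (i j : Fin n) :
    (g * dg t).1 i j = g.1 i j * t j := by
  rw [Units.val_mul, dg_val, Matrix.mul_diagonal]

theorem dg_mul_apply (g : Matrix.GeneralLinearGroup (Fin n) F) (t : Fin n → Fˣ) (i j : Fin n) :
    (dg t * g).1 i j = t i * g.1 i j := by
  rw [Units.val_mul, dg_val, Matrix.diagonal_mul]

theorem pm_dg (w : Equiv.Perm (Fin n)) (t : Fin n → Fˣ) :
    (pm w * dg t : Matrix.GeneralLinearGroup (Fin n) F) = dg (fun i => t (w.symm i)) * pm w := by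
  apply Units.ext
  ext i j
  rw [mul_dg_apply, dg_mul_apply, pm_apply]
  by_cases h : i = w j
  · simp [h]
  · simp [h]

theorem dg_pm (w : Equiv.Perm (Fin n)) (t : Fin n → Fˣ) :
    (dg t * pm w : Matrix.GeneralLinearGroup (Fin n) F) = pm w * dg (fun i => t (w i)) := by
  rw [pm_dg]; simp

variable [Finite F]
set_option linter.unusedSectionVars false

instance : Finite (Matrix.GeneralLinearGroup (Fin n) F) := by
  have : Finite (Matrix (Fin n) (Fin n) F) := by unfold Matrix; infer_instance
  infer_instance

/-- The unipotent subgroup attached to a level function `r`. -/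
def NN (F : Type) [Field F] [Finite F] {n : ℕ} (r : Fin n → ℕ) :
    Subgroup (Matrix.GeneralLinearGroup (Fin n) F) :=
  let S : Submonoid (Matrix.GeneralLinearGroup (Fin n) F) :=
    { carrier := {g | ∀ i j, ¬ r i < r j → g.1 i j = if i = j then 1 else 0}
      one_mem' := by
        intro i j _
        exact Matrix.one_apply
      mul_mem' := by
        intro g h hg hh i j hij
        rw [Units.val_mul, Matrix.mul_apply]
        have : ∀ k, g.1 i k * h.1 k j = if k = i then (if i = j then 1 else 0) else 0 := by
          intro k
          by_cases hk : r i < r k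
          · have hkj : ¬ r k < r j := by omega
            have hne : k ≠ j := by rintro rfl; exact hij hk
            have hne2 : k ≠ i := by rintro rfl; omega
            rw [hh k j hkj, if_neg hne, mul_zero, if_neg hne2]
          · rw [hg i k hk]
            by_cases hki : k = i
            · subst hki; rw [hh k j hij]; simp
            · rw [if_neg (fun h => hki h.symm), if_neg hki, zero_mul]
        rw [Finset.sum_congr rfl fun k _ => this k]
        simp }
  { S with
    inv_mem' := by
      intro x hx
      have h1 : x⁻¹ = x ^ (Nat.card (Matrix.GeneralLinearGroup (Fin n) F) - 1) := by
        rw [inv_eq_iff_mul_eq_one, ← pow_succ', Nat.sub_add_cancel Nat.card_pos, pow_card_eq_one']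
      rw [h1]
      exact S.pow_mem hx _ }

theorem mem_NN {r : Fin n → ℕ} {g : Matrix.GeneralLinearGroup (Fin n) F} :
    g ∈ NN F r ↔ ∀ i j, ¬ r i < r j → g.1 i j = if i = j then 1 else 0 := Iff.rfl

/-- upper unitriangular group -/
def UU (F : Type) [Field F] [Finite F] (n : ℕ) : Subgroup (Matrix.GeneralLinearGroup (Fin n) F) :=
  NN F (fun i : Fin n => (i : ℕ))

theorem mem_UU {g : Matrix.GeneralLinearGroup (Fin n) F} :
    g ∈ UU F n ↔ ∀ i j, ¬ i < j → g.1 i j = if i = j then 1 else 0 := Iff.rfl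

theorem NN_le_UU {r : Fin n → ℕ} (hr : Monotone r) : NN F r ≤ UU F n := by
  intro g hg i j hij
  apply hg
  have : ¬ i < j := hij
  exact not_lt.mpr (hr (not_lt.mp this))

theorem block_of_commute {x : Matrix.GeneralLinearGroup (Fin n) F} {d : Fin n → Fˣ}
    (h : x * dg d = dg d * x) {i j : Fin n} (hij : d i ≠ d j) : x.1 i j = 0 := by
  have h1 : (x * dg d).1 i j = (dg d * x).1 i j := by rw [h]
  rw [mul_dg_apply, dg_mul_apply, mul_comm] at h1
  by_contra h0
  exact hij (Units.ext (mul_right_cancel₀ h0 h1).symm)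

theorem trace_NN {V : Type*} [AddCommGroup V] [Module ℂ V]
    (ρ : Matrix.GeneralLinearGroup (Fin n) F →* End ℂ V)
    (x : Matrix.GeneralLinearGroup (Fin n) F) (d : Fin n → Fˣ) (r : Fin n → ℕ)
    (hr : ∀ i j, r i = r j ↔ d i = d j) (k : ℕ) (hk : x ^ k = dg d) :
    (∀ m ∈ NN F r, x⁻¹ * m * x ∈ NN F r) ∧
    LinearMap.trace ℂ V (ρ x * avg ρ (NN F r)) = LinearMap.trace ℂ V (ρ x) := by
  have hx : x * dg d = dg d * x := by rw [← hk, ← pow_succ, ← pow_succ']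
  have hx' : x⁻¹ * dg d = dg d * x⁻¹ := (Commute.inv_left (show Commute x (dg d) from hx)).eq
  have hN : ∀ m ∈ NN F r, x⁻¹ * m * x ∈ NN F r := by
    intro m hm i j hij
    have e : ∀ k l, (x⁻¹).1 i k * (m.1 k l * x.1 l j) = (x⁻¹).1 i k * ((1 : Matrix _ _ F) k l * x.1 l j) := by
      intro k l
      by_cases h1 : r i = r k
      · by_cases h2 : r l = r j
        · rw [hm k l (by omega), Matrix.one_apply]
        · rw [block_of_commute hx (fun h => h2 ((hr _ _).mpr h))]; simp
      · rw [block_of_commute hx' (fun h => h1 ((hr _ _).mpr h))]; simp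
    rw [mul_assoc, Units.val_mul, Units.val_mul, Matrix.mul_apply]
    simp_rw [Matrix.mul_apply, Finset.mul_sum, e, ← Finset.mul_sum, ← Matrix.mul_apply]
    rw [one_mul, ← Units.val_mul, inv_mul_cancel, Units.val_one, Matrix.one_apply]
  refine ⟨hN, trace_avg ρ _ x hN ?_⟩
  intro m hm hmx
  have hmd : m * dg d = dg d * m := by
    rw [← hk]
    exact (Commute.pow_right (show Commute m x from hmx) k).eq
  apply Units.ext
  ext i j
  rw [Units.val_one, Matrix.one_apply]
  by_cases h : r i < r j
  · rw [block_of_commute hmd (fun h' => by have := (hr i j).mpr h'; omega), if_neg]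
    rintro rfl; omega
  · exact hm i j h

theorem comm_mem_NN {r : Fin n → ℕ} (hr : Monotone r) {z : Fin n → Fˣ}
    (hz : ∀ i j, r i = r j → z i = z j) {u : Matrix.GeneralLinearGroup (Fin n) F} (hu : u ∈ UU F n) :
    dg z * u * dg z⁻¹ * u⁻¹ ∈ NN F r := by
  intro i j hij
  rw [Units.val_mul, Matrix.mul_apply]
  have hu' := (UU F n).inv_mem hu
  have e : ∀ k, (dg z * u * dg z⁻¹).1 i k * (u⁻¹).1 k j = u.1 i k * (u⁻¹).1 k j := by
    intro k
    rw [mul_dg_apply, dg_mul_apply]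
    by_cases h1 : i ≤ k
    · by_cases h2 : k ≤ j
      · have h3 := hr h1
        have h4 := hr h2
        rw [hz i k (by omega), mul_comm, mul_comm (z k : F), mul_assoc]
        simp [mul_comm]
      · rw [mem_UU.mp hu' k j (by omega), if_neg (by rintro rfl; exact h2 le_rfl)]; simp
    · rw [mem_UU.mp hu i k (by omega), if_neg (by rintro rfl; exact h1 le_rfl)]; simp
  rw [Finset.sum_congr rfl fun k _ => e k, ← Matrix.mul_apply, ← Units.val_mul, mul_inv_cancel,
    Units.val_one, Matrix.one_apply]

theorem mkU (M' : Fin n → Fin n → F) (hM : ∀ i j, ¬ i < j → M' i j = if i = j then 1 else 0) :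
    ∃ u ∈ UU F n, ∀ a b, u.1 a b = M' a b := by
  let M : Matrix (Fin n) (Fin n) F := Matrix.of M'
  replace hM : ∀ i j, ¬ i < j → M i j = if i = j then 1 else 0 := hM
  have hdet : M.det = 1 := by
    rw [Matrix.det_of_isUpperTriangular]
    · apply Finset.prod_eq_one
      intro i _
      rw [hM i i (lt_irrefl i), if_pos rfl]
    · intro i j hij
      have hij' : j < i := hij
      rw [hM i j (not_lt.mpr hij'.le), if_neg hij'.ne']
  refine ⟨Matrix.GeneralLinearGroup.mkOfDetNeZero M (by rw [hdet]; exact one_ne_zero), ?_, fun _ _ => rfl⟩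
  exact hM

theorem bruhat_aux (g : Matrix.GeneralLinearGroup (Fin n) F) (k : ℕ) (hk : k ≤ n) :
    ∃ u1 ∈ UU F n, ∃ u2 ∈ UU F n, ∀ j : Fin n, (j : ℕ) < k → ∃ i, (u1 * g * u2).1 i j ≠ 0 ∧
      (∀ i', i' ≠ i → (u1 * g * u2).1 i' j = 0) ∧ ∀ j', j' ≠ j → (u1 * g * u2).1 i j' = 0 := by
  induction k with
  | zero => exact ⟨1, one_mem _, 1, one_mem _, fun j hj => absurd hj (Nat.not_lt_zero _)⟩
  | succ k ih =>
    obtain ⟨u1, hu1, u2, hu2, H⟩ := ih (by omega)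
    set h := u1 * g * u2 with hh
    let c : Fin n := ⟨k, by omega⟩
    have hex : ∃ i, h.1 i c ≠ 0 := by
      by_contra hcon
      push Not at hcon
      have h1 : (h⁻¹ * h).1 c c = 0 := by
        rw [Units.val_mul, Matrix.mul_apply]
        apply Finset.sum_eq_zero
        intro x _
        rw [hcon x, mul_zero]
      rw [inv_mul_cancel, Units.val_one, Matrix.one_apply_eq] at h1
      exact one_ne_zero h1
    classical
    let S := Finset.univ.filter fun i => h.1 i c ≠ 0
    have hS : S.Nonempty := by
      obtain ⟨i, hi⟩ := hex
      exact ⟨i, by simp [S, hi]⟩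
    let i := S.max' hS
    have hi : h.1 i c ≠ 0 := by
      have := S.max'_mem hS
      exact (Finset.mem_filter.mp this).2
    have hmax : ∀ a, i < a → h.1 a c = 0 := by
      intro a ha
      by_contra h0
      have := S.le_max' a (by simp [S, h0])
      exact absurd ha (not_lt.mpr this)
    -- earlier pivots
    have hij : ∀ j : Fin n, (j : ℕ) < k → h.1 i j = 0 := by
      intro j hj
      obtain ⟨a, h1, h2, h3⟩ := H j hj
      apply h2
      rintro rfl
      exact hi (h3 c (by intro hc; rw [← hc] at hj; exact lt_irrefl _ hj))
    let cf : Fin n → F := fun a => if a = i then 0 else - h.1 a c / h.1 i c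
    obtain ⟨v1, hv1, hv1M⟩ := mkU (F := F) (n := n)
      (fun a b => (if a = b then 1 else 0) + (if b = i then cf a else 0)) (by
        intro a b hab
        by_cases hb : b = i
        · subst hb
          by_cases ha : a = i
          · simp [cf, ha]
          · have : cf a = 0 := by
              simp only [cf, if_neg ha]
              rw [hmax a (by omega)]; simp
            simp [this]
        · simp [hb])
    have e1 : ∀ a b, (v1 * h).1 a b = h.1 a b + cf a * h.1 i b := by
      intro a b
      rw [Units.val_mul, Matrix.mul_apply]
      simp [hv1M, add_mul, Finset.sum_add_distrib]
    let df : Fin n → F := fun b => if b = c then 0 else - h.1 i b / h.1 i c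
    obtain ⟨v2, hv2, hv2M⟩ := mkU (F := F) (n := n)
      (fun a b => (if a = b then 1 else 0) + (if a = c then df b else 0)) (by
        intro a b hab
        by_cases ha : a = c
        · subst ha
          by_cases hb : b = c
          · simp [df, hb]
          · have : df b = 0 := by
              simp only [df, if_neg hb]
              have hlt : b < c := by omega
              rw [hij b hlt]; simp
            simp [this]
        · simp [ha])
    have e2 : ∀ a b, (v1 * h * v2).1 a b = h.1 a b + cf a * h.1 i b + (h.1 a c + cf a * h.1 i c) * df b := by
      intro a b
      rw [Units.val_mul, Matrix.mul_apply]
      simp [hv2M, mul_add, Finset.sum_add_distrib, e1]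
    refine ⟨v1 * u1, mul_mem hv1 hu1, u2 * v2, mul_mem hu2 hv2, ?_⟩
    have e3 : v1 * u1 * g * (u2 * v2) = v1 * h * v2 := by rw [hh]; group
    rw [e3]
    intro j hj
    have hci : cf i = 0 := by simp [cf]
    have hcol : ∀ a, a ≠ i → h.1 a c + cf a * h.1 i c = 0 := by
      intro a ha
      simp only [cf, if_neg ha]
      field_simp
      ring
    by_cases hjk : j = c
    · subst hjk
      have hdc : df c = 0 := by simp [df]
      refine ⟨i, ?_, ?_, ?_⟩
      · rw [e2, hci, hdc]; simpa using hi
      · intro a ha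
        rw [e2, hcol a ha, zero_mul, add_zero]
      · intro b hb
        rw [e2, hci]
        simp only [df, if_neg hb]
        field_simp
        ring
    · have hjk' : (j : ℕ) < k := by
        rcases Nat.lt_succ_iff_lt_or_eq.mp hj with h1 | h1
        · exact h1
        · exact absurd (Fin.ext h1) hjk
      obtain ⟨a, h1, h2, h3⟩ := H j hjk'
      have hdj : df j = 0 := by
        simp only [df, if_neg hjk]
        rw [hij j hjk']; simp
      have hai : a ≠ i := by
        rintro rfl
        exact h1 (hij j hjk')
      have hac : h.1 a c = 0 := h3 c (fun h => hjk h.symm)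
      have hca : cf a = 0 := by
        simp only [cf, if_neg hai, hac]; simp
      refine ⟨a, ?_, ?_, ?_⟩
      · rw [e2, hdj, hij j hjk']; simpa using h1
      · intro a' ha'
        rw [e2, hdj, hij j hjk', h2 a' ha']; simp
      · intro b hb
        rw [e2, hca, hac, h3 b hb]; simp

theorem bruhat (g : Matrix.GeneralLinearGroup (Fin n) F) :
    ∃ u1 ∈ UU F n, ∃ (w : Equiv.Perm (Fin n)) (t : Fin n → Fˣ), ∃ u2 ∈ UU F n,
      g = u1 * pm w * dg t * u2 := by
  obtain ⟨u1, hu1, u2, hu2, H⟩ := bruhat_aux g n le_rfl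
  set h := u1 * g * u2 with hh
  have H' : ∀ j : Fin n, _ := fun j => H j j.2
  choose f h1 h2 h3 using H'
  have hf : Function.Injective f := by
    intro a b hab
    by_contra hne
    apply h1 b
    rw [← hab]
    exact h3 a b (fun h => hne h.symm)
  let w : Equiv.Perm (Fin n) := Equiv.ofBijective f (Finite.injective_iff_bijective.mp hf)
  let t : Fin n → Fˣ := fun j => Units.mk0 _ (h1 j)
  have e : h = pm w * dg t := by
    apply Units.ext
    ext i j
    rw [mul_dg_apply, pm_apply]
    by_cases hi : i = f j
    · subst hi
      simp [w, t]
    · rw [h2 j i hi, if_neg, zero_mul]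
      exact hi
  refine ⟨u1⁻¹, inv_mem hu1, w, t, u2⁻¹, inv_mem hu2, ?_⟩
  rw [mul_assoc u1⁻¹, ← e, hh]
  group

end mat
end NT


namespace NT
open Module

section rep
variable {F : Type} [Field F] [Finite F] {n : ℕ}
variable {V : Type} [AddCommGroup V] [Module ℂ V] [FiniteDimensional ℂ V]
variable (ρ : Matrix.GeneralLinearGroup (Fin n) F →* End ℂ V)
set_option linter.unusedSectionVars false

theorem common_eig {T : Type*} [CommGroup T] [Finite T] (σ : T →* End ℂ V) (W : Submodule ℂ V)
    (hW : W ≠ ⊥) (hinv : ∀ t, ∀ v ∈ W, σ t v ∈ W) :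
    ∃ v ∈ W, v ≠ 0 ∧ ∃ θ : T → ℂ, ∀ t, σ t v = θ t • v := by
  classical
  have := Fintype.ofFinite T
  have key : ∀ s : Finset T, ∃ W' : Submodule ℂ V, W' ≤ W ∧ W' ≠ ⊥ ∧ (∀ t, ∀ v ∈ W', σ t v ∈ W') ∧
      ∀ t ∈ s, ∃ c : ℂ, ∀ v ∈ W', σ t v = c • v := by
    intro s
    induction s using Finset.induction_on with
    | empty => exact ⟨W, le_rfl, hW, hinv, fun t ht => absurd ht (Finset.notMem_empty t)⟩
    | insert a s _ ih =>
      obtain ⟨W', h1, h2, h3, h4⟩ := ih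
      have : Nontrivial W' := Submodule.nontrivial_iff_ne_bot.mpr h2
      obtain ⟨μ, hμ⟩ := Module.End.exists_eigenvalue ((σ a).restrict (h3 a))
      obtain ⟨w, hw⟩ := hμ.exists_hasEigenvector
      have hw1 : σ a (w : V) = μ • (w : V) := congrArg Subtype.val hw.apply_eq_smul
      refine ⟨W' ⊓ Module.End.eigenspace (σ a) μ, inf_le_left.trans h1, ?_, ?_, ?_⟩
      · rw [Submodule.ne_bot_iff]
        refine ⟨w, ⟨w.2, Module.End.mem_eigenspace_iff.mpr hw1⟩, ?_⟩
        intro h0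
        exact hw.2 (Subtype.ext h0)
      · rintro t v ⟨hv1, hv2⟩
        refine ⟨h3 t v hv1, ?_⟩
        have hv2' : σ a v = μ • v := Module.End.mem_eigenspace_iff.mp hv2
        apply Module.End.mem_eigenspace_iff.mpr
        rw [← Module.End.mul_apply, ← map_mul, mul_comm, map_mul, Module.End.mul_apply, hv2', map_smul]
      · intro t ht
        rcases Finset.mem_insert.mp ht with rfl | ht
        · exact ⟨μ, fun v hv => Module.End.mem_eigenspace_iff.mp hv.2⟩
        · obtain ⟨c, hc⟩ := h4 t ht
          exact ⟨c, fun v hv => hc v hv.1⟩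
  obtain ⟨W', h1, h2, -, h4⟩ := key Finset.univ
  obtain ⟨v, hv, hv0⟩ := (Submodule.ne_bot_iff W').mp h2
  choose θ hθ using fun t => h4 t (Finset.mem_univ t)
  exact ⟨v, h1 hv, hv0, θ, fun t => hθ t v hv⟩

theorem common_eig' {T : Type*} [CommGroup T] [Finite T] (σ : T →* End ℂ V) (W : Submodule ℂ V)
    (hW : W ≠ ⊥) (hinv : ∀ t, ∀ v ∈ W, σ t v ∈ W) :
    ∃ v ∈ W, v ≠ 0 ∧ ∃ θ : T →* ℂ, ∀ t, σ t v = θ t • v := by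
  obtain ⟨v, hv, hv0, θ, hθ⟩ := common_eig σ W hW hinv
  refine ⟨v, hv, hv0, ⟨⟨θ, ?_⟩, ?_⟩, hθ⟩
  · apply smul_left_injective ℂ hv0
    simp [← hθ]
  · intro s t
    apply smul_left_injective ℂ hv0
    simp only
    rw [← hθ, map_mul, Module.End.mul_apply, hθ, map_smul, hθ, smul_smul, mul_comm]

theorem avg_UU_ne {p : ℕ} [Fact p.Prime] (hpn : n < p) (ζ : Fˣ) (hζ : orderOf ζ = p)
    (hdeg : ¬ p ∣ finrank ℂ V) : avg ρ (UU F n) ≠ 0 := by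
  intro h0
  let d : Fin n → Fˣ := fun j => ζ ^ (j : ℕ)
  have hd : ∀ i j : Fin n, (i : ℕ) = j ↔ d i = d j := by
    intro i j
    refine ⟨fun h => by simp [d, h], fun h => ?_⟩
    exact pow_injOn_Iio_orderOf (by rw [hζ]; exact i.2.trans hpn) (by rw [hζ]; exact j.2.trans hpn) h
  have h1 := (trace_NN ρ (dg d) d (fun i => (i : ℕ)) hd 1 (pow_one _)).2
  have h2 : avg ρ (NN F fun i : Fin n => (i : ℕ)) = 0 := h0
  rw [h2, mul_zero, map_zero] at h1
  obtain ⟨S, hS1, hS2, hS3⟩ := trace_roots_one (ρ (dg d)) p (by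
    rw [← map_pow, ← map_pow]
    have : d ^ p = 1 := by
      ext j
      simp only [d, Pi.pow_apply, ← pow_mul, mul_comm _ p]
      rw [pow_mul, ← hζ, pow_orderOf_eq_one, one_pow]; rfl
    rw [this, map_one, map_one])
  have h3 := dvd_card_sub (p := p) 0 S 0 (by simpa using hS3) (by simp) (by rw [hS1, ← h1]; rfl)
  rw [hS2] at h3
  apply hdeg
  simpa [Int.natCast_dvd_natCast] using h3

theorem dg_norm (t : Fin n → Fˣ) (m) (hm : m ∈ UU F n) : (dg t)⁻¹ * m * dg t ∈ UU F n := by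
  intro i j hij
  rw [← map_inv, mul_dg_apply, dg_mul_apply, hm i j hij]
  by_cases h : i = j
  · subst h; simp
  · simp [h]

/-- The package of data: highest-weight-like vector. -/
structure HW (v : V) (θ : (Fin n → Fˣ) →* ℂ) : Prop where
  fixed : ∀ u ∈ UU F n, ρ u v = v
  eig : ∀ t, ρ (dg t) v = θ t • v
  span : Submodule.span ℂ (Set.range fun g => ρ g v) = ⊤

theorem exists_HW (hirr : ∀ W : Submodule ℂ V, (∀ g, ∀ v ∈ W, ρ g v ∈ W) → ∀ v ∈ W, v ≠ 0 → W = ⊤)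
    (hU : avg ρ (UU F n) ≠ 0) : ∃ v θ, HW ρ v θ := by
  obtain ⟨v, hv, hv0, θ, hθ⟩ := common_eig' (ρ.comp dg) (LinearMap.range (avg ρ (UU F n)))
    (by rwa [Ne, LinearMap.range_eq_bot]) (by
      rintro t _ ⟨v, rfl⟩
      refine ⟨ρ (dg t) v, ?_⟩
      rw [← Module.End.mul_apply, ← avg_comm ρ _ (dg t) (dg_norm t)]
      rfl)
  refine ⟨v, θ, ?_, hθ, ?_⟩
  · obtain ⟨w, rfl⟩ := hv
    intro u hu
    rw [← Module.End.mul_apply, mul_avg ρ _ u hu]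
  · refine hirr _ ?_ v (Submodule.subset_span ⟨1, by simp⟩) hv0
    intro g w hw
    induction hw using Submodule.span_induction with
    | mem x hx =>
      obtain ⟨h, rfl⟩ := hx
      apply Submodule.subset_span
      exact ⟨g * h, by simp⟩
    | zero => simp
    | add x y _ _ hx hy => rw [map_add]; exact Submodule.add_mem _ hx hy
    | smul c x _ hx => rw [map_smul]; exact Submodule.smul_mem _ _ hx

variable {ρ} {v : V} {θ : (Fin n → Fˣ) →* ℂ}

theorem HW.trace (H : HW ρ v θ) : ∃ (κ : Type) (_ : Fintype κ) (a : κ → Equiv.Perm (Fin n)),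
    ∀ y, LinearMap.trace ℂ V (ρ (dg y) * avg ρ (UU F n)) = ∑ k, θ (fun i => y (a k i)) := by
  classical
  let e := avg ρ (UU F n)
  let f : Equiv.Perm (Fin n) → V := fun w => e (ρ (pm w) v)
  obtain ⟨κ, a, ha, hsp, hli⟩ := exists_linearIndependent' ℂ f
  have hκ : Finite κ := Finite.of_injective a ha
  have := Fintype.ofFinite κ
  refine ⟨κ, this, a, fun y => ?_⟩
  have hfw : ∀ w, ρ (dg y) (f w) = θ (fun i => y (w i)) • f w := by
    intro w
    calc ρ (dg y) (f w) = (ρ (dg y) * avg ρ (UU F n)) (ρ (pm w) v) := rfl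
      _ = e ((ρ (dg y) * ρ (pm w)) v) := by rw [avg_comm ρ _ (dg y) (dg_norm y)]; rfl
      _ = e (ρ (pm w) (ρ (dg fun i => y (w i)) v)) := by
        rw [← map_mul, dg_pm, map_mul]; rfl
      _ = _ := by rw [H.eig, map_smul, map_smul]
  let W := Submodule.span ℂ (Set.range (f ∘ a))
  have hmem : ∀ w, f w ∈ W := by
    intro w
    change f w ∈ Submodule.span ℂ (Set.range (f ∘ a))
    rw [hsp]
    exact Submodule.subset_span ⟨w, rfl⟩
  have hrange : ∀ x, e x ∈ W := by
    intro x
    have hx : x ∈ Submodule.span ℂ (Set.range fun g => ρ g v) := by rw [H.span]; trivial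
    induction hx using Submodule.span_induction with
    | mem x hx =>
      obtain ⟨g, rfl⟩ := hx
      obtain ⟨u1, hu1, w, t, u2, hu2, rfl⟩ := bruhat g
      have h1 : e (ρ (u1 * pm w * dg t * u2) v) = θ t • f w := by
        simp only [map_mul, Module.End.mul_apply]
        rw [H.fixed u2 hu2, H.eig, map_smul, map_smul, map_smul, ← Module.End.mul_apply e, avg_mul ρ _ u1 hu1]
      simp only [h1]
      exact Submodule.smul_mem _ _ (hmem w)
    | zero => simp
    | add x y _ _ hx hy => rw [map_add]; exact Submodule.add_mem _ hx hy
    | smul c x _ hx => rw [map_smul]; exact Submodule.smul_mem _ _ hx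
  have hef : ∀ w, e (f w) = f w := by
    intro w
    change (avg ρ (UU F n) * avg ρ (UU F n)) _ = _
    rw [avg_idem]
  have hinv : ∀ x, (ρ (dg y) * e) x ∈ W := by
    intro x
    change (ρ (dg y) * avg ρ (UU F n)) x ∈ W
    rw [avg_comm ρ _ (dg y) (dg_norm y)]
    exact hrange _
  have hinv' : ∀ x ∈ W, (ρ (dg y) * e) x ∈ W := fun x _ => hinv x
  have h2 := LinearMap.trace_restrict_eq_of_forall_mem W (ρ (dg y) * e) hinv hinv'
  change LinearMap.trace ℂ V (ρ (dg y) * e) = _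
  rw [← h2]
  let B := Basis.span hli
  rw [LinearMap.trace_eq_matrix_trace ℂ B, Matrix.trace]
  refine Finset.sum_congr rfl fun k _ => ?_
  rw [Matrix.diag_apply, LinearMap.toMatrix_apply]
  have h3 : (LinearMap.restrict (ρ (dg y) * e) hinv') (B k) = θ (fun i => y (a k i)) • B k := by
    apply Subtype.ext
    have hB : ((B k : W) : V) = f (a k) := Basis.coe_span_apply hli k
    rw [LinearMap.coe_restrict_apply, SetLike.val_smul, hB, Module.End.mul_apply, hef, hfw]
  rw [h3]
  simp

theorem HW.upper (H : HW ρ v θ) (x : Matrix.GeneralLinearGroup (Fin n) F) (d : Fin n → Fˣ)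
    (r : Fin n → ℕ) (hr : ∀ i j, r i = r j ↔ d i = d j) (hm : Monotone r) (m q : ℕ)
    (hx : x ^ m = dg d) (hθ : ∀ w : Equiv.Perm (Fin n), θ (fun i => d (w i)) ^ q = 1) :
    LinearMap.trace ℂ V (ρ x) ∈ Qcyc (q * m) := by
  obtain ⟨h1, h2⟩ := trace_NN ρ x d r hr m hx
  rw [← h2]
  set e := avg ρ (NN F r) with he
  have hcomm : ρ x * e = e * ρ x := avg_comm ρ _ x h1
  let z := d ^ q
  have hz : ∀ i j, r i = r j → z i = z j := by
    intro i j hij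
    simp [z, (hr i j).mp hij]
  have hxz : x ^ (q * m) = dg z := by
    rw [mul_comm, pow_mul, hx, ← map_pow]
  have hzN : ∀ m ∈ NN F r, (dg z)⁻¹ * m * dg z ∈ NN F r := by
    intro m hm i j hij
    rw [← map_inv, mul_dg_apply, dg_mul_apply, hm i j hij]
    by_cases h : i = j
    · subst h; simp
    · simp [h]
  have hze : ρ (dg z) * e = e := by
    rw [avg_comm ρ _ (dg z) hzN]
    apply LinearMap.ext_on H.span
    rintro _ ⟨g, rfl⟩
    obtain ⟨u1, hu1, w, t, u2, hu2, rfl⟩ := bruhat g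
    have e1 : dg z * (u1 * pm w * dg t * u2) =
        (dg z * u1 * dg z⁻¹ * u1⁻¹) * (u1 * (pm w * (dg (fun i => z (w i)) * (dg t * u2)))) := by
      rw [← mul_assoc (pm w), ← dg_pm, map_inv]
      group
    have e2 : e * ρ (dg z * u1 * dg z⁻¹ * u1⁻¹) = e := avg_mul ρ _ _ (comm_mem_NN hm hz hu1)
    have e3 : θ (fun i => z (w i)) = 1 := by
      rw [← hθ w, ← map_pow]; rfl
    beta_reduce
    rw [Module.End.mul_apply, ← Module.End.mul_apply (ρ (dg z)), ← map_mul, e1, map_mul,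
      Module.End.mul_apply, ← Module.End.mul_apply e, e2]
    simp only [map_mul, Module.End.mul_apply]
    rw [H.fixed u2 hu2, H.eig, map_smul, H.eig, e3, one_smul]
  apply trace_mem
  have hpow : ∀ k, (ρ x * e) ^ (k + 1) = ρ (x ^ (k + 1)) * e := by
    intro k
    induction k with
    | zero => simp
    | succ k ih =>
      rw [pow_succ, ih, mul_assoc, ← mul_assoc e, ← hcomm, mul_assoc, he, avg_idem, ← mul_assoc, ← map_mul,
        ← pow_succ]
  rw [hpow, pow_succ', hxz, map_mul, mul_assoc, hze]

end rep
end NT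


namespace NT
open Module

section syl
variable {F : Type} [Field F] [Finite F] {n : ℕ}
set_option linter.unusedSectionVars false

theorem dg_injective : Function.Injective (dg : (Fin n → Fˣ) →* Matrix.GeneralLinearGroup (Fin n) F) := by
  intro s t h
  funext i
  have h1 : (dg s : Matrix.GeneralLinearGroup (Fin n) F).1 i i = (dg t).1 i i := by rw [h]
  rw [dg_apply, dg_apply, if_pos rfl, if_pos rfl] at h1
  exact Units.ext h1

theorem card_fact {p : ℕ} [Fact p.Prime] (hodd : Odd p) (hpn : n < p)
    (hpq : p ∣ Nat.card F - 1) :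
    (Nat.card (Fin n → Fˣ)).factorization p =
      (Nat.card (Matrix.GeneralLinearGroup (Fin n) F)).factorization p := by
  have := Fintype.ofFinite F
  have hp : p.Prime := Fact.out
  have hq : 1 < Nat.card F := Finite.one_lt_card
  set q := Nat.card F with hqd
  have hpq' : ¬ p ∣ q := by
    intro h
    have h1 := (Nat.dvd_sub_iff_right hq.le h).mp hpq
    exact hp.one_lt.ne' (Nat.dvd_one.mp h1)
  have e1 : Nat.card (Fin n → Fˣ) = (q - 1) ^ n := by
    rw [Nat.card_fun, Nat.card_units, Nat.card_fin]
  rw [e1, Matrix.card_GL_field, Nat.factorization_pow, ← Nat.card_eq_fintype_card, ← hqd,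
    Nat.factorization_prod]
  · have : ∀ i : Fin n, (q ^ n - q ^ (i : ℕ)).factorization p = (q - 1).factorization p := by
      intro i
      have hi : (i : ℕ) < n := i.2
      have e2 : q ^ n - q ^ (i : ℕ) = q ^ (i : ℕ) * (q ^ (n - i) - 1 ^ (n - i)) := by
        rw [one_pow, Nat.mul_sub, ← pow_add, mul_one]
        congr 2
        omega
      have hne : q ^ (n - (i : ℕ)) - 1 ^ (n - (i : ℕ)) ≠ 0 := by
        rw [one_pow]
        have := Nat.one_lt_pow (by omega : n - (i : ℕ) ≠ 0) hq
        omega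
      rw [e2, Nat.factorization_mul (by positivity) hne, Nat.factorization_pow, Finsupp.add_apply,
        Finsupp.smul_apply, Nat.factorization_eq_zero_of_not_dvd hpq', smul_zero, zero_add,
        Nat.factorization_def _ hp, padicValNat.pow_sub_pow hodd hq hpq hpq' (by omega),
        padicValNat.eq_zero_of_not_dvd (n := n - i), add_zero, Nat.factorization_def _ hp]
      intro h
      have := Nat.le_of_dvd (by omega) h
      omega
    simp [this]
  · intro i _
    have hi : (i : ℕ) < n := i.2
    have := Nat.pow_lt_pow_right hq hi
    omega

theorem conj_diag {p : ℕ} [Fact p.Prime] (hodd : Odd p) (hpn : n < p)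
    (hpq : p ∣ Nat.card F - 1) :
    ∃ m : ℕ, m.Coprime p ∧ 0 < m ∧ ∀ x : Matrix.GeneralLinearGroup (Fin n) F, ∃ g d, ∃ r : Fin n → ℕ,
      (g * x * g⁻¹) ^ m = dg d ∧ Monotone r ∧ (∀ i j, r i = r j ↔ d i = d j) ∧ ∃ k, d ^ (p ^ k) = 1 := by
  have hp : p.Prime := Fact.out
  set G := Matrix.GeneralLinearGroup (Fin n) F
  set e := (Nat.card G).factorization p with he
  have hG : Nat.card G ≠ 0 := Nat.card_pos.ne'
  refine ⟨Nat.card G / p ^ e, (Nat.coprime_ordCompl hp hG).symm, Nat.ordCompl_pos p hG, fun x => ?_⟩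
  obtain ⟨Q⟩ : Nonempty (Sylow p (Fin n → Fˣ)) := inferInstance
  let P : Sylow p G := Sylow.ofCard (Q.1.map dg) (by
    rw [Subgroup.card_map_of_injective dg_injective, Sylow.card_eq_multiplicity, card_fact hodd hpn hpq])
  have hP : ∀ g : G, g ∈ P → ∃ d ∈ Q, dg d = g := fun g hg => hg
  set m := Nat.card G / p ^ e
  have hx : (x ^ m) ^ (p ^ e) = 1 := by
    rw [← pow_mul, mul_comm, Nat.ordProj_mul_ordCompl_eq_self, pow_card_eq_one']
  have hZ : IsPGroup p (Subgroup.zpowers (x ^ m)) := by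
    rintro ⟨y, hy⟩
    refine ⟨e, ?_⟩
    obtain ⟨k, rfl⟩ := Subgroup.mem_zpowers_iff.mp hy
    apply Subtype.ext
    change ((x ^ m) ^ k) ^ (p ^ e) = 1
    rw [← zpow_natCast, ← zpow_mul, mul_comm, zpow_mul, zpow_natCast, hx, one_zpow]
  obtain ⟨R, hR⟩ := hZ.exists_le_sylow
  obtain ⟨g, hg⟩ := MulAction.exists_smul_eq G R P
  have h1 : g * x ^ m * g⁻¹ ∈ P := by
    rw [← hg]
    have hxR : x ^ m ∈ R := hR (Subgroup.mem_zpowers _)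
    exact Subgroup.smul_mem_pointwise_smul (x ^ m) (MulAut.conj g) R.1 hxR
  obtain ⟨d, hdQ, hd⟩ := hP _ h1
  obtain ⟨k, hk⟩ := Q.2 ⟨d, hdQ⟩
  have hk' : d ^ (p ^ k) = 1 := congrArg Subtype.val hk
  obtain ⟨r0, hr0⟩ : ∃ r0 : Fˣ → ℕ, Function.Injective r0 :=
    ⟨_, Fin.val_injective.comp (Finite.equivFin Fˣ).injective⟩
  let σ := Tuple.sort (r0 ∘ d)
  refine ⟨(pm σ)⁻¹ * g, fun i => d (σ i), (r0 ∘ d) ∘ σ, ?_, Tuple.monotone_sort _, ?_, k, ?_⟩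
  · rw [conj_pow, mul_inv_rev, inv_inv]
    have : (pm σ)⁻¹ * g * x ^ m * (g⁻¹ * pm σ) = (pm σ)⁻¹ * (g * x ^ m * g⁻¹ * pm σ) := by group
    rw [this, ← hd, dg_pm, inv_mul_cancel_left]
  · intro i j
    exact hr0.eq_iff
  · funext i
    exact congrFun hk' (σ i)

variable {V : Type} [AddCommGroup V] [Module ℂ V] [FiniteDimensional ℂ V]
variable (ρ : Matrix.GeneralLinearGroup (Fin n) F →* End ℂ V)

theorem trace_conj (g x : Matrix.GeneralLinearGroup (Fin n) F) :
    LinearMap.trace ℂ V (ρ (g * x * g⁻¹)) = LinearMap.trace ℂ V (ρ x) := by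
  rw [map_mul, LinearMap.trace_mul_comm, ← map_mul, inv_mul_cancel_left]

theorem trace_regular (d : Fin n → Fˣ) (hd : Function.Injective d) :
    LinearMap.trace ℂ V (ρ (dg d)) = LinearMap.trace ℂ V (ρ (dg d) * avg ρ (UU F n)) :=
  ((trace_NN ρ (dg d) d (fun i => (i : ℕ)) (fun i j => ⟨fun h => by rw [Fin.ext h], fun h => by
    rw [hd h]⟩) 1 (pow_one _)).2).symm

theorem main {p : ℕ} [Fact p.Prime] (hodd : Odd p) (hpn : n < p)
    (hpq : p ∣ Nat.card F - 1)
    (hirr : ∀ W : Submodule ℂ V, (∀ g, ∀ v ∈ W, ρ g v ∈ W) → ∀ v ∈ W, v ≠ 0 → W = ⊤)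
    (hdeg : ¬ p ∣ finrank ℂ V) :
    ∃ b m : ℕ, m.Coprime p ∧ 0 < m ∧ (∀ x, LinearMap.trace ℂ V (ρ x) ∈ Qcyc (p ^ b * m)) ∧
      (2 ≤ b → ∃ y k, y ^ (p ^ k) = 1 ∧ LinearMap.trace ℂ V (ρ y) ∈ Qcyc (p ^ b) ∧
        LinearMap.trace ℂ V (ρ y) ∉ Qcyc (p ^ (b - 1))) := by
  classical
  have hp : p.Prime := Fact.out
  obtain ⟨ζ, hζ⟩ : ∃ ζ : Fˣ, orderOf ζ = p :=
    exists_prime_orderOf_dvd_card' p (by rwa [Nat.card_units])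
  obtain ⟨v, θ, H⟩ := exists_HW ρ hirr (avg_UU_ne ρ hpn ζ hζ hdeg)
  obtain ⟨κ, _, a, ha⟩ := H.trace
  have hζinj : ∀ i j : Fin n, ζ ^ (i : ℕ) = ζ ^ (j : ℕ) → i = j := by
    intro i j h
    exact Fin.ext (pow_injOn_Iio_orderOf (by rw [hζ]; exact i.2.trans hpn)
      (by rw [hζ]; exact j.2.trans hpn) h)
  have hζp : ∀ i : ℕ, (ζ ^ i) ^ p = 1 := by
    intro i
    rw [← pow_mul, mul_comm, pow_mul, ← hζ, pow_orderOf_eq_one, one_pow]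
  -- the number of weights is prime to `p`
  have hκ : ¬ p ∣ Fintype.card κ := by
    intro hdvd
    let d : Fin n → Fˣ := fun j => ζ ^ (j : ℕ)
    have hdp : d ^ p = 1 := funext fun i => hζp i
    have h1 := trace_regular ρ d (fun i j h => hζinj i j h)
    rw [ha] at h1
    obtain ⟨S, hS1, hS2, hS3⟩ := trace_roots_one (ρ (dg d)) p (by
      rw [← map_pow, ← map_pow, hdp, map_one, map_one])
    have h3 := dvd_card_sub (p := p) 0 S (Finset.univ.val.map fun k => θ (fun i => d (a k i)))
      (by simpa using hS3) (by
        intro z hz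
        obtain ⟨k, -, rfl⟩ := Multiset.mem_map.mp hz
        rw [zero_add, pow_one, ← map_pow, ← map_one θ]
        congr 1
        funext i
        exact hζp _) (by rw [hS1, h1]; rfl)
    rw [hS2, Multiset.card_map] at h3
    apply hdeg
    have h4 : (p : ℤ) ∣ (Fintype.card κ : ℤ) := by exact_mod_cast hdvd
    have h5 := (Int.dvd_iff_dvd_of_dvd_sub h3).mpr h4
    exact_mod_cast h5
  -- the level `b`
  let Pb : ℕ → Prop := fun b => ∀ s : Fin n → Fˣ, (∃ k, s ^ (p ^ k) = 1) → θ s ^ (p ^ b) = 1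
  have hex : ∃ b, Pb b := by
    refine ⟨(Nat.card (Fin n → Fˣ)).factorization p, ?_⟩
    rintro s ⟨k, hk⟩
    obtain ⟨j, -, hj⟩ := (Nat.dvd_prime_pow hp).mp (orderOf_dvd_of_pow_eq_one hk)
    have h1 : orderOf s ∣ p ^ (Nat.card (Fin n → Fˣ)).factorization p := by
      have h2 := orderOf_dvd_natCard s
      rw [hj] at h2 ⊢
      exact (hp.pow_dvd_iff_dvd_ordProj Nat.card_pos.ne').mp h2
    rw [← map_pow, orderOf_dvd_iff_pow_eq_one.mp h1, map_one]
  obtain ⟨b, hb, hbmin⟩ : ∃ b, Pb b ∧ ∀ b' < b, ¬ Pb b' :=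
    ⟨Nat.find hex, Nat.find_spec hex, fun b' h => Nat.find_min hex h⟩
  obtain ⟨m, hm1, hm0, hm⟩ := conj_diag (F := F) (n := n) hodd hpn hpq
  refine ⟨b, m, hm1, hm0, ?_, ?_⟩
  · intro x
    obtain ⟨g, d, r, h1, h2, h3, k, h4⟩ := hm x
    rw [← trace_conj ρ g x]
    refine H.upper _ d r h3 h2 m (p ^ b) h1 fun w => hb _ ⟨k, ?_⟩
    funext i
    exact congrFun h4 (w i)
  · intro hb2
    obtain ⟨c, rfl⟩ : ∃ c, b = c + 1 := ⟨b - 1, by omega⟩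
    have hc1 : 1 ≤ c := by omega
    have hbc := hbmin c (by omega)
    simp only [Pb] at hbc
    push Not at hbc
    obtain ⟨s, ⟨k, hk⟩, hs⟩ := hbc
    obtain ⟨k0, hk0⟩ : ∃ k0, θ (Pi.mulSingle k0 (s k0)) ^ (p ^ c) ≠ 1 := by
      by_contra hcon
      push Not at hcon
      apply hs
      have h1 : s = ∏ i, Pi.mulSingle i (s i) := (Finset.univ_prod_mulSingle s).symm
      rw [h1, map_prod, ← Finset.prod_pow]
      exact Finset.prod_eq_one fun i _ => hcon i
    set t := s k0 with ht
    have htk : t ^ (p ^ k) = 1 := congrFun hk k0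
    have hsing : ∀ (i : Fin n) (e : ℕ), (Pi.mulSingle i t : Fin n → Fˣ) ^ e = Pi.mulSingle i (t ^ e) :=
      fun i e => (map_pow (MonoidHom.mulSingle (fun _ : Fin n => Fˣ) i) t e).symm
    set ω := θ (Pi.mulSingle k0 t) with hω
    have hω1 : ω ^ (p ^ (c + 1)) = 1 := hb _ ⟨k, by rw [hsing, htk, Pi.mulSingle_one]⟩
    have hprim : IsPrimitiveRoot ω (p ^ (c + 1)) := by
      rw [IsPrimitiveRoot.iff_orderOf]
      exact orderOf_eq_prime_pow hk0 hω1
    have htp : t ^ p ≠ 1 := by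
      intro h
      apply hk0
      obtain ⟨c', rfl⟩ : ∃ c', c = c' + 1 := ⟨c - 1, by omega⟩
      rw [hω, ← map_pow, hsing, pow_succ', pow_mul, h, one_pow, Pi.mulSingle_one, map_one]
    let y : Fin n → Fin n → Fˣ := fun i j => if j = i then t else ζ ^ (j : ℕ)
    have hyinj : ∀ i, Function.Injective (y i) := by
      intro i j l h
      simp only [y] at h
      split_ifs at h with h1 h2 h2
      · rw [h1, h2]
      · exact absurd (hζp l) (h ▸ htp)
      · exact absurd (hζp j) (h.symm ▸ htp)
      · exact hζinj j l h
    have hy1 : ∀ i j, y i j ^ (p ^ (k + 1)) = 1 := by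
      intro i j
      simp only [y]
      split_ifs
      · rw [pow_succ, pow_mul, htk, one_pow]
      · rw [pow_succ', pow_mul, hζp, one_pow]
    have hroots : ∀ i l, θ (fun j => y i (a l j)) ^ (p ^ (c + 1)) = 1 := fun i l =>
      hb _ ⟨k + 1, funext fun j => hy1 i (a l j)⟩
    have htr : ∀ i, LinearMap.trace ℂ V (ρ (dg (y i))) = ∑ l, θ (fun j => y i (a l j)) := fun i => by
      rw [trace_regular ρ _ (hyinj i), ha]
    by_contra hcon
    push Not at hcon
    have hmem : ∀ i, ∑ l, θ (fun j => y i (a l j)) ∈ Qcyc (p ^ c) := by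
      intro i
      rw [← htr]
      refine hcon (dg (y i)) (k + 1) ?_ ?_
      · rw [← map_pow, ← map_one dg]
        congr 1
        exact funext (hy1 i)
      · rw [htr]
        exact sum_mem fun l _ => mem_Qcyc (hroots i l)
    have hext := fun i => extract hc1 hprim Finset.univ (fun l => θ (fun j => y i (a l j)))
      (fun l _ => hroots i l) (hmem i)
    have hval : ∀ i l, θ (fun j => y i (a l j)) ^ (p ^ c) =
        θ (Pi.mulSingle ((a l).symm i) t) ^ (p ^ c) := by
      intro i l
      rw [← map_pow, ← map_pow, hsing]
      congr 1
      funext j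
      simp only [Pi.pow_apply, y]
      by_cases h : a l j = i
      · have : j = (a l).symm i := by rw [← h, Equiv.symm_apply_apply]
        rw [if_pos h, this, Pi.mulSingle_eq_same]
      · have : j ≠ (a l).symm i := by rintro rfl; simp at h
        rw [if_neg h, Pi.mulSingle_eq_of_ne this]
        obtain ⟨c', rfl⟩ : ∃ c', c = c' + 1 := ⟨c - 1, by omega⟩
        rw [pow_succ', pow_mul, hζp, one_pow]
    simp_rw [hval] at hext
    have hsum := Finset.dvd_sum (s := Finset.univ) fun i _ => hext i
    simp_rw [Finset.card_filter] at hsum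
    rw [Finset.sum_comm] at hsum
    have hin : ∀ l : κ, ∑ i : Fin n, (if θ (Pi.mulSingle ((a l).symm i) t) ^ (p ^ c) = ω ^ (p ^ c) then 1 else 0)
        = (Finset.univ.filter fun i : Fin n => θ (Pi.mulSingle i t) ^ (p ^ c) = ω ^ (p ^ c)).card := by
      intro l
      rw [Finset.card_filter]
      exact Equiv.sum_comp (a l).symm (fun i => if θ (Pi.mulSingle i t) ^ (p ^ c) = ω ^ (p ^ c) then 1 else 0)
    rw [Finset.sum_congr rfl fun l _ => hin l, Finset.sum_const, Finset.card_univ, smul_eq_mul] at hsum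
    rcases hp.dvd_mul.mp hsum with h | h
    · exact hκ h
    · have h1 := Nat.le_of_dvd (Finset.card_pos.mpr ⟨k0, by simp [hω]⟩) h
      have h2 := Finset.card_le_univ (Finset.univ.filter fun i : Fin n =>
        θ (Pi.mulSingle i t) ^ (p ^ c) = ω ^ (p ^ c))
      rw [Fintype.card_fin] at h2
      omega

end syl
end NT


/-- Property 1.3 holds for `GLₙ(F_q)` and any odd prime `p` with `p ∣ q - 1`
and `p > n`, for every irreducible character of degree not divisible by `p`. -/
theorem stmt13 (F : Type) [Field F] [Fintype F] [DecidableEq F]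
    (n : ℕ) (hn : 1 ≤ n)
    (p : ℕ) (hp : p.Prime) (hodd : Odd p)
    (hpq : p ∣ Fintype.card F - 1) (hpn : n < p)
    (V : FDRep ℂ (Matrix.GeneralLinearGroup (Fin n) F)) (hV : Simple V)
    (hdeg : ¬ p ∣ Module.finrank ℂ V) :
    Property13 V.character p := by
  have : Fact p.Prime := ⟨hp⟩
  rw [← Nat.card_eq_fintype_card] at hpq
  obtain ⟨b, m, hm, hm0, hup, hlow⟩ := NT.main V.ρ hodd hpn hpq
    (fun W hW v hv hv0 => NT.invariant_eq_top V hV W hW v hv hv0) hdeg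
  have hp2 : p ≠ 2 := by rintro rfl; exact absurd hodd (by decide)
  intro f hf
  have hf0 : 0 < f := hf.1.1
  have hfv : ∀ g, V.character g ∈ Qcyc f := hf.1.2
  have hup' : ∀ g, V.character g ∈ Qcyc (p ^ b * m) := hup
  have : NeZero f := ⟨hf0.ne'⟩
  have : NeZero (p ^ b * m) := ⟨(Nat.mul_pos (pow_pos hp.pos b) hm0).ne'⟩
  have : NeZero (p ^ b) := ⟨pow_ne_zero _ hp.ne_zero⟩
  by_cases ha : f.factorization p ≤ 1
  · refine ⟨1, ⟨0, by simp⟩, ?_⟩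
    rw [FDRep.char_one]
    exact NT.not_dvd_small hp ha _
  · have hdvd : f ∣ p ^ b * m := by
      have h1 : ∀ g, V.character g ∈ Qcyc (f.gcd (p ^ b * m)) := by
        intro g
        rw [← NT.Qcyc_inf]
        exact ⟨hfv g, hup' g⟩
      have h2 : f ≤ f.gcd (p ^ b * m) := hf.2 ⟨Nat.gcd_pos_of_pos_left _ hf0, h1⟩
      have h3 : f.gcd (p ^ b * m) = f := le_antisymm (Nat.gcd_le_left _ hf0) h2
      exact Nat.gcd_eq_left_iff_dvd.mp h3
    set a := f.factorization p with ha'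
    have hpa : p ^ a ∣ f := Nat.ordProj_dvd f p
    have hab : p ^ a ∣ p ^ b :=
      (Nat.Coprime.pow_left a hm.symm).dvd_of_dvd_mul_right (hpa.trans hdvd)
    have hab' : a ≤ b := (Nat.pow_dvd_pow_iff_le_right hp.one_lt).mp hab
    obtain ⟨y, k, hy, hy1, hy2⟩ := hlow (by omega)
    refine ⟨y, ?_, ?_⟩
    · obtain ⟨j, -, hj⟩ := (Nat.dvd_prime_pow hp).mp (orderOf_dvd_of_pow_eq_one hy)
      exact ⟨j, hj⟩
    · have h1 : V.character y ∈ Qcyc (f.gcd (p ^ b)) := by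
        rw [← NT.Qcyc_inf]
        exact ⟨hfv y, hy1⟩
      obtain ⟨j, hjb, hj⟩ := (Nat.dvd_prime_pow hp).mp (Nat.gcd_dvd_right f (p ^ b))
      have hja : j ≤ a := by
        have : p ^ j ∣ f := hj ▸ Nat.gcd_dvd_left f (p ^ b)
        exact (hp.pow_dvd_iff_le_factorization hf0.ne').mp this
      rw [hj] at h1
      have hjb' : b ≤ j := by
        by_contra hlt
        exact hy2 (NT.Qcyc_mono (pow_dvd_pow p (by omega)) h1)
      have hba : b = a := by omega
      obtain ⟨c, hc⟩ : ∃ c, a = c + 1 := ⟨a - 1, by omega⟩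
      rw [hc]
      rw [hba, hc] at hy1 hy2
      exact NT.not_dvd_relfinrank hp2 (by omega) hy1 hy2
end
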